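/- As n → ∞, the number X_n of accessible direct paths converges in distribution to a mixed Poisson law with mixture Z·Z' for Z, Z' independent rate-1 exponentials: for every x ∈ ℕ, lim_{n→∞} P(X_n = x) = ∫₀^∞ ∫₀^∞ ((z·z')^x / x!) · e^{−z·z'} · e^{−z} · e^{−z'} dz dz'. -/

import Mathlib

open MeasureTheory Filter

namespace RandomHypercube

/-- Index of a (potential) hypercube edge: the lower endpoint `A` together with the
direction `i` that is added, representing the edge from `A` to `A ∪ {i}`. -/
abbrev EdgeIdx (n : ℕ) := Finset (Fin n) × Fin n

/-- The sample space: an i.i.d. Uniform[0,1] weight for each edge index. -/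
abbrev CubeOmega (n : ℕ) := EdgeIdx n → ℝ

/-- The product of uniform measures on [0,1], one for each edge. -/
noncomputable def cubeMeasure (n : ℕ) : Measure (CubeOmega n) :=
  Measure.pi fun _ => (volume : Measure ℝ).restrict (Set.Icc 0 1)

/-- The vertex visited by the direct path associated to the permutation `σ`
just before taking its `j`-th step: the image under `σ` of `{0, …, j-1}`. -/
def initSeg (n : ℕ) (σ : Equiv.Perm (Fin n)) (j : Fin n) : Finset (Fin n) :=
  (Finset.univ.filter fun i => i < j).image σ

/-- The edge used in the `j`-th step of the direct path associated to `σ`. -/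
def pathEdge (n : ℕ) (σ : Equiv.Perm (Fin n)) (j : Fin n) : EdgeIdx n :=
  (initSeg n σ j, σ j)

/-- The direct path associated to `σ` is accessible if its successive edge
weights are strictly increasing. -/
def Accessible (n : ℕ) (σ : Equiv.Perm (Fin n)) (ω : CubeOmega n) : Prop :=
  StrictMono fun j : Fin n => ω (pathEdge n σ j)

/-- The number of accessible direct paths from `∅` to `[n]`. -/
noncomputable def X (n : ℕ) (ω : CubeOmega n) : ℕ :=
  Nat.card {σ : Equiv.Perm (Fin n) // Accessible n σ ω}

end RandomHypercube

set_option linter.unusedSectionVars false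
set_option linter.unusedVariables false
namespace RHP
open MeasureTheory Filter Set
open scoped Classical in
/-- keep coordinates in `D` from `ω`, the rest from `ω'` -/
noncomputable def glue {ι : Type*} (D : Set ι) (ω ω' : ι → ℝ) : ι → ℝ :=
  fun i => if i ∈ D then ω i else ω' i

noncomputable abbrev unif : Measure ℝ := (volume : Measure ℝ).restrict (Set.Icc 0 1)

instance : IsProbabilityMeasure unif := ⟨by simp [unif]⟩

noncomputable def pm (ι : Type*) [Fintype ι] : Measure (ι → ℝ) := Measure.pi fun _ => unif

section
variable {ι : Type*} [Fintype ι]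

instance : IsProbabilityMeasure (pm ι) := by unfold pm; infer_instance

lemma glue_mem {D : Set ι} {ω ω' : ι → ℝ} {i : ι} (h : i ∈ D) : glue D ω ω' i = ω i := by
  simp [glue, h]
lemma glue_not_mem {D : Set ι} {ω ω' : ι → ℝ} {i : ι} (h : i ∉ D) : glue D ω ω' i = ω' i := by
  simp [glue, h]

lemma measurable_glue (D : Set ι) :
    Measurable (fun z : (ι → ℝ) × (ι → ℝ) => glue D z.1 z.2) := by
  refine measurable_pi_lambda _ fun i => ?_
  by_cases h : i ∈ D
  · simp only [glue_mem h]; fun_prop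
  · simp only [glue_not_mem h]; fun_prop

lemma mp_glue (D : Set ι) :
    MeasurePreserving (fun z : (ι → ℝ) × (ι → ℝ) => glue D z.1 z.2) ((pm ι).prod (pm ι)) (pm ι) := by
  classical
  refine ⟨measurable_glue D, ?_⟩
  symm
  refine Measure.pi_eq fun s hs => ?_
  rw [Measure.map_apply (measurable_glue D) (MeasurableSet.univ_pi hs)]
  have : (fun z : (ι → ℝ) × (ι → ℝ) => glue D z.1 z.2) ⁻¹' (Set.univ.pi s)
      = (Set.univ.pi fun i => if i ∈ D then s i else Set.univ) ×ˢ
        (Set.univ.pi fun i => if i ∈ D then Set.univ else s i) := by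
    ext ⟨a, b⟩
    simp only [Set.mem_preimage, Set.mem_univ_pi, Set.mem_prod]
    constructor
    · intro h
      refine ⟨fun i => ?_, fun i => ?_⟩
      · by_cases hi : i ∈ D
        · have := h i; rw [glue_mem hi] at this; simpa [hi]
        · simp [hi]
      · by_cases hi : i ∈ D
        · simp [hi]
        · have := h i; rw [glue_not_mem hi] at this; simpa [hi]
    · rintro ⟨h1, h2⟩ i
      by_cases hi : i ∈ D
      · rw [glue_mem hi]; simpa [hi] using h1 i
      · rw [glue_not_mem hi]; simpa [hi] using h2 i
  rw [this, Measure.prod_prod, pm, Measure.pi_pi, Measure.pi_pi, ← Finset.prod_mul_distrib]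
  refine Finset.prod_congr rfl fun i _ => ?_
  have hu : unif Set.univ = 1 := measure_univ
  by_cases hi : i ∈ D <;> simp only [hi, if_true, if_false, hu, mul_one, one_mul]

/-- bounded measurable -/
def BM (f : (ι → ℝ) → ℝ) : Prop := Measurable f ∧ ∃ C, ∀ ω, |f ω| ≤ C

lemma BM.meas {f : (ι → ℝ) → ℝ} (h : BM f) : Measurable f := h.1

lemma bint {Ω : Type*} [MeasurableSpace Ω] {μ : Measure Ω} [IsFiniteMeasure μ] {f : Ω → ℝ}
    (h : Measurable f) {C : ℝ} (hC : ∀ ω, |f ω| ≤ C) : Integrable f μ :=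
  Integrable.of_bound h.aestronglyMeasurable C (ae_of_all _ fun ω => by simpa using hC ω)

lemma BM.int {f : (ι → ℝ) → ℝ} (h : BM f) : Integrable f (pm ι) := by
  obtain ⟨h1, C, hC⟩ := h; exact bint h1 hC

lemma BM.const (c : ℝ) : BM (fun _ : ι → ℝ => c) := ⟨measurable_const, |c|, fun _ => le_rfl⟩

lemma BM.add {f g : (ι → ℝ) → ℝ} (hf : BM f) (hg : BM g) : BM (fun ω => f ω + g ω) := by
  obtain ⟨h1, C, hC⟩ := hf; obtain ⟨h2, D, hD⟩ := hg
  exact ⟨h1.add h2, C + D, fun ω => (abs_add_le _ _).trans (add_le_add (hC ω) (hD ω))⟩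
lemma BM.sub {f g : (ι → ℝ) → ℝ} (hf : BM f) (hg : BM g) : BM (fun ω => f ω - g ω) := by
  obtain ⟨h1, C, hC⟩ := hf; obtain ⟨h2, D, hD⟩ := hg
  exact ⟨h1.sub h2, C + D, fun ω => (abs_sub _ _).trans (add_le_add (hC ω) (hD ω))⟩
lemma BM.mul {f g : (ι → ℝ) → ℝ} (hf : BM f) (hg : BM g) : BM (fun ω => f ω * g ω) := by
  obtain ⟨h1, C, hC⟩ := hf; obtain ⟨h2, D, hD⟩ := hg
  refine ⟨h1.mul h2, C * D, fun ω => ?_⟩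
  rw [abs_mul]
  exact mul_le_mul (hC ω) (hD ω) (abs_nonneg _) ((abs_nonneg _).trans (hC ω))
lemma BM.abs {f : (ι → ℝ) → ℝ} (hf : BM f) : BM (fun ω => |f ω|) := by
  obtain ⟨h1, C, hC⟩ := hf
  exact ⟨h1.abs, C, fun ω => by simpa using hC ω⟩
lemma BM.sum {κ : Type*} (s : Finset κ) {f : κ → (ι → ℝ) → ℝ} (hf : ∀ k ∈ s, BM (f k)) :
    BM (fun ω => ∑ k ∈ s, f k ω) := by
  classical
  induction s using Finset.induction_on with
  | empty => simpa using BM.const 0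
  | insert a s ha ih =>
    simp only [Finset.sum_insert ha]
    exact (hf a (by simp)).add (ih fun k hk => hf k (by simp [hk]))
lemma BM.prod {κ : Type*} (s : Finset κ) {f : κ → (ι → ℝ) → ℝ} (hf : ∀ k ∈ s, BM (f k)) :
    BM (fun ω => ∏ k ∈ s, f k ω) := by
  classical
  induction s using Finset.induction_on with
  | empty => simpa using BM.const 1
  | insert a s ha ih =>
    simp only [Finset.prod_insert ha]
    exact (hf a (by simp)).mul (ih fun k hk => hf k (by simp [hk]))
lemma BM.of01 {f : (ι → ℝ) → ℝ} (hf : Measurable f) (h : ∀ ω, 0 ≤ f ω ∧ f ω ≤ 1) : BM f :=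
  ⟨hf, 1, fun ω => abs_le.2 ⟨by linarith [(h ω).1], (h ω).2⟩⟩
lemma BM.comp {f : (ι → ℝ) → ℝ} {g : (ι → ℝ) → (ι → ℝ)} (hf : BM f) (hg : Measurable g) :
    BM (fun ω => f (g ω)) := by
  obtain ⟨h1, C, hC⟩ := hf
  exact ⟨h1.comp hg, C, fun ω => hC _⟩

lemma measurable_glue_right (D : Set ι) (ω : ι → ℝ) : Measurable (fun ω' => glue D ω ω') :=
  (measurable_glue D).comp measurable_prodMk_left

lemma BM.glue {f : (ι → ℝ) → ℝ} (hf : BM f) (D : Set ι) (ω : ι → ℝ) :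
    BM (fun ω' => f (glue D ω ω')) := hf.comp (measurable_glue_right D ω)

/-- conditional expectation given the coordinates in `D` -/
noncomputable def R (D : Set ι) (f : (ι → ℝ) → ℝ) (ω : ι → ℝ) : ℝ := ∫ ω', f (glue D ω ω') ∂(pm ι)

lemma BM.R {f : (ι → ℝ) → ℝ} (hf : BM f) (D : Set ι) : BM (R D f) := by
  obtain ⟨h1, C, hC⟩ := hf
  refine ⟨?_, C, fun ω => ?_⟩
  · exact ((h1.comp (measurable_glue D)).stronglyMeasurable.integral_prod_right').measurable
  · unfold RHP.R
    have := norm_integral_le_of_norm_le_const (μ := pm ι) (C := C)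
      (f := fun ω' => f (RHP.glue D ω ω')) (ae_of_all _ fun ω' => by simpa using hC _)
    simpa using this

lemma int_glue {f : (ι → ℝ) → ℝ} (hf : BM f) (D : Set ι) :
    ∫ z, f (glue D z.1 z.2) ∂((pm ι).prod (pm ι)) = ∫ ω, f ω ∂(pm ι) := by
  have h := mp_glue D
  conv_rhs => rw [← h.map_eq]
  rw [integral_map h.measurable.aemeasurable
    (by rw [h.map_eq]; exact hf.meas.aestronglyMeasurable)]

lemma int_R {f : (ι → ℝ) → ℝ} (hf : BM f) (D : Set ι) :
    ∫ ω, R D f ω ∂(pm ι) = ∫ ω, f ω ∂(pm ι) := by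
  rw [← int_glue hf D, integral_prod]
  · rfl
  · obtain ⟨h1, C, hC⟩ := hf
    exact bint (h1.comp (measurable_glue D)) (C := C) fun z => hC _

lemma glue_glue {D D' : Set ι} (h : D ⊆ D') (a b c : ι → ℝ) :
    glue D' (glue D a b) c = glue D a (glue D' b c) := by
  funext i
  by_cases hi : i ∈ D
  · rw [glue_mem (h hi), glue_mem hi, glue_mem hi]
  · by_cases hi' : i ∈ D'
    · rw [glue_mem hi', glue_not_mem hi, glue_not_mem hi, glue_mem hi']
    · rw [glue_not_mem hi', glue_not_mem hi, glue_not_mem hi']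

lemma R_tower {D D' : Set ι} (h : D ⊆ D') {f : (ι → ℝ) → ℝ} (hf : BM f) :
    R D (R D' f) = R D f := by
  funext ω
  have := int_R (hf.glue D ω) D'
  unfold R at *
  rw [← this]
  simp only [glue_glue h]

lemma R_mono {D : Set ι} {f g : (ι → ℝ) → ℝ} (hf : BM f) (hg : BM g) (h : ∀ ω, f ω ≤ g ω) (ω) :
    R D f ω ≤ R D g ω :=
  integral_mono (hf.glue D ω).int (hg.glue D ω).int fun _ => h _

lemma R_nonneg {D : Set ι} {f : (ι → ℝ) → ℝ} (h : ∀ ω, 0 ≤ f ω) (ω) :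
    0 ≤ R D f ω := integral_nonneg fun _ => h _

lemma indep_mul {f g : (ι → ℝ) → ℝ} {P Q : Set ι} (hf : BM f) (hg : BM g)
    (hP : DependsOn f P) (hQ : DependsOn g Q) (hd : Disjoint P Q) :
    ∫ ω, f ω * g ω ∂(pm ι) = (∫ ω, f ω ∂(pm ι)) * ∫ ω, g ω ∂(pm ι) := by
  rw [← int_glue (hf.mul hg) P, ← integral_prod_mul]
  refine integral_congr_ae (ae_of_all _ fun z => ?_)
  have h1 : f (glue P z.1 z.2) = f z.1 := hP fun i hi => glue_mem hi
  have h2 : g (glue P z.1 z.2) = g z.2 :=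
    hQ fun i hi => glue_not_mem fun hp => (Set.disjoint_left.1 hd hp hi)
  simp only [h1, h2]

lemma dep_glue {f : (ι → ℝ) → ℝ} {P : Set ι} (hP : DependsOn f P) (D : Set ι) (ω : ι → ℝ) :
    DependsOn (fun ω' => f (glue D ω ω')) (P \ D) := by
  intro a b h
  refine hP fun i hi => ?_
  by_cases hD : i ∈ D
  · rw [glue_mem hD, glue_mem hD]
  · rw [glue_not_mem hD, glue_not_mem hD]; exact h i ⟨hi, hD⟩

lemma dep_R {f : (ι → ℝ) → ℝ} {P : Set ι} (hP : DependsOn f P) (D : Set ι) :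
    DependsOn (R D f) (P ∩ D) := by
  intro a b h
  unfold R
  refine integral_congr_ae (ae_of_all _ fun ω => ?_)
  refine hP fun i hi => ?_
  by_cases hD : i ∈ D
  · rw [glue_mem hD, glue_mem hD]; exact h i ⟨hi, hD⟩
  · rw [glue_not_mem hD, glue_not_mem hD]

lemma R_mul {f g : (ι → ℝ) → ℝ} {P Q D : Set ι} (hf : BM f) (hg : BM g)
    (hP : DependsOn f P) (hQ : DependsOn g Q) (hd : P ∩ Q ⊆ D) (ω) :
    R D (fun ω => f ω * g ω) ω = R D f ω * R D g ω := by
  refine indep_mul (hf.glue D ω) (hg.glue D ω) (dep_glue hP D ω) (dep_glue hQ D ω) ?_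
  rw [Set.disjoint_left]
  rintro i ⟨h1, h2⟩ ⟨h3, _⟩
  exact h2 (hd ⟨h1, h3⟩)

lemma R_sq_le {f : (ι → ℝ) → ℝ} (hf : BM f) (D : Set ι) (ω) :
    (R D f ω) ^ 2 ≤ R D (fun ω => f ω * f ω) ω := by
  have hg := hf.glue D ω
  set c := R D f ω with hc
  have h0 : 0 ≤ ∫ ω', (f (glue D ω ω') - c) * (f (glue D ω ω') - c) ∂(pm ι) :=
    integral_nonneg fun _ => mul_self_nonneg _
  have h1 : ∫ ω', (f (glue D ω ω') - c) * (f (glue D ω ω') - c) ∂(pm ι)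
      = R D (fun ω => f ω * f ω) ω - 2 * c * c + c * c := by
    have : ∀ ω', (f (glue D ω ω') - c) * (f (glue D ω ω') - c)
      = f (glue D ω ω') * f (glue D ω ω') - 2 * c * f (glue D ω ω') + c * c := by intro; ring
    simp only [this]
    rw [integral_add (((hg.mul hg).sub ((BM.const _).mul hg)).int) (BM.const _).int,
      integral_sub ((hg.mul hg).int) ((BM.const _).mul hg).int, integral_const_mul]
    simp [hc, R]
  nlinarith

lemma mp_eval (i : ι) : MeasurePreserving (fun ω : ι → ℝ => ω i) (pm ι) unif :=
  measurePreserving_eval (μ := fun _ : ι => unif) i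

/-- Fubini in one coordinate -/
lemma int_coord [DecidableEq ι] (i : ι) {f : (ι → ℝ) → ℝ} (hf : BM f) :
    ∫ ω, f ω ∂(pm ι) = ∫ v, (∫ ω, f (Function.update ω i v) ∂(pm ι)) ∂unif := by
  have hm : Measurable (fun z : ℝ × (ι → ℝ) => f (Function.update z.2 i z.1)) := by
    refine hf.1.comp (measurable_pi_lambda _ fun j => ?_)
    by_cases h : j = i
    · subst h; simp only [Function.update_self]; fun_prop
    · simp only [Function.update_of_ne h]; fun_prop
  rw [← int_R hf {i}, ← (mp_eval i).map_eq, integral_map (mp_eval i).measurable.aemeasurable]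
  · refine integral_congr_ae (ae_of_all _ fun ω => ?_)
    unfold R
    refine integral_congr_ae (ae_of_all _ fun ω' => ?_)
    simp only
    congr 1
    funext j
    by_cases h : j = i
    · subst h; rw [glue_mem (by simp)]; simp
    · rw [glue_not_mem (by simpa using h), Function.update_of_ne h]
  · exact hm.stronglyMeasurable.integral_prod_right'.aestronglyMeasurable

lemma mp_perm (τ : ι ≃ ι) : MeasurePreserving (fun ω : ι → ℝ => fun i => ω (τ i)) (pm ι) (pm ι) := by
  refine ⟨by fun_prop, ?_⟩
  symm
  refine Measure.pi_eq fun s hs => ?_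
  rw [Measure.map_apply (by fun_prop) (MeasurableSet.univ_pi hs)]
  have : (fun ω : ι → ℝ => fun i => ω (τ i)) ⁻¹' (Set.univ.pi s)
      = Set.univ.pi fun i => s (τ.symm i) := by
    ext ω
    simp only [Set.mem_preimage, Set.mem_univ_pi]
    constructor
    · intro h i; simpa using h (τ.symm i)
    · intro h i; simpa using h (τ i)
  rw [this, pm, Measure.pi_pi]
  exact Equiv.prod_comp τ.symm (fun i => unif (s i))

lemma mp_refl1 : MeasurePreserving (fun x : ℝ => 1 - x) unif unif := by
  have h := (Measure.measurePreserving_sub_left (volume : Measure ℝ) 1).restrict_preimage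
    (s := Set.Icc (0:ℝ) 1) measurableSet_Icc
  have e : (fun x : ℝ => 1 - x) ⁻¹' Set.Icc 0 1 = Set.Icc 0 1 := by
    ext x; simp only [Set.mem_preimage, Set.mem_Icc]; constructor <;> rintro ⟨a, b⟩ <;> constructor <;> linarith
  rwa [e] at h

lemma mp_reflect : MeasurePreserving (fun ω : ι → ℝ => fun i => 1 - ω i) (pm ι) (pm ι) :=
  measurePreserving_pi (fun _ : ι => unif) (fun _ : ι => unif) fun _ => mp_refl1

lemma int_mp {T : (ι → ℝ) → (ι → ℝ)} (hT : MeasurePreserving T (pm ι) (pm ι)) {f : (ι → ℝ) → ℝ}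
    (hf : BM f) : ∫ ω, f (T ω) ∂(pm ι) = ∫ ω, f ω ∂(pm ι) := by
  conv_rhs => rw [← hT.map_eq]
  rw [integral_map hT.measurable.aemeasurable
    (by rw [hT.map_eq]; exact hf.meas.aestronglyMeasurable)]

lemma int_prod_coord (f : ι → ℝ → ℝ) :
    ∫ ω, ∏ i, f i (ω i) ∂(pm ι) = ∏ i, ∫ v, f i v ∂unif :=
  integral_fintype_prod_eq_prod f

lemma unif_int (f : ℝ → ℝ) : ∫ v, f v ∂unif = ∫ v in (0:ℝ)..1, f v := by
  rw [intervalIntegral.integral_of_le zero_le_one, integral_Icc_eq_integral_Ioc]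

lemma ae_unif : ∀ᵐ v ∂unif, 0 < v ∧ v < 1 := by
  have : ∀ᵐ v ∂(volume.restrict (Set.Ioo (0:ℝ) 1)), 0 < v ∧ v < 1 :=
    (ae_restrict_mem measurableSet_Ioo).mono fun v hv => hv
  rwa [unif, ← Measure.restrict_congr_set Ioo_ae_eq_Icc]

lemma ae_coord : ∀ᵐ ω ∂(pm ι), ∀ i, 0 < ω i ∧ ω i < 1 := by
  rw [ae_all_iff]
  intro i
  exact (mp_eval i).quasiMeasurePreserving.ae ae_unif

end
end RHP

namespace RHP
open MeasureTheory Filter Set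

lemma beta_int (x : ℝ) (q : ℕ) : ∀ p : ℕ, ∫ v in (0:ℝ)..x, v ^ p * (x - v) ^ q =
    (p.factorial * q.factorial : ℝ) / ((p + q + 1).factorial : ℝ) * x ^ (p + q + 1) := by
  induction q with
  | zero =>
    intro p
    simp only [pow_zero, mul_one, integral_pow, Nat.factorial_zero, Nat.cast_one, add_zero]
    rw [Nat.factorial_succ]
    have : (p.factorial : ℝ) ≠ 0 := by positivity
    push_cast
    field_simp
    simp
  | succ q ih =>
    intro p
    have hd : ∀ v ∈ Set.uIcc 0 x, HasDerivAt (fun v : ℝ => v ^ (p+1) * (x - v) ^ (q+1))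
        ((p+1 : ℝ) * (v ^ p * (x - v) ^ (q+1)) - (q+1:ℝ) * (v ^ (p+1) * (x - v) ^ q)) v := by
      intro v _
      have h1 := hasDerivAt_pow (p+1) v
      have h2 := ((hasDerivAt_id v).const_sub x).pow (q+1)
      convert! h1.mul h2 using 1
      simp
      ring
    have h := intervalIntegral.integral_eq_sub_of_hasDerivAt hd (Continuous.intervalIntegrable (by fun_prop) _ _)
    rw [intervalIntegral.integral_sub (Continuous.intervalIntegrable (by fun_prop) _ _)
      (Continuous.intervalIntegrable (by fun_prop) _ _), intervalIntegral.integral_const_mul,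
      intervalIntegral.integral_const_mul, ih (p+1)] at h
    simp only [sub_self, ne_eq, Nat.add_eq_zero_iff, one_ne_zero, and_false, not_false_eq_true, zero_pow, mul_zero, sub_zero, zero_mul] at h
    have hp : (p + 1 : ℝ) ≠ 0 := by positivity
    have : ∫ v in (0:ℝ)..x, v ^ p * (x - v) ^ (q+1) = (q+1:ℝ)/(p+1) * (((p+1).factorial * q.factorial : ℝ) / ((p + 1 + q + 1).factorial : ℝ) * x ^ (p + 1 + q + 1)) := by
      field_simp
      field_simp at h
      linarith
    rw [this, show p + 1 + q + 1 = p + (q+1) + 1 by ring, Nat.factorial_succ p, Nat.factorial_succ q]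
    push_cast
    field_simp

open scoped Classical in
noncomputable def ind (p : Prop) : ℝ := if p then 1 else 0

lemma ind_true {p : Prop} (h : p) : ind p = 1 := by simp [ind, h]
lemma ind_false {p : Prop} (h : ¬ p) : ind p = 0 := by simp [ind, h]
lemma ind_nonneg (p : Prop) : 0 ≤ ind p := by by_cases h : p <;> simp [ind, h]
lemma ind_le_one (p : Prop) : ind p ≤ 1 := by by_cases h : p <;> simp [ind, h]
lemma ind_and (p q : Prop) : ind (p ∧ q) = ind p * ind q := by
  by_cases h : p <;> by_cases h' : q <;> simp [ind, h, h']
lemma ind_mono {p q : Prop} (h : p → q) : ind p ≤ ind q := by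
  by_cases h' : p
  · rw [ind_true h', ind_true (h h')]
  · rw [ind_false h']; exact ind_nonneg _
lemma meas_ind {Ω : Type*} [MeasurableSpace Ω] {p : Ω → Prop} (h : MeasurableSet {ω | p ω}) :
    Measurable fun ω => ind (p ω) := by
  classical
  unfold ind
  exact Measurable.ite h measurable_const measurable_const

lemma unif_window {lo hi : ℝ} (h0 : 0 ≤ lo) (h1 : lo ≤ hi) (h2 : hi ≤ 1) (g : ℝ → ℝ) :
    ∫ v, ind (lo < v ∧ v < hi) * g v ∂unif = ∫ v in lo..hi, g v := by
  have : (fun v => ind (lo < v ∧ v < hi) * g v) = Set.indicator (Set.Ioo lo hi) g := by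
    funext v
    by_cases h : lo < v ∧ v < hi
    · rw [ind_true h, Set.indicator_of_mem (show v ∈ Set.Ioo lo hi from h), one_mul]
    · rw [ind_false h, Set.indicator_of_notMem (show v ∉ Set.Ioo lo hi from h), zero_mul]
  rw [this, integral_indicator measurableSet_Ioo, unif, Measure.restrict_restrict measurableSet_Ioo,
    Set.inter_eq_left.2, intervalIntegral.integral_of_le h1, integral_Ioc_eq_integral_Ioo]
  rintro v ⟨a, b⟩
  exact ⟨by linarith, by linarith⟩

section
variable {ι : Type*} [Fintype ι]

def W (e : ℕ → ι) (k n : ℕ) (lo hi : ℝ) (ω : ι → ℝ) : Prop :=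
  (∀ i, k ≤ i → i < n → lo < ω (e i) ∧ ω (e i) < hi) ∧
    ∀ i j, k ≤ i → i < j → j < n → ω (e i) < ω (e j)

lemma W_meas (e : ℕ → ι) (k n : ℕ) (lo hi : ℝ) : MeasurableSet {ω | W e k n lo hi ω} := by
  simp only [W, Set.ofPred_and, Set.ofPred_forall]
  refine MeasurableSet.inter ?_ ?_
  · refine MeasurableSet.iInter fun i => MeasurableSet.iInter fun _ => MeasurableSet.iInter fun _ => ?_
    exact (measurableSet_lt measurable_const (measurable_pi_apply _)).inter
      (measurableSet_lt (measurable_pi_apply _) measurable_const)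
  · refine MeasurableSet.iInter fun i => MeasurableSet.iInter fun j => MeasurableSet.iInter fun _ =>
      MeasurableSet.iInter fun _ => MeasurableSet.iInter fun _ => ?_
    exact measurableSet_lt (measurable_pi_apply _) (measurable_pi_apply _)

noncomputable def wI (e : ℕ → ι) (k n : ℕ) (lo hi : ℝ) (ω : ι → ℝ) : ℝ := ind (W e k n lo hi ω)

lemma wI_BM (e : ℕ → ι) (k n : ℕ) (lo hi : ℝ) : BM (wI e k n lo hi) :=
  BM.of01 (meas_ind (W_meas e k n lo hi)) fun _ => ⟨ind_nonneg _, ind_le_one _⟩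

lemma W_congr {e : ℕ → ι} {k n : ℕ} {lo hi : ℝ} {ω ω' : ι → ℝ}
    (h : ∀ i, k ≤ i → i < n → ω (e i) = ω' (e i)) : W e k n lo hi ω ↔ W e k n lo hi ω' := by
  unfold W
  refine and_congr (forall_congr' fun i => forall_congr' fun a => forall_congr' fun b => by rw [h i a b])
    (forall_congr' fun i => forall_congr' fun j => forall_congr' fun a => forall_congr' fun b => forall_congr' fun c =>
      by rw [h i a (b.trans c), h j (a.trans b.le) c])

lemma wI_dep (e : ℕ → ι) (k n : ℕ) (lo hi : ℝ) :
    DependsOn (wI e k n lo hi) {x | ∃ i, k ≤ i ∧ i < n ∧ e i = x} := by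
  intro a b h
  unfold wI
  rw [W_congr (ω := a) (ω' := b) fun i h1 h2 => h _ ⟨i, h1, h2, rfl⟩]

lemma W_succ {e : ℕ → ι} {k n : ℕ} {lo hi : ℝ} {ω : ι → ℝ} (hk : k ≤ n) :
    W e k (n+1) lo hi ω ↔ (lo < ω (e n) ∧ ω (e n) < hi) ∧ W e k n lo (ω (e n)) ω := by
  constructor
  · rintro ⟨h1, h2⟩
    exact ⟨h1 n hk (by lia), fun i a b => ⟨(h1 i a (by lia)).1, h2 i n a b (by lia)⟩,
      fun i j a b c => h2 i j a b (by lia)⟩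
  · rintro ⟨⟨h1, h2⟩, h3, h4⟩
    refine ⟨fun i a b => ?_, fun i j a b c => ?_⟩
    · rcases Nat.lt_succ_iff_lt_or_eq.1 b with b | rfl
      · exact ⟨(h3 i a b).1, (h3 i a b).2.trans h2⟩
      · exact ⟨h1, h2⟩
    · rcases Nat.lt_succ_iff_lt_or_eq.1 c with c | rfl
      · exact h4 i j a b c
      · exact (h3 i a b).2

lemma chain_prob {e : ℕ → ι} {k n : ℕ} (hk : k ≤ n)
    (he : ∀ i j, k ≤ i → i < j → j < n → e i ≠ e j) : ∀ {lo hi : ℝ}, 0 ≤ lo → lo ≤ hi → hi ≤ 1 →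
    ∫ ω, wI e k n lo hi ω ∂(pm ι) = (hi - lo) ^ (n - k) / ((n - k).factorial : ℝ) := by
  classical
  induction n, hk using Nat.le_induction with
  | base =>
    intro lo hi _ _ _
    have : ∀ ω : ι → ℝ, wI e k k lo hi ω = 1 := fun ω =>
      ind_true ⟨fun i a b => by lia, fun i j a b c => by lia⟩
    simp [this]
  | succ n hk ih =>
    intro lo hi h0 h1 h2
    rw [int_coord (e n) (wI_BM _ _ _ _ _)]
    have ih' := fun {lo hi} => ih (fun i j a b c => he i j a b (by lia)) (lo := lo) (hi := hi)
    have step : ∀ v, ∫ ω, wI e k (n+1) lo hi (Function.update ω (e n) v) ∂(pm ι)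
        = ind (lo < v ∧ v < hi) * ((v - lo) ^ (n - k) / ((n - k).factorial : ℝ)) := by
      intro v
      have : ∀ ω, wI e k (n+1) lo hi (Function.update ω (e n) v)
          = ind (lo < v ∧ v < hi) * wI e k n lo v ω := by
        intro ω
        unfold wI
        rw [W_succ hk, Function.update_self, ind_and]
        congr 2
        exact propext (W_congr fun i a b => Function.update_of_ne (he i n a b (by lia)) _ _)
      simp only [this]
      rw [integral_const_mul]
      by_cases hv : lo < v ∧ v < hi
      · rw [ih' h0 hv.1.le (hv.2.le.trans h2)]
      · simp [ind_false hv]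
    simp only [step]
    rw [unif_window h0 h1 h2, intervalIntegral.integral_div,
      intervalIntegral.integral_comp_sub_right (fun v => v ^ (n-k)), integral_pow,
      Nat.succ_sub hk, Nat.factorial_succ]
    simp
    have : ((n-k).factorial : ℝ) ≠ 0 := by positivity
    field_simp

end

/-- the sizes of the gaps of `S` in `range n` -/
def gap (S : Finset ℕ) (n i : ℕ) : ℕ :=
  ((Finset.range n).filter fun a => a ∉ S ∧ (S.filter fun j => j < a).card = i).card

def gprod {M : Type*} [CommMonoid M] (F : ℕ → M) (S : Finset ℕ) (n : ℕ) : M :=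
  ∏ i ∈ Finset.range (S.card + 1), F (gap S n i)

lemma gprod_empty {M : Type*} [CommMonoid M] (F : ℕ → M) (n : ℕ) : gprod F ∅ n = F n := by
  simp [gprod, gap]

lemma gprod_insert {M : Type*} [CommMonoid M] (F : ℕ → M) {S : Finset ℕ} {a n : ℕ}
    (hS : ∀ j ∈ S, j < a) (ha : a < n) :
    gprod F (insert a S) n = gprod F S a * F (n - 1 - a) := by
  have haS : a ∉ S := fun h => lt_irrefl _ (hS a h)
  unfold gprod
  rw [Finset.card_insert_of_notMem haS, Finset.prod_range_succ]
  have key : ∀ b, b < a → ((insert a S).filter fun j => j < b) = (S.filter fun j => j < b) := by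
    intro b hb
    rw [Finset.filter_insert, if_neg (by lia)]
  have key2 : ∀ b, a < b → ((insert a S).filter fun j => j < b) = insert a S := by
    intro b hb
    rw [Finset.filter_true_of_mem]
    intro j hj
    rcases Finset.mem_insert.1 hj with rfl | hj
    · exact hb
    · exact (hS j hj).trans hb
  congr 1
  · refine Finset.prod_congr rfl fun i hi => ?_
    congr 1
    unfold gap
    congr 1
    ext b
    simp only [Finset.mem_filter, Finset.mem_range, Finset.mem_insert, not_or] at hi ⊢
    constructor
    · rintro ⟨hb, ⟨hba, hbS⟩, hc⟩
      rcases lt_or_gt_of_ne hba with h | h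
      · rw [key b h] at hc; exact ⟨h, hbS, hc⟩
      · rw [key2 b h, Finset.card_insert_of_notMem haS] at hc; lia
    · rintro ⟨hb, hbS, hc⟩
      exact ⟨hb.trans ha, ⟨hb.ne, hbS⟩, by rw [key b hb]; exact hc⟩
  · congr 1
    unfold gap
    have : ((Finset.range n).filter fun b => b ∉ insert a S ∧
        ((insert a S).filter fun j => j < b).card = S.card + 1) = Finset.Ioo a n := by
      ext b
      simp only [Finset.mem_filter, Finset.mem_range, Finset.mem_insert, not_or, Finset.mem_Ioo]
      constructor
      · rintro ⟨hb, ⟨hba, hbS⟩, hc⟩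
        refine ⟨?_, hb⟩
        rcases lt_or_gt_of_ne hba with h | h
        · rw [key b h] at hc
          have := Finset.card_filter_le S (fun j => j < b)
          lia
        · exact h
      · rintro ⟨h, hb⟩
        refine ⟨hb, ⟨h.ne', fun hbS => ?_⟩, ?_⟩
        · have := hS b hbS; lia
        · rw [key2 b h, Finset.card_insert_of_notMem haS]
    rw [this, Nat.card_Ioo]
    lia

section
variable {ι : Type*} [Fintype ι]

noncomputable def pI (e e' : ℕ → ι) (n : ℕ) (x : ℝ) (ω : ι → ℝ) : ℝ :=
  wI e 0 n 0 x ω * wI e' 0 n 0 x ω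

lemma pI_BM (e e' : ℕ → ι) (n : ℕ) (x : ℝ) : BM (pI e e' n x) := (wI_BM _ _ _ _ _).mul (wI_BM _ _ _ _ _)

lemma DependsOn_mul {f g : (ι → ℝ) → ℝ} {P Q : Set ι} (hP : DependsOn f P) (hQ : DependsOn g Q) :
    DependsOn (fun ω => f ω * g ω) (P ∪ Q) := by
  intro a b h
  simp only
  rw [hP fun i hi => h i (Or.inl hi), hQ fun i hi => h i (Or.inr hi)]

lemma W_split {e : ℕ → ι} {a n : ℕ} {x : ℝ} {ω : ι → ℝ} (ha : a < n) :
    W e 0 n 0 x ω ↔ (0 < ω (e a) ∧ ω (e a) < x) ∧ W e 0 a 0 (ω (e a)) ω ∧ W e (a+1) n (ω (e a)) x ω := by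
  constructor
  · rintro ⟨h1, h2⟩
    refine ⟨h1 a (by lia) ha, ⟨fun i _ b => ⟨(h1 i (by lia) (by lia)).1, h2 i a (by lia) b ha⟩,
      fun i j p q r => h2 i j p q (by lia)⟩, ⟨fun i p q => ⟨h2 a i (by lia) (by lia) q, (h1 i (by lia) q).2⟩,
      fun i j p q r => h2 i j (by lia) q r⟩⟩
  · rintro ⟨⟨h1, h2⟩, ⟨h3, h4⟩, ⟨h5, h6⟩⟩
    refine ⟨fun i _ b => ?_, fun i j _ b c => ?_⟩
    · rcases lt_trichotomy i a with h | rfl | h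
      · exact ⟨(h3 i (by lia) h).1, (h3 i (by lia) h).2.trans h2⟩
      · exact ⟨h1, h2⟩
      · exact ⟨h1.trans (h5 i h b).1, (h5 i h b).2⟩
    · rcases lt_trichotomy j a with h | rfl | h
      · exact h4 i j (by lia) b h
      · exact (h3 i (by lia) b).2
      · rcases lt_trichotomy i a with h' | rfl | h'
        · exact (h3 i (by lia) h').2.trans (h5 j h c).1
        · exact (h5 j h c).1
        · exact h6 i j h' b c

lemma pair_prob {e e' : ℕ → ι} (S : Finset ℕ) : ∀ {n : ℕ} {x : ℝ}, 0 ≤ x → x ≤ 1 →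
    (∀ j ∈ S, j < n) → (∀ j < n, j ∈ S ↔ e j = e' j) →
    (∀ i j, i < n → j < n → e i = e j → i = j) → (∀ i j, i < n → j < n → e' i = e' j → i = j) →
    (∀ i j, i < n → j < n → e i = e' j → i = j) →
    ∫ ω, pI e e' n x ω ∂(pm ι) = (gprod Nat.centralBinom S n : ℕ) * x ^ (2 * n - S.card) /
      ((2 * n - S.card).factorial : ℝ) := by
  classical
  induction S using Finset.induction_on_max with
  | empty =>
    intro n x hx0 hx1 _ hS he he' hee
    unfold pI
    rw [indep_mul (wI_BM _ _ _ _ _) (wI_BM _ _ _ _ _) (wI_dep _ _ _ _ _) (wI_dep _ _ _ _ _),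
      chain_prob (by lia) (fun i j _ h h' heq => h.ne (he i j (by lia) h' heq)) le_rfl hx0 hx1,
      chain_prob (by lia) (fun i j _ h h' heq => h.ne (he' i j (by lia) h' heq)) le_rfl hx0 hx1,
      gprod_empty]
    · have := Nat.succ_mul_centralBinom_succ
      have h : ((2*n).factorial : ℝ) = Nat.centralBinom n * (n.factorial * n.factorial) := by
        rw [Nat.centralBinom_eq_two_mul_choose]
        have := Nat.choose_mul_factorial_mul_factorial (show n ≤ 2*n by lia)
        rw [show 2 * n - n = n by lia] at this
        rw [← this]; push_cast; ring
      have h1 : (n.factorial : ℝ) ≠ 0 := by positivity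
      have h2 : (n.centralBinom : ℝ) ≠ 0 := by exact_mod_cast Nat.centralBinom_ne_zero n
      simp only [sub_zero, Nat.sub_zero, Finset.card_empty]
      rw [h, two_mul, pow_add]
      field_simp
    · rw [Set.disjoint_left]
      rintro _ ⟨i, _, hi, rfl⟩ ⟨j, _, hj, heq⟩
      have := hee i j hi hj heq.symm
      subst this
      simpa using (hS i hi).2 heq.symm
  | insert a S hS' ih =>
    intro n x hx0 hx1 hn hS he he' hee
    have han : a < n := hn a (by simp)
    have haS : a ∉ S := fun h => lt_irrefl _ (hS' a h)
    have hea : e a = e' a := (hS a han).1 (by simp)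
    have hc : S.card ≤ a := by
      have := Finset.card_le_card (show S ⊆ Finset.range a from fun j hj => Finset.mem_range.2 (hS' j hj))
      simpa using this
    have hSa : ∀ i, a < i → i < n → e i ≠ e' i := by
      intro i h1 h2 heq
      have := (hS i h2).2 heq
      rcases Finset.mem_insert.1 this with h | h
      · lia
      · have := hS' i h; lia
    set g := n - 1 - a with hg
    have step : ∀ v, ∫ ω, pI e e' n x (Function.update ω (e a) v) ∂(pm ι)
        = ind (0 < v ∧ v < x) * (((gprod Nat.centralBinom S a : ℕ) / ((2*a - S.card).factorial * (g.factorial * g.factorial) : ℝ)) * (v ^ (2*a - S.card) * (x - v) ^ (2 * g))) := by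
      intro v
      have : ∀ ω, pI e e' n x (Function.update ω (e a) v)
          = ind (0 < v ∧ v < x) * (pI e e' a v ω * (wI e (a+1) n v x ω * wI e' (a+1) n v x ω)) := by
        intro ω
        unfold pI wI
        rw [W_split han, W_split (e := e') han, ← hea, Function.update_self]
        have c1 : W e 0 a 0 v (Function.update ω (e a) v) = W e 0 a 0 v ω :=
          propext (W_congr fun i _ h => Function.update_of_ne (fun hh => by have := he i a (by lia) han hh; lia) _ _)
        have c2 : W e' 0 a 0 v (Function.update ω (e a) v) = W e' 0 a 0 v ω :=
          propext (W_congr fun i _ h => Function.update_of_ne (fun hh => by have := hee a i han (by lia) hh.symm; lia) _ _)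
        have c3 : W e (a+1) n v x (Function.update ω (e a) v) = W e (a+1) n v x ω :=
          propext (W_congr fun i h h2 => Function.update_of_ne (fun hh => by have := he i a (by lia) han hh; lia) _ _)
        have c4 : W e' (a+1) n v x (Function.update ω (e a) v) = W e' (a+1) n v x ω :=
          propext (W_congr fun i h h2 => Function.update_of_ne (fun hh => by have := hee a i han (by lia) hh.symm; lia) _ _)
        rw [c1, c2, c3, c4]
        by_cases hv : 0 < v ∧ v < x
        · simp only [ind_and, ind_true hv.1, ind_true hv.2]; ring
        · rw [ind_and, ind_false hv]; ring
      simp only [this]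
      rw [integral_const_mul]
      by_cases hv : 0 < v ∧ v < x
      · congr 1
        have D1 : DependsOn (pI e e' a v) _ := DependsOn_mul (wI_dep e 0 a 0 v) (wI_dep e' 0 a 0 v)
        have D2 := wI_dep e (a+1) n v x
        have D3 := wI_dep e' (a+1) n v x
        rw [indep_mul (pI_BM _ _ _ _) ((wI_BM _ _ _ _ _).mul (wI_BM _ _ _ _ _)) D1 (DependsOn_mul D2 D3),
          indep_mul (wI_BM _ _ _ _ _) (wI_BM _ _ _ _ _) D2 D3,
          chain_prob (by lia) (fun i j _ h h' heq => h.ne (he i j (by lia) h' heq)) hv.1.le hv.2.le hx1,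
          chain_prob (by lia) (fun i j _ h h' heq => h.ne (he' i j (by lia) h' heq)) hv.1.le hv.2.le hx1,
          ih hv.1.le (hv.2.le.trans hx1) hS', show n - (a+1) = g by lia]
        · have h1 : (g.factorial : ℝ) ≠ 0 := by positivity
          rw [two_mul g, pow_add]
          field_simp
        · intro j hj
          rw [← hS j (hj.trans han), Finset.mem_insert]
          exact ⟨fun h => Or.inr h, fun h => h.resolve_left (by lia)⟩
        · exact fun i j h h' => he i j (by lia) (by lia)
        · exact fun i j h h' => he' i j (by lia) (by lia)
        · exact fun i j h h' => hee i j (by lia) (by lia)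
        · rw [Set.disjoint_left]
          rintro _ ⟨i, hi', hi, rfl⟩ ⟨j, _, hj, heq⟩
          have := hee i j hi hj heq.symm
          subst this
          exact hSa i (by lia) hi heq.symm
        · rw [Set.disjoint_left]
          rintro _ (⟨i, _, hi, rfl⟩ | ⟨i, _, hi, rfl⟩) (⟨j, hj, hj', heq⟩ | ⟨j, hj, hj', heq⟩)
          · have := he j i hj' (by lia) heq; lia
          · have := hee i j (by lia) hj' heq.symm; lia
          · have := hee j i hj' (by lia) heq; lia
          · have := he' j i hj' (by lia) heq; lia
      · simp [ind_false hv]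
    rw [int_coord (e a) (pI_BM _ _ _ _)]
    simp only [step]
    rw [unif_window le_rfl hx0 hx1, intervalIntegral.integral_const_mul, beta_int,
      gprod_insert _ hS' han, Finset.card_insert_of_notMem haS, ← hg,
      show 2 * a - S.card + 2 * g + 1 = 2 * n - (S.card + 1) by lia]
    have h : ((2*g).factorial : ℝ) = Nat.centralBinom g * (g.factorial * g.factorial) := by
      rw [Nat.centralBinom_eq_two_mul_choose]
      have := Nat.choose_mul_factorial_mul_factorial (show g ≤ 2*g by lia)
      rw [show 2 * g - g = g by lia] at this
      rw [← this]; push_cast; ring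
    have h1 : (g.factorial : ℝ) ≠ 0 := by positivity
    rw [h]
    push_cast
    field_simp
end
end RHP

namespace RHP
open MeasureTheory Filter Set

/-- `(2g)!/g!` -/
def hh (g : ℕ) : ℕ := g.factorial * g.centralBinom
noncomputable def ht (g : ℕ) : ℝ := if g = 1 then 0 else (hh g : ℝ)

lemma hh_zero : hh 0 = 1 := by simp [hh]
lemma hh_pos (g : ℕ) : 1 ≤ hh g := Nat.mul_pos (Nat.factorial_pos _) (Nat.centralBinom_pos _)
lemma hh_mul (g : ℕ) : hh g * g.factorial = (2 * g).factorial := by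
  unfold hh
  rw [Nat.centralBinom_eq_two_mul_choose]
  have := Nat.choose_mul_factorial_mul_factorial (show g ≤ 2*g by lia)
  rw [show 2 * g - g = g by lia] at this
  rw [← this]; ring
lemma hh_succ (g : ℕ) : hh (g+1) = 2 * (2 * g + 1) * hh g := by
  have h := Nat.succ_mul_centralBinom_succ g
  unfold hh
  rw [Nat.factorial_succ]
  calc _ = g.factorial * ((g+1) * (g+1).centralBinom) := by ring
    _ = _ := by rw [h]; ring

lemma ht_zero : ht 0 = 1 := by simp [ht, hh_zero]
lemma ht_one : ht 1 = 0 := by simp [ht]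
lemma ht_nonneg (g : ℕ) : 0 ≤ ht g := by unfold ht; split_ifs <;> positivity
lemma ht_le (g : ℕ) : ht g ≤ hh g := by unfold ht; split_ifs <;> simp

lemma cb_mul_le (a b : ℕ) : a.centralBinom * b.centralBinom ≤ (a+b).centralBinom := by
  simp only [Nat.centralBinom_eq_two_mul_choose]
  rw [show 2 * (a+b) = 2*a + 2*b by ring, Nat.add_choose_eq]
  exact Finset.single_le_sum (f := fun ij : ℕ × ℕ => (2*a).choose ij.1 * (2*b).choose ij.2)
    (fun _ _ => Nat.zero_le _) (show (a,b) ∈ _ by simp)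

lemma hh_mul_le (a b : ℕ) : hh a * hh b * (a+b).choose b ≤ hh (a+b) := by
  have h := Nat.add_choose_mul_factorial_mul_factorial a b
  unfold hh
  calc _ = ((a+b).choose b * a.factorial * b.factorial) * (a.centralBinom * b.centralBinom) := by ring
    _ ≤ _ := by rw [h]; exact Nat.mul_le_mul_left _ (cb_mul_le a b)

lemma choose_mono_half {G a b : ℕ} (h2 : a ≤ b) (hb : b ≤ G / 2) : G.choose a ≤ G.choose b := by
  induction b, h2 using Nat.le_induction with
  | base => exact le_rfl
  | succ b hab ih => exact (ih (by lia)).trans (Nat.choose_le_succ_of_lt_half_left (by lia))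

lemma choose_two_le {G b : ℕ} (h2 : 2 ≤ b) (hb : b + 2 ≤ G) : G.choose 2 ≤ G.choose b := by
  rcases le_or_gt b (G/2) with h | h
  · exact choose_mono_half h2 h
  · rw [← Nat.choose_symm (show b ≤ G by lia)]
    exact choose_mono_half (by lia) (by lia)

noncomputable def dl (G : ℕ) : ℝ := ((G - 3 : ℕ) : ℝ) / (G.choose 2 : ℝ)

lemma dl_nonneg (G : ℕ) : 0 ≤ dl G := by unfold dl; positivity

lemma dl_le (G : ℕ) : dl G ≤ 1 / 5 := by
  unfold dl
  rcases lt_or_ge G 4 with h | h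
  · rw [show G - 3 = 0 by lia]; simp
  · have hp : (0:ℝ) < G.choose 2 := by exact_mod_cast Nat.choose_pos (by lia)
    rw [div_le_div_iff₀ hp (by norm_num), Nat.cast_choose_two, Nat.cast_sub (by lia)]
    have h5 : (0:ℝ) ≤ ((G:ℝ) - 5) * (G - 6) := by
      rcases le_or_gt G 5 with h' | h'
      · have : (G:ℝ) ≤ 5 := by exact_mod_cast h'
        nlinarith
      · have : (6:ℝ) ≤ G := by exact_mod_cast h'
        nlinarith
    push_cast
    nlinarith

lemma dl_le' {G : ℕ} (h : 2 ≤ G) : dl G ≤ 2 / ((G:ℝ) - 1) := by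
  unfold dl
  have h1 : (2:ℝ) ≤ G := by exact_mod_cast h
  rw [Nat.cast_choose_two]
  have h3 : ((G - 3 : ℕ) : ℝ) ≤ G := by exact_mod_cast Nat.sub_le _ _
  have h4 : (0:ℝ) < G - 1 := by linarith
  have h5 : (0:ℝ) < G := by linarith
  rw [div_le_div_iff₀ (by positivity) h4]
  nlinarith

lemma conv_mid {f : ℕ → ℝ} {u : ℝ} (hu : 0 ≤ u) (hf : ∀ a, f a ≤ u * hh a) (hf1 : f 1 = 0) (G : ℕ) :
    ∑ b ∈ Finset.Ico 1 G, f (G - b) * ht b ≤ u * dl G * hh G := by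
  have h1 : ∑ b ∈ Finset.Ico 1 G, f (G - b) * ht b = ∑ b ∈ Finset.Ico 2 (G-1), f (G - b) * ht b := by
    symm
    refine Finset.sum_subset (fun b hb => ?_) (fun b hb hb' => ?_)
    · simp only [Finset.mem_Ico] at hb ⊢; lia
    · simp only [Finset.mem_Ico] at hb hb'
      rcases eq_or_ne b 1 with rfl | h
      · simp [ht_one]
      · rw [show G - b = 1 by lia, hf1, zero_mul]
  rw [h1]
  have h2 : ∀ b ∈ Finset.Ico 2 (G-1), f (G - b) * ht b ≤ u * hh G / (G.choose 2 : ℝ) := by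
    intro b hb
    simp only [Finset.mem_Ico] at hb
    have hp : (0:ℝ) < G.choose 2 := by exact_mod_cast Nat.choose_pos (by lia)
    have h3 := hh_mul_le (G - b) b
    rw [Nat.sub_add_cancel (by lia)] at h3
    have h4 : hh (G-b) * hh b * G.choose 2 ≤ hh G :=
      (Nat.mul_le_mul_left _ (choose_two_le hb.1 (by lia))).trans h3
    have h5 : (hh (G-b) : ℝ) * hh b * G.choose 2 ≤ hh G := by exact_mod_cast h4
    rw [le_div_iff₀ hp]
    calc f (G-b) * ht b * (G.choose 2:ℝ) ≤ (u * hh (G-b)) * hh b * (G.choose 2:ℝ) := by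
          have := ht_le b
          have := ht_nonneg b
          have := hf (G-b)
          gcongr
      _ = u * ((hh (G-b) : ℝ) * hh b * G.choose 2) := by ring
      _ ≤ _ := by gcongr
  calc _ ≤ ∑ b ∈ Finset.Ico 2 (G-1), u * hh G / (G.choose 2 : ℝ) := Finset.sum_le_sum h2
    _ = _ := by
      rw [Finset.sum_const, Nat.card_Ico, show G - 1 - 2 = G - 3 by lia, nsmul_eq_mul, dl]
      ring

noncomputable def V : ℕ → ℕ → ℝ
  | 0, G => ht G
  | c+1, G => ∑ b ∈ Finset.range (G+1), V c (G - b) * ht b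

lemma V_nonneg (c : ℕ) : ∀ G, 0 ≤ V c G := by
  induction c with
  | zero => intro G; exact ht_nonneg G
  | succ c ih => intro G; exact Finset.sum_nonneg fun b _ => mul_nonneg (ih _) (ht_nonneg _)

lemma V_zero (c : ℕ) : V c 0 = 1 := by
  induction c with
  | zero => exact ht_zero
  | succ c ih => simp [V, ih, ht_zero]

lemma V_one (c : ℕ) : V c 1 = 0 := by
  induction c with
  | zero => exact ht_one
  | succ c ih => simp [V, Finset.sum_range_succ, ih, ht_one]

lemma V_mono_succ (c G : ℕ) : V c G ≤ V (c+1) G := by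
  have := Finset.single_le_sum (f := fun b => V c (G - b) * ht b)
    (fun b _ => mul_nonneg (V_nonneg c _) (ht_nonneg b)) (show 0 ∈ Finset.range (G+1) by simp)
  simpa [V, ht_zero] using this

lemma V_mono {c c' : ℕ} (h : c ≤ c') (G : ℕ) : V c G ≤ V c' G := by
  induction c', h using Nat.le_induction with
  | base => exact le_rfl
  | succ c' _ ih => exact ih.trans (V_mono_succ _ _)

noncomputable def uu (c : ℕ) : ℝ := (c + 1) * (6/5) ^ c

lemma uu_one (c : ℕ) : 1 ≤ uu c := by
  unfold uu
  have : (1:ℝ) ≤ (6/5)^c := one_le_pow₀ (by norm_num)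
  nlinarith [(Nat.cast_nonneg c : (0:ℝ) ≤ c)]

lemma uu_step (c : ℕ) : uu c * (6/5) + 1 ≤ uu (c+1) := by
  unfold uu
  have : (1:ℝ) ≤ (6/5)^(c+1) := one_le_pow₀ (by norm_num)
  rw [pow_succ] at *
  push_cast
  nlinarith

lemma uu_mono (c : ℕ) : uu c ≤ uu (c+1) := by
  have := uu_step c; have := uu_one c; linarith

lemma V_le (c : ℕ) : ∀ G, V c G ≤ uu c * hh G := by
  induction c with
  | zero => intro G; simpa [V, uu] using ht_le G
  | succ c ih =>
    intro G
    have hG : (1:ℝ) ≤ hh G := by exact_mod_cast hh_pos G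
    rcases Nat.eq_zero_or_pos G with rfl | h
    · rw [V_zero]; nlinarith [uu_one (c+1)]
    · have hm := conv_mid (by linarith [uu_one c]) ih (V_one c) G
      rw [V, Finset.sum_range_succ, Finset.range_eq_Ico, Finset.sum_eq_sum_Ico_succ_bot h]
      simp only [Nat.sub_zero, ht_zero, mul_one, Nat.sub_self, V_zero, one_mul, zero_add]
      have := ih G
      have := ht_le G
      have h1 : uu c * dl G * hh G ≤ uu c * (1/5) * hh G := by
        have := dl_le G
        have := uu_one c
        gcongr
      nlinarith [uu_step c]

lemma V_mid (c G : ℕ) : ∑ b ∈ Finset.Ico 1 G, V c (G - b) * ht b ≤ uu c * dl G * hh G :=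
  conv_mid (by linarith [uu_one c]) (V_le c) (V_one c) G

/-- convolution power bound -/
lemma V_pow (L : ℕ) (x : ℝ) (hx : 0 ≤ x) (c : ℕ) :
    ∑ G ∈ Finset.range (L+1), V c G * x ^ G ≤ (∑ g ∈ Finset.range (L+1), ht g * x ^ g) ^ (c+1) := by
  induction c with
  | zero => simp [V]
  | succ c ih =>
    rw [pow_succ]
    have h0 : 0 ≤ ∑ g ∈ Finset.range (L+1), ht g * x ^ g :=
      Finset.sum_nonneg fun g _ => mul_nonneg (ht_nonneg g) (pow_nonneg hx g)
    refine le_trans ?_ (mul_le_mul_of_nonneg_right ih h0)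
    rw [Finset.sum_mul_sum]
    simp only [V, Finset.sum_mul]
    rw [Finset.sum_sigma', ← Finset.sum_product']
    have h1 : ∀ p : (Σ _ : ℕ, ℕ), p ∈ (Finset.range (L+1)).sigma (fun G => Finset.range (G+1)) →
      V c (p.1 - p.2) * ht p.2 * x ^ p.1 = V c (p.1 - p.2) * x ^ (p.1 - p.2) * (ht p.2 * x ^ p.2) := by
      rintro ⟨G, b⟩ hp
      simp only [Finset.mem_sigma, Finset.mem_range] at hp ⊢
      have : x ^ G = x ^ (G - b) * x ^ b := by rw [← pow_add]; congr 1; lia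
      rw [this]; ring
    rw [Finset.sum_congr rfl h1]
    rw [← Finset.sum_image (s := (Finset.range (L+1)).sigma (fun G => Finset.range (G+1)))
      (g := fun p : (Σ _ : ℕ, ℕ) => ((p.1 - p.2, p.2) : ℕ × ℕ)) (f := fun q : ℕ × ℕ => V c q.1 * x ^ q.1 * (ht q.2 * x ^ q.2))]
    · refine Finset.sum_le_sum_of_subset_of_nonneg ?_ fun q _ _ =>
        mul_nonneg (mul_nonneg (V_nonneg _ _) (pow_nonneg hx _)) (mul_nonneg (ht_nonneg _) (pow_nonneg hx _))
      intro q hq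
      simp only [Finset.mem_image, Finset.mem_sigma, Finset.mem_range, Finset.mem_product] at hq ⊢
      obtain ⟨p, hp, rfl⟩ := hq
      constructor <;> simp only <;> lia
    · rintro ⟨a, b⟩ hp ⟨a', b'⟩ hp' heq
      simp only [Finset.coe_sigma, Set.mem_sigma_iff, Finset.mem_coe, Finset.mem_range, Prod.mk.injEq] at hp hp' heq
      obtain ⟨h1, rfl⟩ := heq
      have : a = a' := by lia
      subst this; rfl
end RHP

namespace RHP
open MeasureTheory Filter Set

lemma peel_max {M : Type*} [AddCommMonoid M] (f : Finset ℕ → M) (c n : ℕ) :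
    ∑ S ∈ Finset.powersetCard (c+1) (Finset.range n), f S =
      ∑ a ∈ Finset.range n, ∑ S ∈ Finset.powersetCard c (Finset.range a), f (insert a S) := by
  rw [Finset.sum_sigma']
  symm
  refine Finset.sum_bij (fun (p : Σ _ : ℕ, Finset ℕ) _ => insert p.1 p.2) ?_ ?_ ?_ ?_
  · rintro ⟨a, S⟩ h
    simp only [Finset.mem_sigma, Finset.mem_range, Finset.mem_powersetCard] at h ⊢
    have haS : a ∉ S := fun h' => by have := h.2.1 h'; simp at this
    refine ⟨?_, by rw [Finset.card_insert_of_notMem haS, h.2.2]⟩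
    intro x hx
    rcases Finset.mem_insert.1 hx with rfl | hx
    · simpa using h.1
    · have := h.2.1 hx; simp at this ⊢; lia
  · rintro ⟨a, S⟩ h ⟨a', S'⟩ h' heq
    simp only [Finset.mem_sigma, Finset.mem_range, Finset.mem_powersetCard] at h h' heq
    have key : ∀ x, x ∈ insert a S → x ≤ a := by
      intro x hx
      rcases Finset.mem_insert.1 hx with rfl | hx
      · exact le_rfl
      · have := h.2.1 hx; simp at this; lia
    have key' : ∀ x, x ∈ insert a' S' → x ≤ a' := by
      intro x hx
      rcases Finset.mem_insert.1 hx with rfl | hx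
      · exact le_rfl
      · have := h'.2.1 hx; simp at this; lia
    have : a = a' := le_antisymm (key' a (by rw [← heq]; simp)) (key a' (by rw [heq]; simp))
    subst this
    have haS : a ∉ S := fun h'' => by have := h.2.1 h''; simp at this
    have haS' : a ∉ S' := fun h'' => by have := h'.2.1 h''; simp at this
    have : S = S' := by rw [← Finset.erase_insert haS, heq, Finset.erase_insert haS']
    rw [this]
  · intro S hS
    simp only [Finset.mem_powersetCard] at hS
    have hne : S.Nonempty := by rw [← Finset.card_pos]; lia
    have hm := S.max'_mem hne
    refine ⟨⟨S.max' hne, S.erase (S.max' hne)⟩, ?_, Finset.insert_erase hm⟩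
    simp only [Finset.mem_sigma, Finset.mem_powersetCard]
    refine ⟨hS.1 hm, ?_, by rw [Finset.card_erase_of_mem hm]; lia⟩
    intro x hx
    have := S.le_max' x (Finset.mem_of_mem_erase hx)
    have := Finset.ne_of_mem_erase hx
    simp; lia
  · rintro ⟨a, S⟩ h; rfl

lemma sum_gprod_V (c : ℕ) : ∀ G, ∑ S ∈ Finset.powersetCard c (Finset.range (c+G)), gprod ht S (c+G) = V c G := by
  induction c with
  | zero => intro G; simp [gprod_empty, V]
  | succ c ih =>
    intro G
    rw [peel_max, V]
    have h1 : ∀ a ∈ Finset.range (c+1+G), ∑ S ∈ Finset.powersetCard c (Finset.range a), gprod ht (insert a S) (c+1+G)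
       = (∑ S ∈ Finset.powersetCard c (Finset.range a), gprod ht S a) * ht (c + G - a) := by
      intro a ha
      rw [Finset.sum_mul]
      refine Finset.sum_congr rfl fun S hS => ?_
      rw [gprod_insert, show c + 1 + G - 1 - a = c + G - a by lia]
      · intro j hj; simpa using (Finset.mem_powersetCard.1 hS).1 hj
      · simpa using ha
    rw [Finset.sum_congr rfl h1]
    rw [← Finset.sum_range_reflect (fun b => V c (G - b) * ht b)]
    rw [show c + 1 + G = c + (G+1) by ring, Finset.sum_range_add, Finset.sum_eq_zero, zero_add]
    · refine Finset.sum_congr rfl fun b hb => ?_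
      simp only [Finset.mem_range] at hb
      rw [ih, show c + G - (c + b) = G - b by lia, show G + 1 - 1 - b = G - b by lia, show G - (G - b) = b by lia]
    · intro a ha
      rw [Finset.powersetCard_eq_empty.2 (by simpa using ha)]; simp

def ND (S : Finset ℕ) (n : ℕ) : Prop := ∃ j ∈ S, ∃ a < j, a ∉ S ∧ ∃ b < n, j < b ∧ b ∉ S

lemma gprod_nonneg (S n) : 0 ≤ gprod ht S n := Finset.prod_nonneg fun _ _ => ht_nonneg _

lemma sum_ND_aux (c G : ℕ) :
  ∑ S ∈ Finset.powersetCard (c+1) (Finset.range (c+1+G)), ind (ND S (c+1+G)) * gprod ht S (c+1+G) ≤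
   ∑ S ∈ Finset.powersetCard c (Finset.range (c+G)), ind (ND S (c+G)) * gprod ht S (c+G) +
    ∑ b ∈ Finset.Ico 1 G, V c (G - b) * ht b := by
  rw [peel_max, show c + 1 + G = (c + G) + 1 by ring, Finset.sum_range_succ, add_comm]
  refine add_le_add ?_ ?_
  · refine Finset.sum_le_sum fun S hS => ?_
    have hS' := Finset.mem_powersetCard.1 hS
    rw [gprod_insert _ (fun j hj => by simpa using hS'.1 hj) (by lia)]
    simp only [Nat.add_sub_cancel, Nat.sub_self, ht_zero, mul_one]
    refine mul_le_mul_of_nonneg_right (ind_mono ?_) (gprod_nonneg _ _)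
    rintro ⟨j, hj, a, ha, haS, b, hb, hjb, hbS⟩
    simp only [Finset.mem_insert, not_or] at hj haS hbS
    exact ⟨j, hj.resolve_left (by lia), a, ha, haS.2, b, by lia, hjb, hbS.2⟩
  · have h1 : ∀ a ∈ Finset.range (c+G), ∑ S ∈ Finset.powersetCard c (Finset.range a), ind (ND (insert a S) (c+G+1)) * gprod ht (insert a S) (c+G+1)
       ≤ if c < a then V c (a - c) * ht (c + G - a) else 0 := by
      intro a ha
      simp only [Finset.mem_range] at ha
      split_ifs with hca
      · rw [← sum_gprod_V, show c + (a - c) = a by lia, Finset.sum_mul]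
        refine Finset.sum_le_sum fun S hS => ?_
        have hS' := Finset.mem_powersetCard.1 hS
        rw [gprod_insert _ (fun j hj => by simpa using hS'.1 hj) (by lia)]
        simp only [Nat.add_sub_cancel]
        exact mul_le_of_le_one_left (mul_nonneg (gprod_nonneg _ _) (ht_nonneg _)) (ind_le_one _)
      · refine (Finset.sum_eq_zero fun S hS => ?_).le
        have hS' := Finset.mem_powersetCard.1 hS
        have hc := Finset.card_le_card hS'.1
        have hSr : S = Finset.range a := Finset.eq_of_subset_of_card_le hS'.1 (by simp; lia)
        rw [ind_false, zero_mul]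
        rintro ⟨j, hj, a', ha', haS, b, hb, hjb, hbS⟩
        simp only [Finset.mem_insert, not_or, hSr, Finset.mem_range] at hj haS hbS
        lia
    refine (Finset.sum_le_sum h1).trans ?_
    rw [Finset.sum_range_add, Finset.sum_eq_zero, zero_add]
    · rw [← Finset.sum_range_reflect]
      rcases Nat.eq_zero_or_pos G with rfl | hG
      · simp
      have : ∀ b ∈ Finset.range G, (if c < c + (G - 1 - b) then V c (c + (G - 1 - b) - c) * ht (c + G - (c + (G - 1 - b))) else 0)
        = if b + 1 < G then V c (G - (b+1)) * ht (b+1) else 0 := by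
        intro b hb
        simp only [Finset.mem_range] at hb
        rw [show c + (G - 1 - b) - c = G - (b+1) by lia, show c + G - (c + (G - 1 - b)) = b + 1 by lia]
        by_cases h : b + 1 < G
        · rw [if_pos h, if_pos (by lia)]
        · rw [if_neg h, if_neg (by lia)]
      rw [Finset.sum_congr rfl this, ← Finset.sum_filter, Finset.sum_Ico_eq_sum_range]
      refine le_of_eq (Finset.sum_congr ?_ fun b _ => by rw [add_comm b 1])
      ext b; simp; lia
    · intro a ha
      rw [if_neg (by simp at ha; lia)]

lemma sum_ND (c : ℕ) : ∀ G, ∑ S ∈ Finset.powersetCard c (Finset.range (c+G)), ind (ND S (c+G)) * gprod ht S (c+G) ≤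
    c * uu c * dl G * hh G := by
  induction c with
  | zero =>
    intro G
    simp
    rw [ind_false]; · simp
    rintro ⟨j, hj, _⟩; simp at hj
  | succ c ih =>
    intro G
    refine (sum_ND_aux c G).trans ?_
    have h1 := ih G
    have h2 := V_mid c G
    have h3 := uu_mono c
    have h4 := uu_one c
    have h5 : 0 ≤ dl G * hh G := mul_nonneg (dl_nonneg G) (by positivity)
    have h6 : (c * uu c + uu c) * (dl G * hh G) ≤ ((c+1) * uu (c+1)) * (dl G * hh G) := by
      refine mul_le_mul_of_nonneg_right ?_ h5
      nlinarith [(Nat.cast_nonneg c : (0:ℝ) ≤ c)]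
    push_cast
    nlinarith

lemma Hc_bound {n c : ℕ} (h : 4 * c ≤ 3 * n) :
    (n.factorial : ℝ) * hh (n - c) / ((2 * n - c).factorial : ℝ) ≤ (4/5) ^ c := by
  have h1 : (n - c).factorial * n.descFactorial c = n.factorial := Nat.factorial_mul_descFactorial (by lia)
  have h2 : (2*n - c - c).factorial * (2*n - c).descFactorial c = (2*n-c).factorial := Nat.factorial_mul_descFactorial (by lia)
  have h3 := hh_mul (n - c)
  rw [show 2 * (n - c) = 2 * n - c - c by lia] at h3
  have h4 : (5:ℝ) ^ c * n.descFactorial c ≤ 4 ^ c * (2*n-c).descFactorial c := by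
    have : 5 ^ c * n.descFactorial c ≤ 4 ^ c * (2*n-c).descFactorial c := by
      rw [Nat.descFactorial_eq_prod_range, Nat.descFactorial_eq_prod_range]
      have : ∀ k : ℕ, k ^ c = ∏ i ∈ Finset.range c, k := by intro k; simp
      rw [this, this, ← Finset.prod_mul_distrib, ← Finset.prod_mul_distrib]
      refine Finset.prod_le_prod' fun i hi => ?_
      simp only [Finset.mem_range] at hi
      lia
    exact_mod_cast this
  have h5 : (n.factorial : ℝ) * hh (n - c) = (2*n - c - c).factorial * n.descFactorial c := by
    rw [← h1, ← h3]; push_cast; ring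
  rw [h5, ← h2, div_le_iff₀ (by rw [h2]; positivity), div_pow]
  push_cast
  have : (0:ℝ) < (2*n - c - c).factorial := by positivity
  have h6 : (0:ℝ) < 5 ^ c := by positivity
  rw [div_mul_eq_mul_div, le_div_iff₀ h6]
  nlinarith
end RHP

namespace RHP
open MeasureTheory Filter Set

lemma hh_three {n g : ℕ} (h3 : 3 ≤ g) (hg : 4 * g ≤ n) : hh g * n ^ 3 ≤ 120 * n ^ g := by
  induction g, h3 using Nat.le_induction with
  | base => exact Nat.mul_le_mul_right _ (by decide)
  | succ g h3 ih =>
    rw [hh_succ, pow_succ]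
    have := ih (by lia)
    calc 2 * (2*g+1) * hh g * n^3 = (2 * (2*g+1)) * (hh g * n^3) := by ring
      _ ≤ n * (120 * n ^ g) := Nat.mul_le_mul (by lia) this
      _ = _ := by ring

lemma eta_bound {n : ℕ} (hn : 1 ≤ n) :
    ∑ g ∈ Finset.range (n/4+1), ht g * (1/(n:ℝ)) ^ g ≤ 1 + 162 / (n:ℝ)^2 := by
  have hn' : (1:ℝ) ≤ n := by exact_mod_cast hn
  have h1 : ∀ g ∈ Finset.range (n/4+1), ht g * (1/(n:ℝ)) ^ g ≤ (if g = 0 then 1 else 0) +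
      (if g = 2 then 12 / (n:ℝ)^2 else 0) + 120 / (n:ℝ)^3 := by
    intro g hg
    simp only [Finset.mem_range] at hg
    have h0 : (0:ℝ) ≤ 120 / (n:ℝ)^3 := by positivity
    rcases (show g = 0 ∨ g = 1 ∨ g = 2 ∨ 3 ≤ g by lia) with rfl | rfl | rfl | h
    · simp [ht_zero]; positivity
    · simp [ht_one]; positivity
    · have : ht 2 = 12 := by
        unfold ht; rw [if_neg (by norm_num)]
        have : hh 2 = 12 := by decide
        rw [this]; norm_num
      rw [this]; simp
      rw [← div_eq_mul_inv]
      simpa using h0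
    · rw [if_neg (by lia), if_neg (by lia)]
      have hb : (hh g : ℝ) * n^3 ≤ 120 * n ^ g := by exact_mod_cast hh_three h (by lia)
      have := ht_le g
      rw [zero_add, zero_add, one_div, inv_pow, ← div_eq_mul_inv, div_le_div_iff₀ (by positivity) (by positivity)]
      refine le_trans ?_ hb
      gcongr
  refine (Finset.sum_le_sum h1).trans ?_
  rw [Finset.sum_add_distrib, Finset.sum_add_distrib, Finset.sum_ite_eq', Finset.sum_ite_eq', Finset.sum_const,
    Finset.card_range, nsmul_eq_mul]
  have h2 : ((n/4+1 : ℕ) : ℝ) ≤ n / 4 + 1 := by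
    push_cast; gcongr; exact Nat.cast_div_le
  have h3 : (if 2 ∈ Finset.range (n/4+1) then 12 / (n:ℝ)^2 else 0) ≤ 12 / (n:ℝ)^2 := by
    split_ifs
    · exact le_rfl
    · positivity
  have h4 : ((n/4+1 : ℕ) : ℝ) * (120 / (n:ℝ)^3) ≤ 150 / (n:ℝ)^2 := by
    rw [mul_div_assoc', div_le_div_iff₀ (by positivity) (by positivity)]
    have : ((n/4+1 : ℕ) : ℝ) ≤ 5/4 * n := by linarith
    nlinarith [mul_le_mul_of_nonneg_right this (show (0:ℝ) ≤ n^2 by positivity)]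
  have h5 : (162:ℝ) / n^2 = 12/n^2 + 150/n^2 := by ring
  simp only [Finset.mem_range, Nat.zero_lt_succ, if_true] at h3 ⊢
  linarith

lemma eta_lim : Tendsto (fun n : ℕ => (1 + 162 / (n:ℝ)^2) ^ (n+1) - 1) atTop (nhds 0) := by
  have h1 : Tendsto (fun n : ℕ => Real.exp (324 / (n:ℝ)) - 1) atTop (nhds 0) := by
    have : Tendsto (fun n : ℕ => 324 / (n:ℝ)) atTop (nhds 0) := tendsto_const_div_atTop_nhds_zero_nat 324
    simpa using ((Real.continuous_exp.tendsto 0).comp this).sub_const 1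
  refine squeeze_zero' (Eventually.of_forall fun n => ?_) ?_ h1
  · have : (1:ℝ) ≤ (1 + 162 / (n:ℝ)^2) ^ (n+1) := one_le_pow₀ (by
      have : (0:ℝ) ≤ 162 / (n:ℝ)^2 := by positivity
      linarith)
    linarith
  · filter_upwards [eventually_ge_atTop 1] with n hn
    have hn' : (1:ℝ) ≤ n := by exact_mod_cast hn
    have h2 : 1 + 162 / (n:ℝ)^2 ≤ Real.exp (162 / (n:ℝ)^2) := by
      have := Real.add_one_le_exp (162 / (n:ℝ)^2); linarith
    have h3 : (1 + 162 / (n:ℝ)^2) ^ (n+1) ≤ Real.exp (162 / (n:ℝ)^2) ^ (n+1) := by gcongr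
    rw [← Real.exp_nat_mul] at h3
    have h4 : ((n+1 : ℕ):ℝ) * (162 / (n:ℝ)^2) ≤ 324 / n := by
      push_cast
      rw [mul_div_assoc', div_le_div_iff₀ (by positivity) (by positivity)]
      nlinarith
    have := Real.exp_le_exp.2 h4
    linarith

noncomputable def Bt (n K : ℕ) (S : Finset ℕ) : ℝ :=
  ind (S ≠ Finset.range n ∧ ∃ j ∈ S, K ≤ j ∧ j < n - K) *
    (n.factorial * gprod ht S n / ((2 * n - S.card).factorial : ℝ))

noncomputable def BB (n K : ℕ) : ℝ := ∑ S ∈ (Finset.range n).powerset, Bt n K S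

lemma Bt_nonneg (n K S) : 0 ≤ Bt n K S :=
  mul_nonneg (ind_nonneg _) (div_nonneg (mul_nonneg (by positivity) (gprod_nonneg _ _)) (by positivity))

lemma mid_ND {n K c : ℕ} {S : Finset ℕ} (hS : S ⊆ Finset.range n) (hc : S.card ≤ K)
    (h : ∃ j ∈ S, K ≤ j ∧ j < n - K) : ND S n := by
  obtain ⟨j, hj, h1, h2⟩ := h
  refine ⟨j, hj, ?_⟩
  have ha : ∃ a < j, a ∉ S := by
    by_contra! hcon
    have := Finset.card_le_card (show Finset.range (j+1) ⊆ S from fun x hx => by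
      simp only [Finset.mem_range] at hx
      rcases Nat.lt_succ_iff_lt_or_eq.1 hx with h | rfl
      · exact hcon x h
      · exact hj)
    simp at this; lia
  have hb : ∃ b, b < n ∧ j < b ∧ b ∉ S := by
    by_contra! hcon
    have := Finset.card_le_card (show Finset.Ico j n ⊆ S from fun x hx => by
      simp only [Finset.mem_Ico] at hx
      rcases lt_or_eq_of_le hx.1 with h | rfl
      · exact hcon x hx.2 h
      · exact hj)
    simp at this; lia
  obtain ⟨a, h3, h4⟩ := ha
  obtain ⟨b, h5, h6, h7⟩ := hb
  exact ⟨a, h3, h4, b, h5, h6, h7⟩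

lemma T_small {n K c : ℕ} (hc : c ≤ K) (hn : 4 * K ≤ 3 * n) :
    ∑ S ∈ Finset.powersetCard c (Finset.range n), Bt n K S ≤ c * uu c * dl (n - c) := by
  have h1 : ∑ S ∈ Finset.powersetCard c (Finset.range n), Bt n K S ≤
      (n.factorial / ((2 * n - c).factorial : ℝ)) * ∑ S ∈ Finset.powersetCard c (Finset.range n), ind (ND S n) * gprod ht S n := by
    rw [Finset.mul_sum]
    refine Finset.sum_le_sum fun S hS => ?_
    have hS' := Finset.mem_powersetCard.1 hS
    unfold Bt
    rw [hS'.2]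
    have h2 : ind (S ≠ Finset.range n ∧ ∃ j ∈ S, K ≤ j ∧ j < n - K) ≤ ind (ND S n) :=
      ind_mono fun h => mid_ND (c := c) hS'.1 (by lia) h.2
    calc _ ≤ ind (ND S n) * (n.factorial * gprod ht S n / ((2 * n - c).factorial : ℝ)) :=
          mul_le_mul_of_nonneg_right h2 (div_nonneg (mul_nonneg (by positivity) (gprod_nonneg _ _)) (by positivity))
      _ = _ := by ring
  refine h1.trans ?_
  have h2 := sum_ND c (n - c)
  rw [show c + (n - c) = n by lia] at h2
  have h3 := Hc_bound (n := n) (c := c) (by lia)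
  have h4 : ((4:ℝ)/5) ^ c ≤ 1 := pow_le_one₀ (by norm_num) (by norm_num)
  calc _ ≤ (n.factorial / ((2 * n - c).factorial : ℝ)) * (c * uu c * dl (n-c) * hh (n-c)) := by gcongr
    _ = (c * uu c * dl (n-c)) * ((n.factorial : ℝ) * hh (n - c) / ((2 * n - c).factorial : ℝ)) := by ring
    _ ≤ (c * uu c * dl (n-c)) * 1 := by
        have := uu_one c
        have := dl_nonneg (n-c)
        gcongr
        exact h3.trans h4
    _ = _ := by ring

lemma T_le {n K c : ℕ} (hc : c ≤ n) :
    ∑ S ∈ Finset.powersetCard c (Finset.range n), Bt n K S ≤ n.factorial / ((2 * n - c).factorial : ℝ) * V c (n-c) := by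
  have h := sum_gprod_V c (n-c)
  rw [show c + (n - c) = n by lia] at h
  rw [← h, Finset.mul_sum]
  refine Finset.sum_le_sum fun S hS => ?_
  have hS' := Finset.mem_powersetCard.1 hS
  unfold Bt
  rw [hS'.2]
  refine (mul_le_of_le_one_left (div_nonneg (mul_nonneg (by positivity) (gprod_nonneg _ _)) (by positivity)) (ind_le_one _)).trans (le_of_eq ?_)
  ring

lemma T_mid {n K c : ℕ} (hn : 4 * c ≤ 3 * n) :
    ∑ S ∈ Finset.powersetCard c (Finset.range n), Bt n K S ≤ (c+1) * (24/25) ^ c := by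
  refine (T_le (by lia)).trans ?_
  have h3 := Hc_bound (n := n) (c := c) (by lia)
  have hv := V_le c (n-c)
  calc _ ≤ n.factorial / ((2 * n - c).factorial : ℝ) * (uu c * hh (n-c)) := by gcongr
    _ = uu c * ((n.factorial : ℝ) * hh (n - c) / ((2 * n - c).factorial : ℝ)) := by ring
    _ ≤ uu c * (4/5)^c := by
        have := uu_one c
        gcongr
    _ = _ := by
        unfold uu
        rw [mul_assoc, ← mul_pow]; norm_num

lemma T_high {n K c : ℕ} (hn : c ≤ n) :
    ∑ S ∈ Finset.powersetCard c (Finset.range n), Bt n K S ≤ V n (n-c) * (1/(n:ℝ)) ^ (n - c) := by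
  refine (T_le (by lia)).trans ?_
  rw [mul_comm]
  refine mul_le_mul (V_mono hn _) ?_ (by positivity) (V_nonneg _ _)
  have h := Nat.factorial_mul_pow_le_factorial (m := n) (n := n - c)
  rw [show n + (n - c) = 2 * n - c by lia] at h
  rcases Nat.eq_zero_or_pos n with rfl | hn0
  · simp
  have h' : (n.factorial : ℝ) * (n+1) ^ (n-c) ≤ (2*n-c).factorial := by exact_mod_cast h
  have hn' : (0:ℝ) < n := by exact_mod_cast hn0
  rw [one_div, inv_pow, div_le_iff₀ (by positivity), inv_mul_eq_div, le_div_iff₀ (by positivity)]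
  refine le_trans ?_ h'
  gcongr
  linarith

lemma T_full {n K : ℕ} : ∑ S ∈ Finset.powersetCard n (Finset.range n), Bt n K S = 0 := by
  refine Finset.sum_eq_zero fun S hS => ?_
  have hS' := Finset.mem_powersetCard.1 hS
  have : S = Finset.range n := Finset.eq_of_subset_of_card_le hS'.1 (by simp [hS'.2])
  unfold Bt
  rw [ind_false, zero_mul]
  exact fun h => h.1 this

lemma BB_le {n K : ℕ} (h1 : 1 ≤ n) (hn : 4 * K ≤ 3 * n) :
    BB n K ≤ ∑ c ∈ Finset.range (K+1), c * uu c * dl (n - c) + ∑ c ∈ Finset.Ioc K n, ((c:ℝ)+1) * (24/25) ^ c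
      + ((1 + 162 / (n:ℝ)^2) ^ (n+1) - 1) := by
  unfold BB
  rw [Finset.sum_powerset, Finset.card_range]
  have key : ∀ c ∈ Finset.range (n+1), ∑ S ∈ Finset.powersetCard c (Finset.range n), Bt n K S ≤
     (if c < K + 1 then c * uu c * dl (n - c) else 0) + (if K < c ∧ c ≤ n then ((c:ℝ)+1) * (24/25) ^ c else 0)
      + (if 1 ≤ n - c ∧ n - c < n / 4 + 1 then V n (n-c) * (1/(n:ℝ)) ^ (n - c) else 0) := by
    intro c hc
    simp only [Finset.mem_range] at hc
    have p1 : 0 ≤ (if c < K + 1 then c * uu c * dl (n - c) else 0) := by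
      split_ifs
      · have := uu_one c
        have := dl_nonneg (n-c)
        positivity
      · exact le_rfl
    have p2 : 0 ≤ (if K < c ∧ c ≤ n then ((c:ℝ)+1) * (24/25) ^ c else 0) := by
      split_ifs <;> positivity
    have p3 : 0 ≤ (if 1 ≤ n - c ∧ n - c < n / 4 + 1 then V n (n-c) * (1/(n:ℝ)) ^ (n - c) else 0) := by
      split_ifs
      · exact mul_nonneg (V_nonneg _ _) (by positivity)
      · exact le_rfl
    rcases (show c ≤ K ∨ K < c ∧ 4 * c ≤ 3 * n ∨ c = n ∨ 3 * n < 4 * c ∧ c < n by lia) with h | h | h | h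
    · have := T_small h hn
      rw [if_pos (by lia)] at p1 ⊢
      linarith
    · have := T_mid (K := K) h.2
      rw [if_pos (show K < c ∧ c ≤ n by lia)] at p2 ⊢
      linarith
    · subst h; rw [T_full]; linarith
    · have := T_high (K := K) h.2.le
      rw [if_pos (show 1 ≤ n - c ∧ n - c < n / 4 + 1 by lia)] at p3 ⊢
      linarith
  refine (Finset.sum_le_sum key).trans ?_
  rw [Finset.sum_add_distrib, Finset.sum_add_distrib]
  refine add_le_add (add_le_add ?_ ?_) ?_
  · rw [← Finset.sum_filter]
    refine Finset.sum_le_sum_of_subset_of_nonneg (fun c hc => ?_) fun c _ _ => ?_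
    · simp at hc ⊢; lia
    · have := uu_one c
      have := dl_nonneg (n-c)
      positivity
  · rw [← Finset.sum_filter]
    refine Finset.sum_le_sum_of_subset_of_nonneg (fun c hc => ?_) fun c _ _ => by positivity
    simp at hc ⊢; lia
  · rw [← Finset.sum_range_reflect]
    have e1 : ∀ b ∈ Finset.range (n+1), (if 1 ≤ n - (n + 1 - 1 - b) ∧ n - (n + 1 - 1 - b) < n / 4 + 1 then
        V n (n-(n + 1 - 1 - b)) * (1/(n:ℝ)) ^ (n - (n + 1 - 1 - b)) else 0) =
        if 1 ≤ b ∧ b < n/4+1 then V n b * (1/(n:ℝ))^b else 0 := by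
      intro b hb
      simp only [Finset.mem_range] at hb
      rw [show n - (n + 1 - 1 - b) = b by lia]
    rw [Finset.sum_congr rfl e1, ← Finset.sum_filter]
    have h2 := V_pow (n/4) (1/(n:ℝ)) (by positivity) n
    have h3 : (∑ g ∈ Finset.range (n/4+1), ht g * (1/(n:ℝ)) ^ g) ^ (n+1) ≤ (1 + 162 / (n:ℝ)^2) ^ (n+1) := by
      refine pow_le_pow_left₀ (Finset.sum_nonneg fun g _ => mul_nonneg (ht_nonneg g) (by positivity)) (eta_bound h1) _
    have h4 : Finset.filter (fun b => 1 ≤ b ∧ b < n/4+1) (Finset.range (n+1)) = Finset.Ico 1 (n/4+1) := by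
      ext b; simp; lia
    rw [h4]
    rw [Finset.range_eq_Ico, Finset.sum_eq_sum_Ico_succ_bot (by lia), V_zero] at h2
    simp only [pow_zero, mul_one, zero_add] at h2
    rw [← Finset.range_eq_Ico] at h2
    linarith

lemma BB_small {ε : ℝ} (hε : 0 < ε) : ∃ K0 : ℕ, ∀ K ≥ K0, ∀ᶠ n in atTop, BB n K ≤ ε := by
  have hs : Summable (fun c : ℕ => ((c:ℝ)+1) * (24/25:ℝ) ^ c) := by
    have h1 := summable_pow_mul_geometric_of_norm_lt_one 1 (r := (24/25:ℝ)) (by norm_num)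
    have h2 := summable_geometric_of_lt_one (r := (24/25:ℝ)) (by norm_num) (by norm_num)
    refine (h1.add h2).congr fun c => ?_
    simp; ring
  obtain ⟨s, hs⟩ := summable_iff_vanishing_norm.1 hs (ε/3) (by positivity)
  refine ⟨s.sup id, fun K hK => ?_⟩
  have h1 : Tendsto (fun n : ℕ => ∑ c ∈ Finset.range (K+1), c * uu c * dl (n - c)) atTop (nhds 0) := by
    have : Tendsto (fun n : ℕ => ∑ c ∈ Finset.range (K+1), c * uu c * dl (n - c)) atTop (nhds (∑ c ∈ Finset.range (K+1), c * uu c * 0)) := by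
      refine tendsto_finsetSum _ fun c _ => Tendsto.const_mul _ ?_
      have hd : Tendsto dl atTop (nhds 0) := by
        refine squeeze_zero' (Eventually.of_forall dl_nonneg) ((eventually_ge_atTop 2).mono fun G hG => dl_le' hG) ?_
        exact Tendsto.const_div_atTop (tendsto_atTop_add_const_right _ _ tendsto_natCast_atTop_atTop) _
      exact hd.comp (tendsto_sub_atTop_nat c)
    simpa using this
  filter_upwards [h1.eventually_le_const (show (0:ℝ) < ε/3 by positivity),
    eta_lim.eventually_le_const (show (0:ℝ) < ε/3 by positivity), eventually_ge_atTop (2 * K + 1)] with n h2 h3 h4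
  have h5 := BB_le (n := n) (K := K) (by lia) (by lia)
  have h6 := hs (Finset.Ioc K n) (by
    rw [Finset.disjoint_left]
    intro c hc hcs
    have := Finset.le_sup (f := id) hcs
    simp at hc this; lia)
  have h7 := (le_abs_self _).trans h6.le
  linarith
end RHP

namespace RHP
open MeasureTheory Filter Set
open RandomHypercube (EdgeIdx pathEdge initSeg)

section
variable {n : ℕ} [NeZero n]

def pe (σ : Equiv.Perm (Fin n)) (j : ℕ) : EdgeIdx n :=
  if h : j < n then pathEdge n σ ⟨j, h⟩ else (∅, 0)

lemma pe_fin (σ : Equiv.Perm (Fin n)) (j : Fin n) : pe σ j = pathEdge n σ j := by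
  simp [pe, j.2]

lemma mem_initSeg {σ : Equiv.Perm (Fin n)} {j x : Fin n} : σ x ∈ initSeg n σ j ↔ x < j := by
  simp [initSeg]

lemma initSeg_card (σ : Equiv.Perm (Fin n)) (j : Fin n) : (initSeg n σ j).card = j := by
  unfold initSeg
  rw [Finset.card_image_of_injective _ σ.injective]
  have : (Finset.univ.filter fun i : Fin n => i < j) = Finset.Iio j := by ext; simp
  rw [this, Fin.card_Iio]

lemma pe_inj (σ σ' : Equiv.Perm (Fin n)) (i j : ℕ) (hi : i < n) (hj : j < n) (h : pe σ i = pe σ' j) : i = j := by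
  have h1 := initSeg_card σ ⟨i, hi⟩
  have h2 := initSeg_card σ' ⟨j, hj⟩
  have h3 : initSeg n σ ⟨i, hi⟩ = initSeg n σ' ⟨j, hj⟩ := by
    have := congrArg Prod.fst h
    simpa [pe, hi, hj, pathEdge] using this
  rw [h3] at h1
  simp at h1 h2; lia

def share (σ σ' : Equiv.Perm (Fin n)) : Finset ℕ := (Finset.range n).filter fun j => pe σ j = pe σ' j

lemma mem_share {σ σ' : Equiv.Perm (Fin n)} {j : Fin n} :
    (j : ℕ) ∈ share σ σ' ↔ initSeg n σ j = initSeg n σ' j ∧ σ j = σ' j := by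
  simp [share, pe_fin, pathEdge, Prod.ext_iff]

noncomputable def Ip (σ : Equiv.Perm (Fin n)) (ω : EdgeIdx n → ℝ) : ℝ := wI (pe σ) 0 n 0 1 ω

lemma Ip_BM (σ : Equiv.Perm (Fin n)) : BM (Ip σ) := wI_BM _ _ _ _ _
lemma Ip_nonneg (σ : Equiv.Perm (Fin n)) (ω) : 0 ≤ Ip σ ω := ind_nonneg _
lemma Ip_le_one (σ : Equiv.Perm (Fin n)) (ω) : Ip σ ω ≤ 1 := ind_le_one _

lemma pairE (σ σ' : Equiv.Perm (Fin n)) : ∫ ω, Ip σ ω * Ip σ' ω ∂(pm (EdgeIdx n)) =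
    (gprod Nat.centralBinom (share σ σ') n : ℕ) / ((2 * n - (share σ σ').card).factorial : ℝ) := by
  have := pair_prob (e := pe σ) (e' := pe σ') (share σ σ') (n := n) (x := 1) (by norm_num) (by norm_num)
    (fun j hj => by simpa using (Finset.mem_filter.1 hj).1) (fun j hj => by simp [share, hj])
    (pe_inj σ σ) (pe_inj σ' σ') (pe_inj σ σ')
  simp only [one_pow, mul_one] at this
  exact this

def lab (n : ℕ) (S : Finset ℕ) (a : Fin n) : Fin n ⊕ Fin (n+1) :=
  if (a : ℕ) ∈ S then Sum.inl a else Sum.inr (Fin.ofNat (n+1) (S.filter fun j => j < (a:ℕ)).card)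

lemma cardlt {n : ℕ} (S : Finset ℕ) (a : Fin n) : (S.filter fun j => j < (a:ℕ)).card < n + 1 := by
  have := Finset.card_le_card (show (S.filter fun j => j < (a:ℕ)) ⊆ Finset.range a from fun x hx => by
    simp at hx ⊢; exact hx.2)
  simp at this
  have := a.2
  lia

lemma lab_inr {S : Finset ℕ} {a : Fin n} {i : Fin (n+1)} :
    lab n S a = Sum.inr i ↔ (a:ℕ) ∉ S ∧ (S.filter fun j => j < (a:ℕ)).card = i := by
  unfold lab
  split_ifs with h
  · simp [h]
  · simp only [Sum.inr.injEq, h, not_false_eq_true, true_and]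
    rw [Fin.ext_iff]
    simp [Fin.ofNat, Nat.mod_eq_of_lt (cardlt S a)]

lemma lab_inl {S : Finset ℕ} {a i : Fin n} : lab n S a = Sum.inl i ↔ (a:ℕ) ∈ S ∧ a = i := by
  unfold lab
  split_ifs with h <;> simp [h]

lemma lab_pres {σ σ' : Equiv.Perm (Fin n)} {S : Finset ℕ} (hSn : S ⊆ share σ σ') :
    lab n S ∘ (σ⁻¹ * σ' : Equiv.Perm (Fin n)) = lab n S := by
  funext a
  simp only [Function.comp_apply, Equiv.Perm.mul_apply]
  set b := σ⁻¹ (σ' a) with hb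
  have hσb : σ b = σ' a := by simp [hb]
  have k1 : ∀ j ∈ S, ((a:ℕ) < j ↔ (b:ℕ) < j) ∧ ((a:ℕ) = j ↔ (b:ℕ) = j) := by
    intro j hj
    have hj' := hSn hj
    have hjn : j < n := by simpa using (Finset.mem_filter.1 hj').1
    obtain ⟨h1, h2⟩ := (mem_share (j := ⟨j, hjn⟩)).1 hj'
    constructor
    · have e1 := mem_initSeg (σ := σ) (j := ⟨j, hjn⟩) (x := b)
      have e2 := mem_initSeg (σ := σ') (j := ⟨j, hjn⟩) (x := a)
      rw [h1, hσb, e2] at e1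
      simpa [Fin.lt_def] using e1
    · have : a = ⟨j, hjn⟩ ↔ b = ⟨j, hjn⟩ := by
        rw [← σ'.injective.eq_iff, ← h2, ← hσb, σ.injective.eq_iff]
      simpa [Fin.ext_iff] using this
  unfold lab
  by_cases ha : (a:ℕ) ∈ S
  · have : b = a := Fin.ext (((k1 _ ha).2).1 rfl)
    rw [this]
  · have hb' : (b:ℕ) ∉ S := fun h => ha (by rw [((k1 _ h).2).2 rfl]; exact h)
    rw [if_neg ha, if_neg hb']
    congr 3
    refine Finset.filter_congr fun j hj => ?_
    have := k1 j hj
    lia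

lemma gap_card (S : Finset ℕ) (i : Fin (n+1)) : Fintype.card {a // lab n S a = Sum.inr i} = gap S n i := by
  rw [Fintype.card_subtype]
  unfold gap
  rw [← Finset.card_map Fin.valEmbedding]
  congr 1
  ext a
  simp only [Finset.mem_map, Finset.mem_filter, Finset.mem_univ, true_and, lab_inr, Fin.valEmbedding_apply, Finset.mem_range]
  constructor
  · rintro ⟨a, h, rfl⟩; exact ⟨a.2, h⟩
  · rintro ⟨h, h'⟩; exact ⟨⟨a, h⟩, h', rfl⟩

lemma share_count (σ : Equiv.Perm (Fin n)) {S : Finset ℕ} (hS : S ⊆ Finset.range n) :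
    (Finset.univ.filter fun σ' => share σ σ' = S).card ≤ gprod Nat.factorial S n := by
  have h1 : (Finset.univ.filter fun σ' => share σ σ' = S).card ≤ Fintype.card {g : Equiv.Perm (Fin n) // lab n S ∘ g = lab n S} := by
    rw [Fintype.card_subtype]
    refine Finset.card_le_card_of_injOn (fun σ' => σ⁻¹ * σ') ?_ (fun a _ b _ h => mul_left_cancel h)
    intro σ' h
    simp only [Finset.coe_filter, Finset.mem_univ, true_and, Set.mem_ofPred_eq] at h ⊢
    exact lab_pres h.symm.subset
  refine h1.trans ?_
  rw [DomMulAct.stabilizer_card, Fintype.prod_sum_type]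
  have h2 : ∏ x : Fin n, (Fintype.card {a // lab n S a = Sum.inl x}).factorial = 1 := by
    refine Finset.prod_eq_one fun x _ => ?_
    have : Fintype.card {a // lab n S a = Sum.inl x} ≤ 1 := by
      rw [Fintype.card_le_one_iff_subsingleton]
      exact ⟨fun a b => Subtype.ext ((lab_inl.1 a.2).2.trans (lab_inl.1 b.2).2.symm)⟩
    exact Nat.factorial_eq_one.2 this
  rw [h2, one_mul]
  simp only [gap_card]
  rw [Fin.prod_univ_eq_prod_range (fun i => (gap S n i).factorial) (n+1)]
  unfold gprod
  have hc := Finset.card_le_card hS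
  simp only [Finset.card_range] at hc
  refine le_of_eq (Finset.prod_subset (fun i hi => by simp at hi ⊢; lia) fun i hi hi' => ?_).symm
  have : gap S n i = 0 := by
    unfold gap
    rw [Finset.card_eq_zero, Finset.filter_eq_empty_iff]
    rintro a _ ⟨_, h⟩
    have := Finset.card_filter_le S (fun j => j < a)
    simp at hi'; lia
  simp [this]

lemma no_gap_one (σ σ' : Equiv.Perm (Fin n)) (i : ℕ) (hi : i < n + 1) : gap (share σ σ') n i ≠ 1 := by
  intro h
  set S := share σ σ' with hS
  have hp := lab_pres (σ := σ) (σ' := σ') (S := S) subset_rfl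
  rw [← gap_card S ⟨i, hi⟩, Fintype.card_eq_one_iff] at h
  obtain ⟨⟨a, ha⟩, huniq⟩ := h
  have huniq' : ∀ b, lab n S b = Sum.inr ⟨i, hi⟩ → b = a := fun b hb => congrArg Subtype.val (huniq ⟨b, hb⟩)
  have hpa : ∀ x, lab n S (σ⁻¹ (σ' x)) = lab n S x := fun x => congrFun hp x
  have h1 : σ⁻¹ (σ' a) = a := huniq' _ ((hpa a).trans ha)
  have h1' : σ a = σ' a := by
    have := congrArg σ h1
    simpa using this.symm
  obtain ⟨haS, hac⟩ := lab_inr.1 ha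
  apply haS
  rw [mem_share]
  refine ⟨(Finset.eq_of_subset_of_card_le ?_ (by rw [initSeg_card, initSeg_card])).symm, h1'⟩
  intro y hy
  obtain ⟨x, rfl⟩ := σ'.surjective y
  rw [mem_initSeg] at hy
  have hz : σ' x = σ (σ⁻¹ (σ' x)) := by simp
  rw [hz, mem_initSeg]
  set z := σ⁻¹ (σ' x)
  have hl : lab n S z = lab n S x := hpa x
  by_cases hxS : (x:ℕ) ∈ S
  · have := (lab_inl (S := S) (a := z) (i := x)).1 (hl.trans (lab_inl.2 ⟨hxS, rfl⟩))
    rw [this.2]; exact hy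
  · by_contra hza
    have hx' : lab n S x = Sum.inr ⟨_, cardlt S x⟩ := lab_inr.2 ⟨hxS, rfl⟩
    obtain ⟨hzS, hzc⟩ := lab_inr.1 (hl.trans hx')
    have m1 : (S.filter fun j => j < (x:ℕ)).card ≤ (S.filter fun j => j < (a:ℕ)).card :=
      Finset.card_le_card fun j hj => by
        simp only [Finset.mem_filter] at hj ⊢
        exact ⟨hj.1, hj.2.trans hy⟩
    have m2 : (S.filter fun j => j < (a:ℕ)).card ≤ (S.filter fun j => j < (z:ℕ)).card :=
      Finset.card_le_card fun j hj => by
        simp only [Finset.mem_filter] at hj ⊢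
        exact ⟨hj.1, hj.2.trans_le (not_lt.1 hza)⟩
    have : x = a := huniq' x (lab_inr.2 ⟨hxS, by simp at hzc hac ⊢; lia⟩)
    exact absurd hy (by rw [this]; exact lt_irrefl _)

lemma share_full {σ σ' : Equiv.Perm (Fin n)} (h : share σ σ' = Finset.range n) : σ = σ' := by
  ext j
  have : (j:ℕ) ∈ share σ σ' := by rw [h]; simp
  rw [(mem_share.1 this).2]

def midS (n K : ℕ) (S : Finset ℕ) : Prop := ∃ j ∈ S, K ≤ j ∧ j < n - K

lemma B2_one (K : ℕ) (σ : Equiv.Perm (Fin n)) :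
    ∑ σ' : Equiv.Perm (Fin n), ind (σ ≠ σ' ∧ midS n K (share σ σ')) * ∫ ω, Ip σ ω * Ip σ' ω ∂(pm (EdgeIdx n))
      ≤ BB n K / n.factorial := by
  classical
  have hmap : ∀ σ' ∈ (Finset.univ : Finset (Equiv.Perm (Fin n))), share σ σ' ∈ (Finset.range n).powerset := by
    intro σ' _
    simp [share]
  rw [← Finset.sum_fiberwise_of_maps_to hmap]
  unfold BB
  rw [Finset.sum_div]
  refine Finset.sum_le_sum fun S hS => ?_
  rcases (Finset.univ.filter fun σ' => share σ σ' = S).eq_empty_or_nonempty with he | ⟨σ0, h0⟩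
  · rw [he, Finset.sum_empty]
    exact div_nonneg (Bt_nonneg _ _ _) (by positivity)
  have h0' : share σ σ0 = S := (Finset.mem_filter.1 h0).2
  have hc := Finset.card_le_card (Finset.mem_powerset.1 hS)
  simp only [Finset.card_range] at hc
  have hg : gprod ht S n = (gprod Nat.factorial S n : ℕ) * (gprod Nat.centralBinom S n : ℕ) := by
    unfold gprod
    push_cast
    rw [← Finset.prod_mul_distrib]
    refine Finset.prod_congr rfl fun i hi => ?_
    have := no_gap_one σ σ0 i (by simp at hi; lia)
    rw [h0'] at this
    rw [ht, if_neg this, hh]; push_cast; rfl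
  have h1 : ∀ σ' ∈ Finset.univ.filter (fun σ' => share σ σ' = S),
      ind (σ ≠ σ' ∧ midS n K (share σ σ')) * ∫ ω, Ip σ ω * Ip σ' ω ∂(pm (EdgeIdx n)) ≤
        ind (S ≠ Finset.range n ∧ ∃ j ∈ S, K ≤ j ∧ j < n - K) * ((gprod Nat.centralBinom S n : ℕ) / ((2 * n - S.card).factorial : ℝ)) := by
    intro σ' h'
    have h'' := (Finset.mem_filter.1 h').2
    rw [pairE, h'']
    refine mul_le_mul_of_nonneg_right (ind_mono fun h => ⟨fun hS => h.1 (share_full (h''.trans hS)), h.2⟩) (by positivity)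
  refine (Finset.sum_le_sum h1).trans ?_
  rw [Finset.sum_const, nsmul_eq_mul, Bt, hg]
  have h2 : (((Finset.univ.filter fun σ' => share σ σ' = S).card : ℕ) : ℝ) ≤ (gprod Nat.factorial S n : ℕ) := by
    exact_mod_cast share_count σ (Finset.mem_powerset.1 hS)
  calc _ ≤ ((gprod Nat.factorial S n : ℕ) : ℝ) * (ind (S ≠ Finset.range n ∧ ∃ j ∈ S, K ≤ j ∧ j < n - K) * ((gprod Nat.centralBinom S n : ℕ) / ((2 * n - S.card).factorial : ℝ))) := by
        refine mul_le_mul_of_nonneg_right h2 (mul_nonneg (ind_nonneg _) (by positivity))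
    _ = _ := by
        field_simp

lemma B2_bound (K : ℕ) :
    ∑ σ : Equiv.Perm (Fin n), ∑ σ' : Equiv.Perm (Fin n), ind (σ ≠ σ' ∧ midS n K (share σ σ')) * ∫ ω, Ip σ ω * Ip σ' ω ∂(pm (EdgeIdx n))
      ≤ BB n K := by
  refine (Finset.sum_le_sum fun σ _ => B2_one K σ).trans ?_
  rw [Finset.sum_const, Finset.card_univ, Fintype.card_perm, Fintype.card_fin, nsmul_eq_mul]
  rw [mul_div_cancel₀ _ (by positivity)]
end
end RHP

namespace RHP
open MeasureTheory Filter Set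

lemma prod01 {κ : Type*} (s : Finset κ) {f : κ → ℝ} (h : ∀ k ∈ s, 0 ≤ f k ∧ f k ≤ 1) :
    0 ≤ ∏ k ∈ s, f k ∧ ∏ k ∈ s, f k ≤ 1 :=
  ⟨Finset.prod_nonneg fun k hk => (h k hk).1, Finset.prod_le_one (fun k hk => (h k hk).1) fun k hk => (h k hk).2⟩

lemma one_sub_prod_le {κ : Type*} (s : Finset κ) {x : κ → ℝ} (h : ∀ k ∈ s, 0 ≤ x k ∧ x k ≤ 1) :
    1 - ∏ k ∈ s, (1 - x k) ≤ ∑ k ∈ s, x k := by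
  classical
  induction s using Finset.induction_on with
  | empty => simp
  | insert a s ha ih =>
    rw [Finset.prod_insert ha, Finset.sum_insert ha]
    have h1 := ih fun k hk => h k (Finset.mem_insert_of_mem hk)
    have h2 := h a (Finset.mem_insert_self a s)
    have h3 := prod01 s (f := fun k => 1 - x k) fun k hk => by
      have := h k (Finset.mem_insert_of_mem hk); constructor <;> linarith
    nlinarith

lemma prod_diff_le {κ : Type*} [DecidableEq κ] {A B : Finset κ} (hAB : A ⊆ B) {x : κ → ℝ} (h : ∀ k, 0 ≤ x k ∧ x k ≤ 1) :
    0 ≤ ∏ k ∈ A, (1 - x k) - ∏ k ∈ B, (1 - x k) ∧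
    ∏ k ∈ A, (1 - x k) - ∏ k ∈ B, (1 - x k) ≤ ∑ k ∈ B \ A, x k := by
  rw [← Finset.prod_sdiff hAB]
  have h1 := one_sub_prod_le (B \ A) (x := x) fun k _ => h k
  have h2 : ∀ s : Finset κ, 0 ≤ ∏ k ∈ s, (1 - x k) ∧ ∏ k ∈ s, (1 - x k) ≤ 1 := fun s => prod01 s fun k _ => by
    have := h k; constructor <;> linarith
  have h3 := h2 (B \ A)
  have h4 := h2 A
  have h5 : 0 ≤ ∑ k ∈ B \ A, x k := Finset.sum_nonneg fun k _ => (h k).1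
  constructor <;> nlinarith

section
variable {ι : Type*} [Fintype ι] {κ : Type*} [Fintype κ] [DecidableEq κ]

lemma pois_deriv (J : κ → (ι → ℝ) → ℝ) (hB : ∀ k, BM (J k)) (h01 : ∀ k ω, 0 ≤ J k ω ∧ J k ω ≤ 1) (s : ℝ)
    (hs : |s| ≤ 1) :
    HasDerivAt (fun s : ℝ => ∫ ω, ∏ k, (1 - s * J k ω) ∂(pm ι))
      (∫ ω, ∑ k, (∏ j ∈ Finset.univ.erase k, (1 - s * J j ω)) * (- J k ω) ∂(pm ι)) s := by
  have hF : ∀ (x : ℝ) (k), BM (fun ω => 1 - x * J k ω) := fun x k => (BM.const 1).sub ((BM.const x).mul (hB k))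
  have hF' : ∀ x : ℝ, BM (fun ω => ∑ k, (∏ j ∈ Finset.univ.erase k, (1 - x * J j ω)) * (- J k ω)) := by
    intro x
    refine BM.sum _ fun k _ => (BM.prod _ fun j _ => hF x j).mul ?_
    simpa using (BM.const 0).sub (hB k)
  refine (hasDerivAt_integral_of_dominated_loc_of_deriv_le (μ := pm ι)
    (F := fun s ω => ∏ k, (1 - s * J k ω))
    (F' := fun x ω => ∑ k, (∏ j ∈ Finset.univ.erase k, (1 - x * J j ω)) * (- J k ω))
    (s := Metric.ball s 1) (bound := fun _ => ∑ k : κ, 3 ^ (Finset.univ.erase k).card)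
    (Metric.ball_mem_nhds s one_pos) ?_ ?_ ?_ ?_ ?_ ?_).2
  · exact Eventually.of_forall fun x => (BM.prod _ fun j _ => hF x j).meas.aestronglyMeasurable
  · exact (BM.prod _ fun j _ => hF s j).int
  · exact (hF' s).meas.aestronglyMeasurable
  · refine ae_of_all _ fun ω x hx => ?_
    refine (norm_sum_le _ _).trans (Finset.sum_le_sum fun k _ => ?_)
    rw [norm_mul, norm_neg, norm_prod]
    have hx' : |x| ≤ 2 := by
      rw [Metric.mem_ball, Real.dist_eq] at hx
      have := abs_sub_abs_le_abs_sub x s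
      linarith
    have h1 : ∏ j ∈ Finset.univ.erase k, ‖1 - x * J j ω‖ ≤ 3 ^ (Finset.univ.erase k).card := by
      rw [← Finset.prod_const]
      refine Finset.prod_le_prod (fun _ _ => norm_nonneg _) fun j _ => ?_
      rw [Real.norm_eq_abs]
      have h2 := abs_sub (1:ℝ) (x * J j ω)
      rw [abs_one, abs_mul, abs_of_nonneg (h01 j ω).1] at h2
      nlinarith [h01 j ω, abs_nonneg x]
    have h2 : ‖J k ω‖ ≤ 1 := by rw [Real.norm_eq_abs, abs_of_nonneg (h01 k ω).1]; exact (h01 k ω).2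
    calc _ ≤ 3 ^ (Finset.univ.erase k).card * 1 := mul_le_mul h1 h2 (norm_nonneg _) (by positivity)
      _ = _ := mul_one _
  · exact integrable_const _
  · refine ae_of_all _ fun ω x hx => ?_
    have := HasDerivAt.fun_finsetProd (u := Finset.univ) (f := fun k (x:ℝ) => 1 - x * J k ω) (f' := fun k => - J k ω) (x := x)
      (fun k _ => by simpa using ((hasDerivAt_id x).mul_const (J k ω)).const_sub 1)
    simpa using this

lemma pois (J : κ → (ι → ℝ) → ℝ) (hB : ∀ k, BM (J k)) (h01 : ∀ k ω, 0 ≤ J k ω ∧ J k ω ≤ 1)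
    (N : κ → Finset κ) (hN : ∀ k, k ∈ N k) (P : κ → Set ι) (hd : ∀ k, DependsOn (J k) (P k))
    (hdis : ∀ k k', k' ∉ N k → Disjoint (P k) (P k')) {s : ℝ} (hs0 : 0 ≤ s) (hs1 : s ≤ 1) :
    |∫ ω, ∏ k, (1 - s * J k ω) ∂(pm ι) - Real.exp (- s * ∑ k, ∫ ω, J k ω ∂(pm ι))| ≤
      ∑ k, ∑ k' ∈ N k, (∫ ω, J k ω ∂(pm ι)) * (∫ ω, J k' ω ∂(pm ι)) +
      ∑ k, ∑ k' ∈ (N k).erase k, ∫ ω, J k ω * J k' ω ∂(pm ι) := by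
  set p : κ → ℝ := fun k => ∫ ω, J k ω ∂(pm ι) with hp
  set lam := ∑ k, p k with hlam
  set b1 := ∑ k, ∑ k' ∈ N k, p k * p k' with hb1
  set b2 := ∑ k, ∑ k' ∈ (N k).erase k, ∫ ω, J k ω * J k' ω ∂(pm ι) with hb2
  have hp0 : ∀ k, 0 ≤ p k := fun k => integral_nonneg fun ω => (h01 k ω).1
  have hlam0 : 0 ≤ lam := Finset.sum_nonneg fun k _ => hp0 k
  have hb10 : 0 ≤ b1 := Finset.sum_nonneg fun k _ => Finset.sum_nonneg fun k' _ => mul_nonneg (hp0 k) (hp0 k')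
  have hb20 : 0 ≤ b2 := Finset.sum_nonneg fun k _ => Finset.sum_nonneg fun k' _ =>
    integral_nonneg fun ω => mul_nonneg (h01 k ω).1 (h01 k' ω).1
  set g : ℝ → ℝ := fun s => ∫ ω, ∏ k, (1 - s * J k ω) ∂(pm ι) with hg
  set g' : ℝ → ℝ := fun s => ∫ ω, ∑ k, (∏ j ∈ Finset.univ.erase k, (1 - s * J j ω)) * (- J k ω) ∂(pm ι) with hg'
  have hF : ∀ (x : ℝ) (k), BM (fun ω => 1 - x * J k ω) := fun x k => (BM.const 1).sub ((BM.const x).mul (hB k))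
  have hFp : ∀ (x : ℝ) (A : Finset κ), BM (fun ω => ∏ k ∈ A, (1 - x * J k ω)) := fun x A => BM.prod _ fun k _ => hF x k
  have key : ∀ x, 0 ≤ x → x ≤ 1 → |g' x + lam * g x| ≤ b1 + b2 := by
    intro x hx0 hx1
    have e1 : g' x = - ∑ k, ∫ ω, J k ω * ∏ j ∈ Finset.univ.erase k, (1 - x * J j ω) ∂(pm ι) := by
      simp only [hg']
      rw [integral_finsetSum]
      · rw [← Finset.sum_neg_distrib]
        refine Finset.sum_congr rfl fun k _ => ?_
        rw [← integral_neg]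
        refine integral_congr_ae (ae_of_all _ fun ω => ?_)
        simp only; ring
      · intro k _
        refine ((hFp x _).mul ?_).int
        simpa using (BM.const 0).sub (hB k)
    have e2 : g' x + lam * g x = ∑ k, (p k * g x - ∫ ω, J k ω * ∏ j ∈ Finset.univ.erase k, (1 - x * J j ω) ∂(pm ι)) := by
      rw [e1, Finset.sum_sub_distrib, hlam, Finset.sum_mul]; ring
    rw [e2]
    have hxJ : ∀ ω k, 0 ≤ x * J k ω ∧ x * J k ω ≤ 1 := fun ω k =>
      ⟨mul_nonneg hx0 (h01 k ω).1, by nlinarith [h01 k ω]⟩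
    have hxJ' : ∀ ω k, x * J k ω ≤ J k ω := fun ω k => by nlinarith [h01 k ω]
    have e3 : ∀ k, - ∑ k' ∈ N k, p k * p k' ≤ (p k * g x - ∫ ω, J k ω * ∏ j ∈ Finset.univ.erase k, (1 - x * J j ω) ∂(pm ι)) ∧
       (p k * g x - ∫ ω, J k ω * ∏ j ∈ Finset.univ.erase k, (1 - x * J j ω) ∂(pm ι)) ≤ ∑ k' ∈ (N k).erase k, ∫ ω, J k ω * J k' ω ∂(pm ι) := by
      intro k
      set A := Finset.univ \ N k with hA
      have hkA : k ∉ A := by simp [hA, hN k]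
      set q := ∫ ω, ∏ j ∈ A, (1 - x * J j ω) ∂(pm ι) with hq
      have hind : ∫ ω, J k ω * ∏ j ∈ A, (1 - x * J j ω) ∂(pm ι) = p k * q := by
        refine indep_mul (hB k) (hFp x A) (hd k) (Q := ⋃ j ∈ A, P j) ?_ ?_
        · intro a b hab
          refine Finset.prod_congr rfl fun j hj => ?_
          rw [hd j fun i hi => hab i (by simp only [Set.mem_iUnion]; exact ⟨j, hj, hi⟩)]
        · rw [Set.disjoint_iUnion₂_right]
          intro j hj
          exact hdis k j (by simpa [hA] using hj)
      have f1 : ∀ ω, 0 ≤ ∏ j ∈ A, (1 - x * J j ω) - ∏ j, (1 - x * J j ω) ∧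
          ∏ j ∈ A, (1 - x * J j ω) - ∏ j, (1 - x * J j ω) ≤ ∑ j ∈ N k, J j ω := by
        intro ω
        have := prod_diff_le (Finset.subset_univ A) (hxJ ω)
        refine ⟨this.1, this.2.trans ?_⟩
        rw [hA, Finset.sdiff_sdiff_eq_self (Finset.subset_univ _)]
        exact Finset.sum_le_sum fun j _ => hxJ' ω j
      have f2 : ∀ ω, 0 ≤ ∏ j ∈ A, (1 - x * J j ω) - ∏ j ∈ Finset.univ.erase k, (1 - x * J j ω) ∧
          ∏ j ∈ A, (1 - x * J j ω) - ∏ j ∈ Finset.univ.erase k, (1 - x * J j ω) ≤ ∑ j ∈ (N k).erase k, J j ω := by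
        intro ω
        have := prod_diff_le (A := A) (B := Finset.univ.erase k) (fun j hj => by
          simp only [Finset.mem_erase, Finset.mem_univ, and_true]; rintro rfl; exact hkA hj) (hxJ ω)
        refine ⟨this.1, this.2.trans ?_⟩
        have e : Finset.univ.erase k \ A = (N k).erase k := by
          ext j; simp [hA]
        rw [e]
        exact Finset.sum_le_sum fun j _ => hxJ' ω j
      have i1 : q - g x = ∫ ω, (∏ j ∈ A, (1 - x * J j ω) - ∏ j, (1 - x * J j ω)) ∂(pm ι) :=
        (integral_sub (hFp x A).int (hFp x _).int).symm
      have i2 : 0 ≤ q - g x := by rw [i1]; exact integral_nonneg fun ω => (f1 ω).1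
      have i3 : q - g x ≤ ∑ j ∈ N k, p j := by
        rw [i1]
        refine (integral_mono ((hFp x A).sub (hFp x _)).int (BM.sum _ fun j _ => hB j).int fun ω => (f1 ω).2).trans ?_
        rw [integral_finsetSum _ fun j _ => (hB j).int]
      have i4 : p k * q - ∫ ω, J k ω * ∏ j ∈ Finset.univ.erase k, (1 - x * J j ω) ∂(pm ι) =
          ∫ ω, J k ω * (∏ j ∈ A, (1 - x * J j ω) - ∏ j ∈ Finset.univ.erase k, (1 - x * J j ω)) ∂(pm ι) := by
        rw [← hind, ← integral_sub ((hB k).mul (hFp x A)).int ((hB k).mul (hFp x _)).int]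
        simp only [mul_sub]
      have i5 : 0 ≤ p k * q - ∫ ω, J k ω * ∏ j ∈ Finset.univ.erase k, (1 - x * J j ω) ∂(pm ι) := by
        rw [i4]; exact integral_nonneg fun ω => mul_nonneg (h01 k ω).1 (f2 ω).1
      have i6 : p k * q - ∫ ω, J k ω * ∏ j ∈ Finset.univ.erase k, (1 - x * J j ω) ∂(pm ι) ≤
          ∑ k' ∈ (N k).erase k, ∫ ω, J k ω * J k' ω ∂(pm ι) := by
        rw [i4]
        refine (integral_mono ((hB k).mul ((hFp x A).sub (hFp x _))).int
          ((hB k).mul (BM.sum _ fun j _ => hB j)).int fun ω => mul_le_mul_of_nonneg_left (f2 ω).2 (h01 k ω).1).trans ?_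
        simp only [Finset.mul_sum]
        rw [integral_finsetSum _ fun j _ => ((hB k).mul (hB j)).int]
      rw [← Finset.mul_sum]
      have := mul_le_mul_of_nonneg_left i3 (hp0 k)
      have := mul_nonneg (hp0 k) i2
      constructor <;> nlinarith
    rw [abs_le]
    constructor
    · have : - b1 ≤ ∑ k, (p k * g x - ∫ ω, J k ω * ∏ j ∈ Finset.univ.erase k, (1 - x * J j ω) ∂(pm ι)) := by
        rw [hb1, ← Finset.sum_neg_distrib]
        exact Finset.sum_le_sum fun k _ => (e3 k).1
      linarith
    · have : ∑ k, (p k * g x - ∫ ω, J k ω * ∏ j ∈ Finset.univ.erase k, (1 - x * J j ω) ∂(pm ι)) ≤ b2 := Finset.sum_le_sum fun k _ => (e3 k).2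
      linarith
  have hder : ∀ x ∈ Set.Icc 0 s, HasDerivWithinAt (fun x => Real.exp (lam * x) * g x)
      (Real.exp (lam * x) * (g' x + lam * g x)) (Set.Icc 0 s) x := by
    intro x hx
    have h1 := pois_deriv J hB h01 x (by rw [abs_of_nonneg hx.1]; exact hx.2.trans hs1)
    have h2 : HasDerivAt (fun x => Real.exp (lam * x)) (Real.exp (lam * x) * lam) x := by
      simpa using ((hasDerivAt_id x).const_mul lam).exp
    refine HasDerivAt.hasDerivWithinAt ?_
    have h3 := h2.mul h1
    refine h3.congr_deriv ?_
    simp only [hg, hg']; ring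
  have hmv := Convex.norm_image_sub_le_of_norm_hasDerivWithin_le (C := Real.exp (lam * s) * (b1 + b2)) hder
    (fun x hx => by
      rw [norm_mul, Real.norm_eq_abs, Real.norm_eq_abs, abs_of_pos (Real.exp_pos _)]
      refine mul_le_mul (Real.exp_le_exp.2 (mul_le_mul_of_nonneg_left hx.2 hlam0)) (key x hx.1 (hx.2.trans hs1)) (abs_nonneg _) (Real.exp_pos _).le)
    (convex_Icc 0 s) (Set.left_mem_Icc.2 hs0) (Set.right_mem_Icc.2 hs0)
  have hg0 : g 0 = 1 := by simp [hg]
  simp only [mul_zero, Real.exp_zero, hg0, one_mul, sub_zero, Real.norm_eq_abs, abs_of_nonneg hs0] at hmv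
  have hE := Real.exp_pos (lam * s)
  have e5 : Real.exp (lam * s) * (g s - Real.exp (-s * lam)) = Real.exp (lam * s) * g s - 1 := by
    rw [mul_sub, ← Real.exp_add, show lam*s + -s*lam = 0 by ring, Real.exp_zero]
  have e6 : Real.exp (lam * s) * |g s - Real.exp (-s * lam)| ≤ Real.exp (lam * s) * ((b1 + b2) * s) := by
    rw [← abs_of_pos hE, ← abs_mul, e5, abs_of_pos hE]; linarith
  have e7 := le_of_mul_le_mul_left e6 hE
  nlinarith
end
end RHP

namespace RHP
open MeasureTheory Filter Set
open RandomHypercube (EdgeIdx pathEdge initSeg)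

section
variable {n : ℕ} [NeZero n]

def ends (n K : ℕ) : Set (EdgeIdx n) := {e | e.1.card < K ∨ n - K ≤ e.1.card}

lemma pe_card (σ : Equiv.Perm (Fin n)) {j : ℕ} (hj : j < n) : (pe σ j).1.card = j := by
  have := initSeg_card σ ⟨j, hj⟩
  simpa [pe, hj, pathEdge] using this

def rng (σ : Equiv.Perm (Fin n)) : Set (EdgeIdx n) := {x | ∃ i, 0 ≤ i ∧ i < n ∧ pe σ i = x}

lemma Ip_dep (σ : Equiv.Perm (Fin n)) : DependsOn (Ip σ) (rng σ) := wI_dep _ _ _ _ _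

lemma exists_swap (σ σ' : Equiv.Perm (Fin n)) :
    ∃ τ : Equiv.Perm (EdgeIdx n), ∀ j < n, τ (pe σ j) = pe σ' j := by
  classical
  have h1 : Function.Injective fun j : Fin n => pe σ j := fun a b h => Fin.ext (pe_inj σ σ _ _ a.2 b.2 h)
  have h2 : Function.Injective fun j : Fin n => pe σ' j := fun a b h => Fin.ext (pe_inj σ' σ' _ _ a.2 b.2 h)
  let e : {x // x ∈ Set.range fun j : Fin n => pe σ j} ≃ {x // x ∈ Set.range fun j : Fin n => pe σ' j} :=
    (Equiv.ofInjective _ h1).symm.trans (Equiv.ofInjective _ h2)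
  refine ⟨e.extendSubtype, fun j hj => ?_⟩
  rw [Equiv.extendSubtype_apply_of_mem e _ ⟨⟨j, hj⟩, rfl⟩]
  have : (⟨pe σ j, ⟨⟨j, hj⟩, rfl⟩⟩ : {x // x ∈ Set.range fun j : Fin n => pe σ j}) = Equiv.ofInjective _ h1 ⟨j, hj⟩ := rfl
  rw [this]
  simp only [e, Equiv.trans_apply, Equiv.symm_apply_apply]
  rfl

def com (σ σ' : Equiv.Perm (Fin n)) : Set (EdgeIdx n) := rng σ ∩ rng σ'

lemma com_eq {σ σ' : Equiv.Perm (Fin n)} {j : ℕ} (hj : j < n) (h : pe σ j ∈ com σ σ') : pe σ' j = pe σ j := by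
  obtain ⟨_, i, _, hi, h2⟩ := h
  have := pe_inj σ' σ i j hi hj h2
  rw [← this, h2, this]
lemma com_eq' {σ σ' : Equiv.Perm (Fin n)} {j : ℕ} (hj : j < n) (h : pe σ' j ∈ com σ σ') : pe σ' j = pe σ j := by
  obtain ⟨⟨i, _, hi, h2⟩, _⟩ := h
  have := pe_inj σ σ' i j hi hj h2
  rw [← h2, this]

lemma R_swap (σ σ' : Equiv.Perm (Fin n)) {D : Set (EdgeIdx n)} (hD : D ⊆ com σ σ') :
    R D (Ip σ') = R D (Ip σ) := by
  funext ω
  unfold R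
  obtain ⟨τ, hτ⟩ := exists_swap σ σ'
  rw [← int_mp (mp_perm τ) ((Ip_BM σ).glue D ω)]
  refine integral_congr_ae (ae_of_all _ fun ω' => ?_)
  have key : ∀ j < n, glue D ω ω' (pe σ' j) = glue D ω (fun i => ω' (τ i)) (pe σ j) := by
    intro j hj
    by_cases h : pe σ j ∈ D
    · have e := com_eq hj (hD h)
      rw [glue_mem h, e, glue_mem h]
    · have h' : pe σ' j ∉ D := fun h' => h (by rw [← com_eq' hj (hD h')]; exact h')
      rw [glue_not_mem h, glue_not_mem h', hτ j hj]
  simp only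
  unfold Ip wI
  congr 1
  apply propext
  unfold W
  refine and_congr ?_ ?_
  · refine forall_congr' fun i => forall_congr' fun a => forall_congr' fun b => by rw [key i b]
  · refine forall_congr' fun i => forall_congr' fun j => forall_congr' fun a => forall_congr' fun b =>
      forall_congr' fun c => by rw [key i (by lia), key j c]

lemma CS (σ σ' : Equiv.Perm (Fin n)) (D : Set (EdgeIdx n)) :
    ∫ ω, R D (Ip σ) ω * R D (Ip σ') ω ∂(pm (EdgeIdx n)) ≤ ∫ ω, Ip σ ω * Ip σ' ω ∂(pm (EdgeIdx n)) := by
  have hb := Ip_BM σ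
  have hb' := Ip_BM σ'
  set C := com σ σ' with hC
  have hsub : C ∩ D ⊆ C := Set.inter_subset_left
  have e1 : ∫ ω, R D (Ip σ) ω * R D (Ip σ') ω ∂(pm (EdgeIdx n)) = ∫ ω, (R (C ∩ D) (Ip σ) ω)^2 ∂(pm (EdgeIdx n)) := by
    rw [← int_R ((hb.R D).mul (hb'.R D)) (C ∩ D)]
    refine integral_congr_ae (ae_of_all _ fun ω => ?_)
    simp only
    rw [R_mul (D := C ∩ D) (hb.R D) (hb'.R D) (dep_R (Ip_dep σ) D) (dep_R (Ip_dep σ') D)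
      (fun x hx => ⟨⟨hx.1.1, hx.2.1⟩, hx.1.2⟩), R_tower Set.inter_subset_right hb,
      R_tower Set.inter_subset_right hb', R_swap σ σ' hsub, sq]
  have e2 : ∫ ω, Ip σ ω * Ip σ' ω ∂(pm (EdgeIdx n)) = ∫ ω, R C (Ip σ) ω * R C (Ip σ) ω ∂(pm (EdgeIdx n)) := by
    rw [← int_R (hb.mul hb') C]
    refine integral_congr_ae (ae_of_all _ fun ω => ?_)
    simp only
    rw [R_mul (D := C) hb hb' (Ip_dep σ) (Ip_dep σ') subset_rfl, R_swap σ σ' (D := C) subset_rfl]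
  rw [e1, e2, ← int_R ((hb.R C).mul (hb.R C)) (C ∩ D)]
  refine integral_mono ?_ (((hb.R C).mul (hb.R C)).R _).int fun ω => ?_
  · simp only [sq]; exact ((hb.R _).mul (hb.R _)).int
  · have := R_sq_le (hb.R C) (C ∩ D) ω
    rwa [R_tower hsub hb] at this

lemma E_Ip (σ : Equiv.Perm (Fin n)) : ∫ ω, Ip σ ω ∂(pm (EdgeIdx n)) = 1 / (n.factorial : ℝ) := by
  unfold Ip
  rw [chain_prob (Nat.zero_le n) (fun i j _ hij hj h => by
    have := pe_inj σ σ i j (by lia) hj h; lia) le_rfl zero_le_one le_rfl]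
  simp

lemma R_Ip_le (σ : Equiv.Perm (Fin n)) {K : ℕ} (hK : 2 * K ≤ n) (ω) :
    R (ends n K) (Ip σ) ω ≤ 1 / ((n - 2 * K).factorial : ℝ) := by
  have h1 : R (ends n K) (Ip σ) ω ≤ R (ends n K) (wI (pe σ) K (n-K) 0 1) ω := by
    refine R_mono (Ip_BM σ) (wI_BM _ _ _ _ _) (fun ω => ind_mono fun h => ?_) ω
    exact ⟨fun i a b => h.1 i (by lia) (by lia), fun i j a b c => h.2 i j (by lia) b (by lia)⟩
  refine h1.trans (le_of_eq ?_)
  unfold R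
  have : ∀ ω', wI (pe σ) K (n-K) 0 1 (glue (ends n K) ω ω') = wI (pe σ) K (n-K) 0 1 ω' := by
    intro ω'
    unfold wI
    rw [W_congr fun i a b => glue_not_mem ?_]
    simp only [ends, Set.mem_ofPred_eq, pe_card σ (show i < n by lia)]
    lia
  simp only [this]
  rw [chain_prob (by lia) (fun i j _ hij hj h => by
    have := pe_inj σ σ i j (by lia) (by lia) h; lia) le_rfl zero_le_one le_rfl]
  simp [show n - K - K = n - 2 * K by lia]

noncomputable def Lam (n : ℕ) [NeZero n] (K : ℕ) (ω : EdgeIdx n → ℝ) : ℝ := ∑ σ, R (ends n K) (Ip σ) ω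

lemma Lam_BM (K : ℕ) : BM (Lam n K) := BM.sum _ fun σ _ => (Ip_BM σ).R _
lemma Lam_nonneg (K : ℕ) (ω) : 0 ≤ Lam n K ω := Finset.sum_nonneg fun σ _ => R_nonneg (Ip_nonneg σ) ω

lemma E_Lam (K : ℕ) : ∫ ω, Lam n K ω ∂(pm (EdgeIdx n)) = 1 := by
  unfold Lam
  rw [integral_finsetSum _ fun σ _ => ((Ip_BM σ).R _).int]
  simp only [int_R (Ip_BM _), E_Ip]
  rw [Finset.sum_const, Finset.card_univ, Fintype.card_perm, Fintype.card_fin, nsmul_eq_mul]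
  field_simp

lemma BM_exp {ι : Type*} [Fintype ι] {f : (ι → ℝ) → ℝ} (hf : BM f) (h0 : ∀ ω, 0 ≤ f ω) {s : ℝ} (hs : 0 ≤ s) :
    BM fun ω => Real.exp (- s * f ω) := by
  refine BM.of01 ?_ fun ω => ⟨(Real.exp_pos _).le, Real.exp_le_one_iff.2 ?_⟩
  · exact Real.measurable_exp.comp (hf.meas.const_mul _)
  · nlinarith [mul_nonneg hs (h0 ω)]

lemma step1 {K : ℕ} (hK : 2 * K ≤ n) {s : ℝ} (hs0 : 0 ≤ s) (hs1 : s ≤ 1) :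
    |∫ ω, ∏ σ, (1 - s * Ip σ ω) ∂(pm (EdgeIdx n)) - ∫ ω, Real.exp (- s * Lam n K ω) ∂(pm (EdgeIdx n))| ≤
      2 * BB n K + 1 / ((n - 2 * K).factorial : ℝ) := by
  classical
  set E := ends n K with hE
  let N : Equiv.Perm (Fin n) → Finset (Equiv.Perm (Fin n)) := fun σ =>
    Finset.univ.filter fun σ' => σ = σ' ∨ midS n K (share σ σ')
  have hNe : ∀ σ, (N σ).erase σ = Finset.univ.filter fun σ' => σ ≠ σ' ∧ midS n K (share σ σ') := by
    intro σ; ext σ'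
    simp only [N, Finset.mem_erase, Finset.mem_filter, Finset.mem_univ, true_and, ne_eq]
    constructor
    · rintro ⟨a, b⟩; exact ⟨fun h => a h.symm, b.resolve_left fun h => a h.symm⟩
    · rintro ⟨a, b⟩; exact ⟨fun h => a h.symm, Or.inr b⟩
  have hNs : ∀ σ, σ ∈ N σ := fun σ => by simp [N]
  have hprod : BM fun ω => ∏ σ : Equiv.Perm (Fin n), (1 - s * Ip σ ω) :=
    BM.prod _ fun σ _ => (BM.const 1).sub ((BM.const s).mul (Ip_BM σ))
  have hpt : ∀ ω, |R E (fun ω => ∏ σ : Equiv.Perm (Fin n), (1 - s * Ip σ ω)) ω - Real.exp (- s * Lam n K ω)| ≤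
      ∑ σ, ∑ σ' ∈ N σ, R E (Ip σ) ω * R E (Ip σ') ω + ∑ σ, ∑ σ' ∈ (N σ).erase σ, R E (fun ω => Ip σ ω * Ip σ' ω) ω := by
    intro ω
    refine pois (ι := EdgeIdx n) (fun σ ω' => Ip σ (glue E ω ω')) (fun σ => (Ip_BM σ).glue E ω)
      (fun σ ω' => ⟨Ip_nonneg _ _, Ip_le_one _ _⟩) N hNs (fun σ => rng σ \ E) (fun σ => dep_glue (Ip_dep σ) E ω) ?_ hs0 hs1
    intro σ σ' h
    rw [Set.disjoint_left]
    rintro x ⟨⟨i, _, hi, rfl⟩, hx⟩ ⟨⟨j, _, hj, h2⟩, _⟩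
    have hij := pe_inj σ' σ j i hj hi h2
    subst hij
    apply h
    simp only [N, Finset.mem_filter, Finset.mem_univ, true_and]
    right
    refine ⟨j, by simp [share, hj, h2], ?_⟩
    simp only [hE, ends, Set.mem_ofPred_eq, pe_card σ hj] at hx
    lia
  have hb1 : ∀ σ σ', BM fun ω => R E (Ip σ) ω * R E (Ip σ') ω := fun σ σ' => ((Ip_BM σ).R E).mul ((Ip_BM σ').R E)
  have hb2 : ∀ σ σ', BM fun ω => R E (fun ω => Ip σ ω * Ip σ' ω) ω := fun σ σ' => ((Ip_BM σ).mul (Ip_BM σ')).R E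
  have hB1 : BM fun ω => ∑ σ, ∑ σ' ∈ N σ, R E (Ip σ) ω * R E (Ip σ') ω :=
    BM.sum _ fun σ _ => BM.sum _ fun σ' _ => hb1 σ σ'
  have hB2 : BM fun ω => ∑ σ, ∑ σ' ∈ (N σ).erase σ, R E (fun ω => Ip σ ω * Ip σ' ω) ω :=
    BM.sum _ fun σ _ => BM.sum _ fun σ' _ => hb2 σ σ'
  have hEx := BM_exp (Lam_BM (n := n) K) (Lam_nonneg K) hs0
  have hoff : ∀ F : Equiv.Perm (Fin n) → Equiv.Perm (Fin n) → ℝ, ∑ σ, ∑ σ' ∈ (N σ).erase σ, F σ σ' =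
      ∑ σ, ∑ σ', ind (σ ≠ σ' ∧ midS n K (share σ σ')) * F σ σ' := by
    intro F
    refine Finset.sum_congr rfl fun σ _ => ?_
    rw [hNe, Finset.sum_filter]
    refine Finset.sum_congr rfl fun σ' _ => ?_
    by_cases h : σ ≠ σ' ∧ midS n K (share σ σ')
    · rw [if_pos h, ind_true h, one_mul]
    · rw [if_neg h, ind_false h, zero_mul]
  have i2 : ∫ ω, ∑ σ, ∑ σ' ∈ (N σ).erase σ, R E (fun ω => Ip σ ω * Ip σ' ω) ω ∂(pm (EdgeIdx n)) ≤ BB n K := by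
    refine le_trans (le_of_eq ?_) (B2_bound (n := n) K)
    rw [← hoff, integral_finsetSum _ fun σ _ => (BM.sum _ fun σ' _ => hb2 σ σ').int]
    refine Finset.sum_congr rfl fun σ _ => ?_
    rw [integral_finsetSum _ fun σ' _ => (hb2 σ σ').int]
    exact Finset.sum_congr rfl fun σ' _ => int_R ((Ip_BM σ).mul (Ip_BM σ')) E
  have i1 : ∫ ω, ∑ σ, ∑ σ' ∈ N σ, R E (Ip σ) ω * R E (Ip σ') ω ∂(pm (EdgeIdx n)) ≤ 1 / ((n - 2 * K).factorial : ℝ) + BB n K := by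
    rw [integral_finsetSum _ fun σ _ => (BM.sum _ fun σ' _ => hb1 σ σ').int]
    have : ∀ σ, ∫ ω, ∑ σ' ∈ N σ, R E (Ip σ) ω * R E (Ip σ') ω ∂(pm (EdgeIdx n)) =
        ∫ ω, R E (Ip σ) ω * R E (Ip σ) ω ∂(pm (EdgeIdx n)) +
          ∑ σ' ∈ (N σ).erase σ, ∫ ω, R E (Ip σ) ω * R E (Ip σ') ω ∂(pm (EdgeIdx n)) := by
      intro σ
      rw [integral_finsetSum _ fun σ' _ => (hb1 σ σ').int, ← Finset.add_sum_erase _ _ (hNs σ)]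
    simp only [this]
    rw [Finset.sum_add_distrib]
    refine add_le_add ?_ ?_
    · have hd : ∀ σ, ∫ ω, R E (Ip σ) ω * R E (Ip σ) ω ∂(pm (EdgeIdx n)) ≤
          1 / ((n - 2 * K).factorial : ℝ) * (1 / (n.factorial : ℝ)) := by
        intro σ
        rw [← E_Ip σ, ← int_R (Ip_BM σ) E, ← integral_const_mul]
        refine integral_mono (hb1 σ σ).int (((Ip_BM σ).R E).int.const_mul _) fun ω => ?_
        exact mul_le_mul_of_nonneg_right (R_Ip_le σ hK ω) (R_nonneg (Ip_nonneg σ) ω)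
      refine (Finset.sum_le_sum fun σ _ => hd σ).trans (le_of_eq ?_)
      rw [Finset.sum_const, Finset.card_univ, Fintype.card_perm, Fintype.card_fin, nsmul_eq_mul]
      field_simp
    · refine le_trans ?_ (B2_bound (n := n) K)
      rw [← hoff]
      exact Finset.sum_le_sum fun σ _ => Finset.sum_le_sum fun σ' _ => CS σ σ' E
  rw [← int_R hprod E, ← integral_sub (hprod.R E).int hEx.int]
  refine (abs_integral_le_integral_abs).trans ?_
  refine (integral_mono ((hprod.R E).sub hEx).abs.int (hB1.add hB2).int hpt).trans ?_
  rw [integral_add hB1.int hB2.int]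
  linarith
end
end RHP

namespace RHP
open MeasureTheory Filter Set
open RandomHypercube (EdgeIdx pathEdge initSeg)

lemma int_coord2 {ι : Type*} [Fintype ι] [DecidableEq ι] (i : ι) {f : (ι → ℝ) → ℝ} (hf : BM f) :
    ∫ ω, f ω ∂(pm ι) = ∫ ω, (∫ v, f (Function.update ω i v) ∂unif) ∂(pm ι) := by
  rw [int_coord i hf]
  have hm : Measurable (fun z : ℝ × (ι → ℝ) => f (Function.update z.2 i z.1)) := by
    refine hf.1.comp (measurable_pi_lambda _ fun j => ?_)
    by_cases h : j = i
    · subst h; simpa using measurable_fst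
    · simp only [Function.update_of_ne h]; fun_prop
  obtain ⟨h1, C, hC⟩ := hf
  exact integral_integral_swap (f := fun v ω => f (Function.update ω i v)) (bint hm (C := C) fun _ => hC _)

section
variable {n : ℕ}

/-- nodup lists of length `k` -/
def L (n : ℕ) : ℕ → Finset (List (Fin n))
  | 0 => {[]}
  | k + 1 => (L n k).biUnion fun p => (p.toFinset)ᶜ.image fun i => i :: p

lemma mem_L_succ {k : ℕ} {i : Fin n} {p : List (Fin n)} : i :: p ∈ L n (k+1) ↔ p ∈ L n k ∧ i ∉ p.toFinset := by
  simp only [L, Finset.mem_biUnion, Finset.mem_image, Finset.mem_compl]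
  constructor
  · rintro ⟨q, hq, j, hj, h⟩
    simp only [List.cons.injEq] at h
    obtain ⟨rfl, rfl⟩ := h
    exact ⟨hq, hj⟩
  · rintro ⟨h1, h2⟩
    exact ⟨p, h1, i, h2, rfl⟩

lemma L_succ_cases {k : ℕ} {q : List (Fin n)} (h : q ∈ L n (k+1)) : ∃ p ∈ L n k, ∃ i, i ∉ p.toFinset ∧ q = i :: p := by
  simp only [L, Finset.mem_biUnion, Finset.mem_image, Finset.mem_compl] at h
  obtain ⟨p, hp, i, hi, rfl⟩ := h
  exact ⟨p, hp, i, hi, rfl⟩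

lemma prod_L_succ {M : Type*} [CommMonoid M] (k : ℕ) (F : List (Fin n) → M) :
    ∏ q ∈ L n (k+1), F q = ∏ p ∈ L n k, ∏ i ∈ (p.toFinset)ᶜ, F (i :: p) := by
  rw [L, Finset.prod_biUnion]
  · refine Finset.prod_congr rfl fun p _ => ?_
    rw [Finset.prod_image]
    intro a _ b _ h
    simpa using h
  · intro p _ q _ hpq
    rw [Function.onFun, Finset.disjoint_left]
    intro x hx hy
    simp only [Finset.mem_image] at hx hy
    obtain ⟨i, _, rfl⟩ := hx
    obtain ⟨j, _, h⟩ := hy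
    simp only [List.cons.injEq] at h
    exact hpq h.2.symm

lemma sum_L_succ (k : ℕ) (F : List (Fin n) → ℝ) :
    ∑ q ∈ L n (k+1), F q = ∑ p ∈ L n k, ∑ i ∈ (p.toFinset)ᶜ, F (i :: p) := by
  have := prod_L_succ (M := Multiplicative ℝ) k F
  exact this

lemma L_card {k : ℕ} {p : List (Fin n)} (h : p ∈ L n k) : p.toFinset.card = k := by
  induction k generalizing p with
  | zero => simp [L] at h; simp [h]
  | succ k ih =>
    obtain ⟨q, hq, i, hi, rfl⟩ := L_succ_cases h
    rw [List.toFinset_cons, Finset.card_insert_of_notMem hi, ih hq]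

lemma L_le {k : ℕ} {p : List (Fin n)} (h : p ∈ L n k) : k ≤ n := by
  rw [← L_card h]; simpa using Finset.card_le_univ p.toFinset

lemma L_compl {k : ℕ} {p : List (Fin n)} (h : p ∈ L n k) : (p.toFinset)ᶜ.card = n - k := by
  rw [Finset.card_compl, L_card h, Fintype.card_fin]

lemma card_L (k : ℕ) : (L n k).card = n.descFactorial k := by
  induction k with
  | zero => simp [L]
  | succ k ih =>
    have h := sum_L_succ (n := n) k (fun _ => 1)
    simp only [Finset.sum_const, nsmul_eq_mul, mul_one] at h
    rw [Finset.sum_congr rfl fun p hp => by rw [L_compl hp], Finset.sum_const, ih, nsmul_eq_mul] at h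
    rw [Nat.descFactorial_succ, mul_comm]
    exact_mod_cast h

def sl (ω : EdgeIdx n → ℝ) : List (Fin n) → ℝ
  | [] => 0
  | i :: p => ω (p.toFinset, i)

def acc (ω : EdgeIdx n → ℝ) : List (Fin n) → Prop
  | [] => True
  | i :: p => acc ω p ∧ sl ω p < ω (p.toFinset, i)

lemma acc_nonneg {ω : EdgeIdx n → ℝ} : ∀ {p : List (Fin n)}, acc ω p → 0 ≤ sl ω p
  | [], _ => le_rfl
  | i :: p, h => (acc_nonneg h.1).trans h.2.le

noncomputable def rr (ω : EdgeIdx n → ℝ) (p : List (Fin n)) : ℝ := max 0 (1 - sl ω p)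
noncomputable def B (ω : EdgeIdx n → ℝ) (p : List (Fin n)) (e : ℕ) : ℝ := ind (acc ω p) * rr ω p ^ e

lemma rr_nonneg (ω : EdgeIdx n → ℝ) (p) : 0 ≤ rr ω p := le_max_left _ _
lemma rr_le_one {ω : EdgeIdx n → ℝ} {p} (h : acc ω p) : rr ω p ≤ 1 :=
  max_le zero_le_one (by linarith [acc_nonneg h])

lemma B_nonneg (ω : EdgeIdx n → ℝ) (p e) : 0 ≤ B ω p e := mul_nonneg (ind_nonneg _) (pow_nonneg (rr_nonneg _ _) _)
lemma B_le_one (ω : EdgeIdx n → ℝ) (p e) : B ω p e ≤ 1 := by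
  unfold B
  by_cases h : acc ω p
  · rw [ind_true h, one_mul]; exact pow_le_one₀ (rr_nonneg _ _) (rr_le_one h)
  · rw [ind_false h, zero_mul]; exact zero_le_one

lemma meas_sl (p : List (Fin n)) : Measurable fun ω => sl ω p := by
  cases p with
  | nil => exact measurable_const
  | cons i p => exact measurable_pi_apply _
lemma meas_rr (p : List (Fin n)) : Measurable fun ω => rr ω p :=
  measurable_const.max (measurable_const.sub (meas_sl p))
lemma meas_acc (p : List (Fin n)) : MeasurableSet {ω | acc ω p} := by
  induction p with
  | nil => simp [acc]
  | cons i p ih =>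
    simp only [acc, Set.ofPred_and]
    exact ih.inter (measurableSet_lt (meas_sl p) (measurable_pi_apply _))
lemma B_BM (p : List (Fin n)) (e : ℕ) : BM fun ω => B ω p e :=
  BM.of01 ((meas_ind (meas_acc p)).mul ((meas_rr p).pow_const e)) fun ω => ⟨B_nonneg _ _ _, B_le_one _ _ _⟩

def low (n k : ℕ) : Set (EdgeIdx n) := {x | x.1.card < k ∧ x.2 ∉ x.1}

lemma low_mono {k k' : ℕ} (h : k ≤ k') : low n k ⊆ low n k' := fun x hx => ⟨by have := hx.1; lia, hx.2⟩

lemma dep_L {k : ℕ} {p : List (Fin n)} (h : p ∈ L n k) {ω ω' : EdgeIdx n → ℝ}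
    (hω : ∀ x ∈ low n k, ω x = ω' x) : sl ω p = sl ω' p ∧ (acc ω p ↔ acc ω' p) := by
  induction k generalizing p with
  | zero => simp [L] at h; subst h; simp [sl, acc]
  | succ k ih =>
    obtain ⟨q, hq, i, hi, rfl⟩ := L_succ_cases h
    obtain ⟨h1, h2⟩ := ih hq fun x hx => hω x (low_mono (by lia) hx)
    have h3 : ω (q.toFinset, i) = ω' (q.toFinset, i) := hω _ ⟨by simp only [L_card hq]; lia, hi⟩
    exact ⟨h3, by simp only [acc, h1, h2, h3]⟩

lemma dep_B {k : ℕ} {p : List (Fin n)} (h : p ∈ L n k) (e : ℕ) : DependsOn (fun ω => B ω p e) (low n k) := by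
  intro a b hab
  obtain ⟨h1, h2⟩ := dep_L h hab
  simp only [B, rr, h1, h2]

/-- one-step integral -/
lemma win_pow {s : ℝ} (hs : 0 ≤ s) (e : ℕ) :
    ∫ v, ind (s < v) * (max 0 (1 - v)) ^ e ∂unif = (max 0 (1 - s)) ^ (e+1) / (e+1) := by
  by_cases h : s ≤ 1
  · have h1 : ∫ v, ind (s < v) * (max 0 (1 - v)) ^ e ∂unif = ∫ v, ind (s < v ∧ v < 1) * (1 - v) ^ e ∂unif := by
      refine integral_congr_ae (ae_unif.mono fun v hv => ?_)
      simp only [hv.2, and_true]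
      rw [max_eq_right (by linarith)]
    rw [h1, unif_window hs h le_rfl, max_eq_right (by linarith)]
    rw [intervalIntegral.integral_comp_sub_left (fun x => x ^ e) 1, integral_pow]
    simp
  · push Not at h
    rw [max_eq_left (by linarith)]
    rw [integral_eq_zero_of_ae]
    · simp
    · filter_upwards [ae_unif] with v hv
      rw [ind_false (by linarith [hv.2]), zero_mul]; rfl

lemma step_int {k : ℕ} {p : List (Fin n)} (hp : p ∈ L n k) {i : Fin n} (hi : i ∉ p.toFinset)
    {G : ℝ → ℝ} (hG : Measurable G) {C : ℝ} (hC : ∀ v, |G v| ≤ C) :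
    ∫ ω, ind (acc ω (i :: p)) * G (ω (p.toFinset, i)) ∂(pm (EdgeIdx n)) =
      ∫ ω, ind (acc ω p) * ∫ v, ind (sl ω p < v) * G v ∂unif ∂(pm (EdgeIdx n)) := by
  have hb : BM fun ω : EdgeIdx n → ℝ => ind (acc ω (i :: p)) * G (ω (p.toFinset, i)) := by
    refine BM.mul (BM.of01 (meas_ind (meas_acc _)) fun ω => ⟨ind_nonneg _, ind_le_one _⟩) ⟨hG.comp (measurable_pi_apply _), C, fun ω => hC _⟩
  rw [int_coord2 (p.toFinset, i) hb]
  refine integral_congr_ae (ae_of_all _ fun ω => ?_)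
  simp only
  rw [← integral_const_mul]
  refine integral_congr_ae (ae_of_all _ fun v => ?_)
  simp only
  obtain ⟨h1, h2⟩ := dep_L hp (ω := Function.update ω (p.toFinset, i) v) (ω' := ω) (fun x hx => by
    rw [Function.update_of_ne]; rintro rfl; have := hx.1; simp only [L_card hp] at this; lia)
  simp only [acc, h1, h2, Function.update_self]
  rw [ind_and, mul_assoc]

lemma E_B_step {k : ℕ} {p : List (Fin n)} (hp : p ∈ L n k) {i : Fin n} (hi : i ∉ p.toFinset) (e : ℕ) :
    ∫ ω, B ω (i :: p) e ∂(pm (EdgeIdx n)) = (∫ ω, B ω p (e+1) ∂(pm (EdgeIdx n))) / (e+1) := by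
  have h1 : ∫ ω, B ω (i :: p) e ∂(pm (EdgeIdx n)) =
      ∫ ω, ind (acc ω (i :: p)) * (max 0 (1 - min 1 (max 0 (ω (p.toFinset, i))))) ^ e ∂(pm (EdgeIdx n)) := by
    refine integral_congr_ae (ae_coord.mono fun ω hω => ?_)
    obtain ⟨a, b⟩ := hω (p.toFinset, i)
    simp only [B, rr, sl]
    rw [max_eq_right a.le, min_eq_right b.le]
  rw [h1, step_int hp hi (G := fun v => (max 0 (1 - min 1 (max 0 v))) ^ e) (C := 1) (by fun_prop), ← integral_div]
  · refine integral_congr_ae (ae_of_all _ fun ω => ?_)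
    simp only [B, rr]
    by_cases h : acc ω p
    · rw [ind_true h, one_mul, one_mul, ← win_pow (acc_nonneg h)]
      refine integral_congr_ae (ae_unif.mono fun v hv => ?_)
      simp only
      rw [max_eq_right hv.1.le, min_eq_right hv.2.le]
    · rw [ind_false h]; simp
  · intro v
    rw [abs_of_nonneg (by positivity)]
    refine pow_le_one₀ (le_max_left _ _) (max_le zero_le_one ?_)
    have : 0 ≤ min 1 (max 0 v) := le_min zero_le_one (le_max_left _ _)
    linarith

lemma E_B {k : ℕ} {p : List (Fin n)} (hp : p ∈ L n k) (e : ℕ) :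
    ∫ ω, B ω p e ∂(pm (EdgeIdx n)) = (e.factorial : ℝ) / ((e + k).factorial : ℝ) := by
  have : IsProbabilityMeasure (pm (EdgeIdx n)) := by unfold pm; infer_instance
  induction k generalizing p e with
  | zero =>
    simp [L] at hp; subst hp
    have : (e.factorial : ℝ) ≠ 0 := by positivity
    simp [B, rr, sl, acc, ind_true, this]
  | succ k ih =>
    obtain ⟨q, hq, i, hi, rfl⟩ := L_succ_cases hp
    rw [E_B_step hq hi, ih hq, Nat.factorial_succ e, show e + 1 + k = e + (k + 1) by ring]
    push_cast
    have : ((e + (k+1)).factorial : ℝ) ≠ 0 := by positivity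
    field_simp

noncomputable def Z (n K : ℕ) (ω : EdgeIdx n → ℝ) : ℝ := ∑ p ∈ L n K, B ω p (n - 2 * K)

lemma Z_BM (K : ℕ) : BM (Z n K) := BM.sum _ fun p _ => B_BM p _
lemma Z_nonneg (K : ℕ) (ω) : 0 ≤ Z n K ω := Finset.sum_nonneg fun p _ => B_nonneg _ _ _
lemma Z_dep (K : ℕ) : DependsOn (Z n K) (low n K) := by
  intro a b h
  exact Finset.sum_congr rfl fun p hp => dep_B hp _ h
noncomputable def EZ (n K : ℕ) : ℝ := (n.descFactorial K : ℝ) * ((n - 2 * K).factorial / ((n - 2 * K + K).factorial : ℝ))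
lemma E_Z (K : ℕ) : ∫ ω, Z n K ω ∂(pm (EdgeIdx n)) = EZ n K := by
  unfold Z EZ
  rw [integral_finsetSum _ fun p _ => (B_BM p _).int, Finset.sum_congr rfl fun p hp => E_B hp _, Finset.sum_const, card_L,
    nsmul_eq_mul]

end
end RHP

namespace RHP
open MeasureTheory Filter Set
open RandomHypercube (EdgeIdx pathEdge initSeg)

lemma EZ_tendsto (K : ℕ) : Tendsto (fun n => EZ n K) atTop (nhds 1) := by
  have h1 : ∀ᶠ n : ℕ in atTop, ∏ i ∈ Finset.range K, (((n:ℝ) - i) / ((n:ℝ) - (K + i))) = EZ n K := by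
    filter_upwards [eventually_ge_atTop (2 * K)] with n hn
    unfold EZ
    have e1 := Nat.factorial_mul_descFactorial (n := n - K) (k := K) (by lia)
    rw [show n - K - K = n - 2 * K by lia] at e1
    rw [show n - 2 * K + K = n - K by lia, ← e1, Finset.prod_div_distrib]
    have hd : ∀ m, K ≤ m → (m.descFactorial K : ℝ) = ∏ i ∈ Finset.range K, ((m:ℝ) - i) := by
      intro m hm
      rw [Nat.descFactorial_eq_prod_range]
      push_cast
      refine Finset.prod_congr rfl fun i hi => ?_
      have := Finset.mem_range.1 hi
      rw [Nat.cast_sub (by lia)]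
    have hp : ((n - K).descFactorial K : ℝ) ≠ 0 := by
      have := Nat.descFactorial_pos.2 (show K ≤ n - K by lia)
      positivity
    rw [hd n (by lia)]
    have e2 := hd (n - K) (by lia)
    rw [Nat.cast_sub (by lia)] at e2
    simp only [sub_sub] at e2
    rw [← e2]
    have : ((n - 2 * K).factorial : ℝ) ≠ 0 := by positivity
    push_cast
    field_simp
  refine Tendsto.congr' h1 ?_
  have h2 : ∀ i ∈ Finset.range K, Tendsto (fun n : ℕ => ((n:ℝ) - i) / ((n:ℝ) - (K + i))) atTop (nhds 1) := by
    intro i _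
    have hd : Tendsto (fun n : ℕ => (n:ℝ) - (K + i)) atTop atTop :=
      tendsto_atTop_add_const_right _ _ tendsto_natCast_atTop_atTop
    have h3 : Tendsto (fun n : ℕ => 1 + (K:ℝ) / ((n:ℝ) - (K + i))) atTop (nhds (1 + 0)) :=
      tendsto_const_nhds.add (hd.const_div_atTop _)
    rw [add_zero] at h3
    refine h3.congr' ?_
    filter_upwards [hd.eventually_gt_atTop 0] with n hn
    field_simp; ring
  simpa using tendsto_finsetProd (Finset.range K) h2

section
variable {n : ℕ}

def rhoF (x : EdgeIdx n) : EdgeIdx n := if x.2 ∈ x.1 then x else ((insert x.2 x.1)ᶜ, x.2)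

lemma rhoF_inv : Function.Involutive (rhoF (n := n)) := by
  rintro ⟨A, i⟩
  by_cases h : i ∈ A
  · simp [rhoF, h]
  · simp only [rhoF, h, if_false]
    rw [if_neg (by simp)]
    ext x
    · simp only [Finset.mem_compl, Finset.mem_insert, not_or, not_and, not_not]
      constructor
      · rintro ⟨h1, h2⟩; exact h2 h1
      · intro hx; exact ⟨fun h' => h (h' ▸ hx), fun _ => hx⟩
    · rfl

def rho (n : ℕ) : EdgeIdx n ≃ EdgeIdx n := rhoF_inv.toPerm

def rev (ω : EdgeIdx n → ℝ) : EdgeIdx n → ℝ := fun x => 1 - ω (rho n x)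

lemma mp_rev : MeasurePreserving (rev (n := n)) (pm (EdgeIdx n)) (pm (EdgeIdx n)) :=
  (mp_reflect (ι := EdgeIdx n)).comp (mp_perm (rho n))

lemma rev_meas : Measurable (rev (n := n)) := mp_rev.measurable

def high (n K : ℕ) : Set (EdgeIdx n) := {x | n - K ≤ x.1.card}

lemma Zrev_dep {K : ℕ} : DependsOn (fun ω => Z n K (rev ω)) (high n K) := by
  intro a b h
  refine Z_dep K fun x hx => ?_
  obtain ⟨h1, h2⟩ := hx
  unfold rev
  rw [h]
  change rhoF x ∈ _
  simp only [rhoF, h2, if_false, high, Set.mem_ofPred_eq]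
  rw [Finset.card_compl, Finset.card_insert_of_notMem h2, Fintype.card_fin]
  lia

lemma low_high {K : ℕ} (hK : 2 * K ≤ n) : Disjoint (low n K) (high n K) := by
  rw [Set.disjoint_left]
  intro x h1 h2
  have a := h1.1
  have b : n - K ≤ x.1.card := h2
  lia

lemma E_ZZ {K : ℕ} (hK : 2 * K ≤ n) : ∫ ω, Z n K ω * Z n K (rev ω) ∂(pm (EdgeIdx n)) = EZ n K ^ 2 := by
  rw [indep_mul (Z_BM K) ((Z_BM K).comp rev_meas) (Z_dep K) Zrev_dep (low_high hK), int_mp mp_rev (Z_BM K), E_Z, sq]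

variable [NeZero n]

def pl (σ : Equiv.Perm (Fin n)) : ℕ → List (Fin n)
  | 0 => []
  | k + 1 => (pe σ k).2 :: pl σ k

lemma pe_val (σ : Equiv.Perm (Fin n)) {k : ℕ} (hk : k < n) : pe σ k = (initSeg n σ ⟨k, hk⟩, σ ⟨k, hk⟩) := by
  simp [pe, hk, pathEdge]

lemma pl_set (σ : Equiv.Perm (Fin n)) {k : ℕ} (hk : k < n) : (pl σ k).toFinset = (pe σ k).1 := by
  induction k with
  | zero => 
    rw [pe_val σ hk]; ext x; simp [pl, initSeg]
  | succ k ih =>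
    rw [pl, List.toFinset_cons, ih (by lia), pe_val σ hk, pe_val σ (show k < n by lia)]
    ext x
    obtain ⟨y, rfl⟩ := σ.surjective x
    simp only [Finset.mem_insert, mem_initSeg, EmbeddingLike.apply_eq_iff_eq, Fin.lt_def, Fin.ext_iff]
    lia

lemma pe_snd_notMem (σ : Equiv.Perm (Fin n)) {k : ℕ} (hk : k < n) : (pe σ k).2 ∉ (pe σ k).1 := by
  rw [pe_val σ hk]; simp [mem_initSeg]

lemma pl_mem (σ : Equiv.Perm (Fin n)) {k : ℕ} (hk : k ≤ n) : pl σ k ∈ L n k := by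
  induction k with
  | zero => simp [pl, L]
  | succ k ih =>
    rw [pl, mem_L_succ]
    refine ⟨ih (by lia), ?_⟩
    rw [pl_set σ (by lia)]
    exact pe_snd_notMem σ (by lia)

lemma pl_inj {σ σ' : Equiv.Perm (Fin n)} {k : ℕ} (hk : k ≤ n) (h : pl σ k = pl σ' k) (j : Fin n) (hj : (j:ℕ) < k) :
    σ j = σ' j := by
  induction k with
  | zero => lia
  | succ k ih =>
    simp only [pl, List.cons.injEq] at h
    by_cases hjk : (j:ℕ) = k
    · have h1 := h.1
      rw [pe_val σ (by lia), pe_val σ' (by lia)] at h1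
      have : j = ⟨k, by lia⟩ := Fin.ext hjk
      rw [this]; exact h1
    · exact ih (by lia) h.2 (by lia)

lemma sl_pl (σ : Equiv.Perm (Fin n)) (ω : EdgeIdx n → ℝ) {k : ℕ} (hk : k < n) : sl ω (pl σ (k+1)) = ω (pe σ k) := by
  simp only [pl, sl, pl_set σ hk]

lemma acc_pl_succ (σ : Equiv.Perm (Fin n)) (ω : EdgeIdx n → ℝ) {k : ℕ} (hk : k < n) :
    acc ω (pl σ (k+1)) ↔ acc ω (pl σ k) ∧ sl ω (pl σ k) < ω (pe σ k) := by
  simp only [pl, acc, pl_set σ hk]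

lemma acc_of (σ : Equiv.Perm (Fin n)) (ω : EdgeIdx n → ℝ) {k : ℕ} (hk : k ≤ n)
    (h0 : ∀ i < k, 0 < ω (pe σ i)) (h1 : ∀ i j, i < j → j < k → ω (pe σ i) < ω (pe σ j)) : acc ω (pl σ k) := by
  induction k with
  | zero => simp [pl, acc]
  | succ k ih =>
    rw [acc_pl_succ σ ω (by lia)]
    refine ⟨ih (by lia) (fun i hi => h0 i (by lia)) (fun i j a b => h1 i j a (by lia)), ?_⟩
    cases k with
    | zero => exact h0 0 (by lia)
    | succ k => rw [sl_pl σ ω (by lia)]; exact h1 _ _ (by lia) (by lia)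

def rp (σ : Equiv.Perm (Fin n)) : Equiv.Perm (Fin n) := Fin.revPerm.trans σ

lemma rev_pe (σ : Equiv.Perm (Fin n)) (ω : EdgeIdx n → ℝ) {j : ℕ} (hj : j < n) :
    rev ω (pe (rp σ) j) = 1 - ω (pe σ (n - 1 - j)) := by
  have hj' : n - 1 - j < n := by lia
  unfold rev
  congr 2
  change rhoF _ = _
  have h1 := pe_snd_notMem (rp σ) hj
  simp only [rhoF, h1, if_false]
  rw [pe_val (rp σ) hj, pe_val σ hj']
  have e : rp σ ⟨j, hj⟩ = σ ⟨n - 1 - j, hj'⟩ := by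
    simp only [rp, Equiv.trans_apply, Fin.revPerm_apply]
    congr 1; ext; simp [Fin.val_rev]; lia
  simp only [e]
  congr 1
  ext x
  obtain ⟨y, rfl⟩ := (rp σ).surjective x
  rw [← e, Finset.mem_compl, Finset.mem_insert, mem_initSeg]
  have e2 : rp σ y = σ y.rev := rfl
  rw [e2, mem_initSeg, ← e2]
  simp only [EmbeddingLike.apply_eq_iff_eq, Fin.lt_def, Fin.ext_iff, Fin.val_rev]
  have := y.2
  lia

lemma R_Ip_le2 (σ : Equiv.Perm (Fin n)) {K : ℕ} (hK : 2 * K < n) (ω) :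
    R (ends n K) (Ip σ) ω ≤ B ω (pl σ K) (n - 2 * K) * B (rev ω) (pl (rp σ) K) (n - 2 * K) / ((n - 2 * K).factorial : ℝ) := by
  have hm : n - K - K = n - 2 * K := by lia
  set s := sl ω (pl σ K) with hs
  set t := 1 - sl (rev ω) (pl (rp σ) K) with ht
  have hg : ∀ ω' i, i < n → (i < K ∨ n - K ≤ i) → glue (ends n K) ω ω' (pe σ i) = ω (pe σ i) := by
    intro ω' i hi h
    apply glue_mem
    simp only [ends, Set.mem_ofPred_eq, pe_card σ hi]; exact h
  have hg' : ∀ ω' i, K ≤ i → i < n - K → glue (ends n K) ω ω' (pe σ i) = ω' (pe σ i) := by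
    intro ω' i hi h
    apply glue_not_mem
    simp only [ends, Set.mem_ofPred_eq, pe_card σ (show i < n by lia)]; lia
  have hpt : ∀ ω', Ip σ (glue (ends n K) ω ω') ≤
      (ind (acc ω (pl σ K)) * ind (acc (rev ω) (pl (rp σ) K))) * wI (pe σ) K (n - K) s t ω' := by
    intro ω'
    unfold Ip wI
    rw [← ind_and, ← ind_and]
    refine ind_mono fun h => ⟨⟨?_, ?_⟩, ?_, ?_⟩
    · refine acc_of σ ω (by lia) (fun i hi => ?_) (fun i j a b => ?_)
      · rw [← hg ω' i (by lia) (by lia)]; exact (h.1 i (by lia) (by lia)).1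
      · rw [← hg ω' i (by lia) (by lia), ← hg ω' j (by lia) (by lia)]; exact h.2 i j (by lia) a (by lia)
    · refine acc_of (rp σ) (rev ω) (by lia) (fun i hi => ?_) (fun i j a b => ?_)
      · rw [rev_pe σ ω (by lia), ← hg ω' _ (by lia) (by lia)]; linarith [(h.1 (n-1-i) (by lia) (by lia)).2]
      · rw [rev_pe σ ω (by lia), rev_pe σ ω (by lia), ← hg ω' (n-1-i) (by lia) (by lia), ← hg ω' (n-1-j) (by lia) (by lia)]
        linarith [h.2 (n-1-j) (n-1-i) (by lia) (by lia) (by lia)]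
    · intro i hi1 hi2
      rw [← hg' ω' i hi1 hi2]
      constructor
      · rcases K with _ | K
        · exact (h.1 i (by lia) (by lia)).1
        · rw [hs, sl_pl σ ω (by lia), ← hg ω' _ (by lia) (by lia)]
          exact h.2 _ _ (by lia) (by lia) (by lia)
      · rcases K with _ | K
        · have := (h.1 i (by lia) (by lia)).2
          simpa [ht, pl, sl] using this
        · rw [ht, sl_pl (rp σ) _ (by lia), rev_pe σ ω (by lia), ← hg ω' _ (by lia) (by lia)]
          have := h.2 i (n - 1 - K) (by lia) (by lia) (by lia)
          linarith
    · intro i j a b c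
      rw [← hg' ω' i (by lia) (by lia), ← hg' ω' j (by lia) (by lia)]
      exact h.2 i j (by lia) b (by lia)
  have h1 : R (ends n K) (Ip σ) ω ≤ (ind (acc ω (pl σ K)) * ind (acc (rev ω) (pl (rp σ) K))) *
      ∫ ω', wI (pe σ) K (n - K) s t ω' ∂(pm (EdgeIdx n)) := by
    rw [← integral_const_mul]
    exact integral_mono ((Ip_BM σ).glue _ ω).int ((wI_BM _ _ _ _ _).int.const_mul _) hpt
  refine h1.trans ?_
  unfold B
  by_cases ha : acc ω (pl σ K)
  swap
  · rw [ind_false ha]; simp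
  by_cases hb : acc (rev ω) (pl (rp σ) K)
  swap
  · rw [ind_false hb]; simp
  rw [ind_true ha, ind_true hb, one_mul, one_mul, one_mul, one_mul]
  have hs0 : 0 ≤ s := acc_nonneg ha
  have ht1 : t ≤ 1 := by have := acc_nonneg hb; linarith
  by_cases hst : s ≤ t
  · rw [chain_prob (by lia) (fun i j _ hij hj h => by
      have := pe_inj σ σ i j (by lia) (by lia) h; lia) hs0 hst ht1, hm, ← mul_pow]
    have e1 : rr ω (pl σ K) = 1 - s := max_eq_right (by linarith)
    have e2 : rr (rev ω) (pl (rp σ) K) = t := max_eq_right (by linarith)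
    rw [e1, e2]
    refine div_le_div_of_nonneg_right (pow_le_pow_left₀ (by linarith) ?_ _) (by positivity)
    nlinarith
  · have : ∀ ω', wI (pe σ) K (n - K) s t ω' = 0 := by
      intro ω'
      refine ind_false fun h => hst ?_
      have := h.1 K le_rfl (by lia)
      linarith
    simp only [this, integral_zero]
    have := rr_nonneg ω (pl σ K)
    have := rr_nonneg (rev ω) (pl (rp σ) K)
    positivity

lemma fiber_card {K : ℕ} (hK : 2 * K ≤ n) (p q : List (Fin n)) :
    (Finset.univ.filter fun σ : Equiv.Perm (Fin n) => pl σ K = p ∧ pl (rp σ) K = q).card ≤ (n - 2 * K).factorial := by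
  classical
  by_cases hne : (Finset.univ.filter fun σ : Equiv.Perm (Fin n) => pl σ K = p ∧ pl (rp σ) K = q).Nonempty
  swap
  · rw [Finset.not_nonempty_iff_eq_empty.1 hne]; simp
  obtain ⟨τ, hτ⟩ := hne
  simp only [Finset.mem_filter, Finset.mem_univ, true_and] at hτ
  let P : Fin n → Prop := fun j => K ≤ (j:ℕ) ∧ (j:ℕ) < n - K
  have h1 : (Finset.univ.filter fun σ : Equiv.Perm (Fin n) => pl σ K = p ∧ pl (rp σ) K = q).card ≤
      Fintype.card {f : Equiv.Perm (Fin n) // ∀ a, ¬ P a → f a = a} := by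
    rw [Fintype.card_subtype]
    refine Finset.card_le_card_of_injOn (fun σ => τ⁻¹ * σ) ?_ (fun a _ b _ h => mul_left_cancel h)
    intro σ h
    simp only [Finset.coe_filter, Finset.mem_univ, true_and, Set.mem_ofPred_eq] at h ⊢
    intro a ha
    simp only [Equiv.Perm.mul_apply]
    rw [Equiv.Perm.inv_eq_iff_eq]
    by_cases hlt : (a:ℕ) < K
    · exact pl_inj (by lia) (h.1.trans hτ.1.symm) a hlt
    · have ha' : n - K ≤ (a:ℕ) := by simp only [P] at ha; lia
      have := pl_inj (by lia) (h.2.trans hτ.2.symm) a.rev (by rw [Fin.val_rev]; have := a.2; lia)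
      simpa [rp] using this
  refine h1.trans (le_of_eq ?_)
  rw [← Fintype.card_congr (Equiv.Perm.subtypeEquivSubtypePerm P), Fintype.card_perm]
  congr 1
  rw [Fintype.card_subtype, ← Finset.card_map Fin.valEmbedding]
  have : (Finset.univ.filter P).map Fin.valEmbedding = Finset.Ico K (n - K) := by
    ext x
    simp only [Finset.mem_map, Finset.mem_filter, Finset.mem_univ, true_and, Fin.valEmbedding_apply, P, Finset.mem_Ico]
    constructor
    · rintro ⟨a, h, rfl⟩; exact h
    · intro h; exact ⟨⟨x, by lia⟩, h, rfl⟩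
  rw [this, Nat.card_Ico]; lia

lemma Lam_le {K : ℕ} (hK : 2 * K < n) (ω) : Lam n K ω ≤ Z n K ω * Z n K (rev ω) := by
  classical
  unfold Lam Z
  refine (Finset.sum_le_sum fun σ _ => R_Ip_le2 σ hK ω).trans ?_
  set m := n - 2 * K with hm
  rw [Finset.sum_mul_sum, ← Finset.sum_product']
  have hmaps : ∀ σ ∈ (Finset.univ : Finset (Equiv.Perm (Fin n))), (pl σ K, pl (rp σ) K) ∈ L n K ×ˢ L n K :=
    fun σ _ => Finset.mem_product.2 ⟨pl_mem σ (by lia), pl_mem _ (by lia)⟩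
  rw [← Finset.sum_fiberwise_of_maps_to hmaps]
  refine Finset.sum_le_sum fun x hx => ?_
  obtain ⟨p, q⟩ := x
  have : ∀ σ ∈ Finset.univ.filter (fun σ : Equiv.Perm (Fin n) => (pl σ K, pl (rp σ) K) = (p, q)),
      B ω (pl σ K) m * B (rev ω) (pl (rp σ) K) m / (m.factorial : ℝ) = B ω p m * B (rev ω) q m / (m.factorial : ℝ) := by
    intro σ hσ
    simp only [Finset.mem_filter, Finset.mem_univ, true_and, Prod.mk.injEq] at hσ
    rw [hσ.1, hσ.2]
  rw [Finset.sum_congr rfl this, Finset.sum_const, nsmul_eq_mul]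
  have hc := fiber_card (n := n) (K := K) (by lia) p q
  simp only [Prod.mk.injEq]
  have hc' : ((Finset.univ.filter fun σ : Equiv.Perm (Fin n) => pl σ K = p ∧ pl (rp σ) K = q).card : ℝ) ≤ (m.factorial : ℝ) := by
    exact_mod_cast hc
  have hB := mul_nonneg (B_nonneg ω p m) (B_nonneg (rev ω) q m)
  have hf : (0:ℝ) < m.factorial := by positivity
  calc _ ≤ (m.factorial : ℝ) * (B ω p m * B (rev ω) q m / (m.factorial : ℝ)) :=
        mul_le_mul_of_nonneg_right hc' (by positivity)
    _ = _ := by field_simp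

lemma exp_lip {a b : ℝ} (ha : 0 ≤ a) (hab : a ≤ b) : |Real.exp (-a) - Real.exp (-b)| ≤ b - a := by
  rw [abs_of_nonneg (by have := Real.exp_le_exp.2 (neg_le_neg hab); linarith)]
  have h1 : Real.exp (-b) = Real.exp (-a) * Real.exp (-(b-a)) := by rw [← Real.exp_add]; congr 1; ring
  have h2 := Real.add_one_le_exp (-(b-a))
  have h3 : Real.exp (-a) ≤ 1 := Real.exp_le_one_iff.2 (by linarith)
  have h4 := Real.exp_pos (-a)
  rw [h1]
  nlinarith

lemma step2 {K : ℕ} (hK : 2 * K < n) {s : ℝ} (hs0 : 0 ≤ s) (hs1 : s ≤ 1) :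
    |∫ ω, Real.exp (- s * Lam n K ω) ∂(pm (EdgeIdx n)) - ∫ ω, Real.exp (- s * (Z n K ω * Z n K (rev ω))) ∂(pm (EdgeIdx n))|
      ≤ EZ n K ^ 2 - 1 := by
  have hZ := (Z_BM (n := n) K).mul ((Z_BM K).comp rev_meas)
  have hL := Lam_BM (n := n) K
  have h1 := BM_exp hL (Lam_nonneg K) hs0
  have h2 := BM_exp hZ (fun ω => mul_nonneg (Z_nonneg K ω) (Z_nonneg K _)) hs0
  rw [← integral_sub h1.int h2.int]
  refine abs_integral_le_integral_abs.trans ?_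
  rw [← E_ZZ (n := n) (K := K) (by lia), ← E_Lam (n := n) K, ← integral_sub hZ.int hL.int]
  refine integral_mono (h1.sub h2).abs.int (hZ.sub hL).int fun ω => ?_
  have := Lam_le hK ω
  have h0 := Lam_nonneg K ω
  have h3 := exp_lip (a := s * Lam n K ω) (b := s * (Z n K ω * Z n K (rev ω))) (by positivity) (by gcongr)
  simp only [neg_mul]
  refine h3.trans ?_
  nlinarith
end
end RHP

namespace RHP
open MeasureTheory Filter Set

lemma prod_sub_le {κ : Type*} (s : Finset κ) {a b : κ → ℝ} (ha : ∀ k ∈ s, 0 ≤ a k ∧ a k ≤ 1) (hb : ∀ k ∈ s, 0 ≤ b k ∧ b k ≤ 1) :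
    |∏ k ∈ s, a k - ∏ k ∈ s, b k| ≤ ∑ k ∈ s, |a k - b k| := by
  classical
  induction s using Finset.induction_on with
  | empty => simp
  | insert k s hk ih =>
    rw [Finset.prod_insert hk, Finset.prod_insert hk, Finset.sum_insert hk]
    have ih' := ih (fun j hj => ha j (Finset.mem_insert_of_mem hj)) (fun j hj => hb j (Finset.mem_insert_of_mem hj))
    have hk1 := ha k (Finset.mem_insert_self _ _)
    have hp0 : 0 ≤ ∏ j ∈ s, b j := Finset.prod_nonneg fun j hj => (hb j (Finset.mem_insert_of_mem hj)).1
    have hp1 : ∏ j ∈ s, b j ≤ 1 := Finset.prod_le_one (fun j hj => (hb j (Finset.mem_insert_of_mem hj)).1) fun j hj => (hb j (Finset.mem_insert_of_mem hj)).2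
    have e : a k * ∏ j ∈ s, a j - b k * ∏ j ∈ s, b j = a k * (∏ j ∈ s, a j - ∏ j ∈ s, b j) + (a k - b k) * ∏ j ∈ s, b j := by ring
    rw [e]
    refine (abs_add_le _ _).trans ?_
    rw [abs_mul, abs_mul, abs_of_nonneg hk1.1, abs_of_nonneg hp0]
    have h1 : a k * |∏ j ∈ s, a j - ∏ j ∈ s, b j| ≤ 1 * |∏ j ∈ s, a j - ∏ j ∈ s, b j| := mul_le_mul_of_nonneg_right hk1.2 (abs_nonneg _)
    have h2 : |a k - b k| * ∏ j ∈ s, b j ≤ |a k - b k| * 1 := mul_le_mul_of_nonneg_left hp1 (abs_nonneg _)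
    linarith

lemma bonf {κ : Type*} (s : Finset κ) {x : κ → ℝ} (hx : ∀ k ∈ s, 0 ≤ x k ∧ x k ≤ 1) :
    1 - ∑ k ∈ s, x k ≤ ∏ k ∈ s, (1 - x k) ∧
    ∏ k ∈ s, (1 - x k) ≤ 1 - ∑ k ∈ s, x k + ((∑ k ∈ s, x k) * (∑ k ∈ s, x k) - ∑ k ∈ s, x k * x k) := by
  classical
  induction s using Finset.induction_on with
  | empty => simp
  | insert k s hk ih =>
    rw [Finset.prod_insert hk, Finset.sum_insert hk, Finset.sum_insert hk]
    obtain ⟨h1, h2⟩ := ih (fun j hj => hx j (Finset.mem_insert_of_mem hj))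
    obtain ⟨h3, h4⟩ := hx k (Finset.mem_insert_self _ _)
    have h5 : 0 ≤ ∑ k ∈ s, x k := Finset.sum_nonneg fun j hj => (hx j (Finset.mem_insert_of_mem hj)).1
    have h6 : ∏ k ∈ s, (1 - x k) ≤ 1 := Finset.prod_le_one (fun j hj => by linarith [(hx j (Finset.mem_insert_of_mem hj)).2])
      fun j hj => by linarith [(hx j (Finset.mem_insert_of_mem hj)).1]
    constructor
    · nlinarith
    · nlinarith [mul_nonneg h3 h5]

lemma offd {κ : Type*} [DecidableEq κ] (s : Finset κ) (x : κ → ℝ) :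
    (∑ k ∈ s, x k) * (∑ k ∈ s, x k) - ∑ k ∈ s, x k * x k = ∑ p ∈ s, ∑ q ∈ s.erase p, x p * x q := by
  rw [Finset.sum_mul_sum, ← Finset.sum_sub_distrib]
  refine Finset.sum_congr rfl fun p hp => ?_
  rw [← Finset.add_sum_erase _ _ hp]; ring

lemma indep_err {κ : Type*} [DecidableEq κ] (s : Finset κ) {X : κ → ℝ → ℝ} (hm : ∀ k, Measurable (X k))
    (hX : ∀ k v, 0 ≤ X k v ∧ X k v ≤ 1) :
    |∫ v, ∏ k ∈ s, (1 - X k v) ∂unif - ∏ k ∈ s, (1 - ∫ v, X k v ∂unif)| ≤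
      ∑ p ∈ s, ∑ q ∈ s.erase p, (∫ v, X p v * X q v ∂unif + (∫ v, X p v ∂unif) * ∫ v, X q v ∂unif) := by
  have hi : ∀ k, Integrable (X k) unif := fun k => bint (hm k) (C := 1) fun v => by
    rw [abs_of_nonneg (hX k v).1]; exact (hX k v).2
  have hi2 : ∀ p q, Integrable (fun v => X p v * X q v) unif := fun p q => bint ((hm p).mul (hm q)) (C := 1) fun v => by
    rw [abs_of_nonneg (mul_nonneg (hX p v).1 (hX q v).1)]; exact mul_le_one₀ (hX p v).2 (hX q v).1 (hX q v).2
  have hy : ∀ k ∈ s, 0 ≤ ∫ v, X k v ∂unif ∧ ∫ v, X k v ∂unif ≤ 1 := fun k _ => ⟨integral_nonneg fun v => (hX k v).1, by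
    have := integral_mono (hi k) (integrable_const (1:ℝ)) fun v => (hX k v).2
    simpa using this⟩
  have hP : Integrable (fun v => ∏ k ∈ s, (1 - X k v)) unif := by
    refine bint (Finset.measurable_prod _ fun k _ => measurable_const.sub (hm k)) (C := 1) fun v => ?_
    rw [abs_of_nonneg (Finset.prod_nonneg fun k _ => by linarith [(hX k v).2])]
    exact Finset.prod_le_one (fun k _ => by linarith [(hX k v).2]) fun k _ => by linarith [(hX k v).1]
  have hS : Integrable (fun v => ∑ k ∈ s, X k v) unif := integrable_finsetSum _ fun k _ => hi k
  have hQ : Integrable (fun v => ∑ p ∈ s, ∑ q ∈ s.erase p, X p v * X q v) unif :=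
    integrable_finsetSum _ fun p _ => integrable_finsetSum _ fun q _ => hi2 p q
  have eS : ∫ v, ∑ k ∈ s, X k v ∂unif = ∑ k ∈ s, ∫ v, X k v ∂unif := integral_finsetSum _ fun k _ => hi k
  have eQ : ∫ v, ∑ p ∈ s, ∑ q ∈ s.erase p, X p v * X q v ∂unif = ∑ p ∈ s, ∑ q ∈ s.erase p, ∫ v, X p v * X q v ∂unif := by
    rw [integral_finsetSum _ fun p _ => integrable_finsetSum _ fun q _ => hi2 p q]
    exact Finset.sum_congr rfl fun p _ => integral_finsetSum _ fun q _ => hi2 p q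
  have l1 : 1 - ∑ k ∈ s, ∫ v, X k v ∂unif ≤ ∫ v, ∏ k ∈ s, (1 - X k v) ∂unif := by
    have := integral_mono ((integrable_const (1:ℝ)).sub hS) hP fun v => (bonf s fun k _ => hX k v).1
    rw [integral_sub' (integrable_const _) hS, eS] at this
    simpa using this
  have l2 : ∫ v, ∏ k ∈ s, (1 - X k v) ∂unif ≤ 1 - ∑ k ∈ s, ∫ v, X k v ∂unif + ∑ p ∈ s, ∑ q ∈ s.erase p, ∫ v, X p v * X q v ∂unif := by
    have := integral_mono hP (((integrable_const (1:ℝ)).sub hS).add hQ) fun v => by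
      have := (bonf s fun k _ => hX k v).2
      rw [offd] at this
      exact this
    rw [integral_add' ((integrable_const _).sub hS) hQ, integral_sub' (integrable_const _) hS, eS, eQ] at this
    simpa using this
  obtain ⟨l3, l4⟩ := bonf s hy
  rw [offd] at l4
  have n1 : 0 ≤ ∑ p ∈ s, ∑ q ∈ s.erase p, ∫ v, X p v * X q v ∂unif :=
    Finset.sum_nonneg fun p _ => Finset.sum_nonneg fun q _ => integral_nonneg fun v => mul_nonneg (hX p v).1 (hX q v).1
  have n2 : 0 ≤ ∑ p ∈ s, ∑ q ∈ s.erase p, (∫ v, X p v ∂unif) * ∫ v, X q v ∂unif :=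
    Finset.sum_nonneg fun p hp => Finset.sum_nonneg fun q hq => mul_nonneg (hy p hp).1 (hy q (Finset.mem_of_mem_erase hq)).1
  simp only [Finset.sum_add_distrib]
  rw [abs_le]
  constructor <;> linarith

/-- single path function -/
noncomputable def xf (lam : ℝ) (e : ℕ) (u : ℝ) : ℝ := lam * u ^ e / (1 + lam * u ^ e)

lemma xf_nonneg {lam : ℝ} (hl : 0 ≤ lam) (e : ℕ) {u : ℝ} (hu : 0 ≤ u) : 0 ≤ xf lam e u := by unfold xf; positivity
lemma xf_le_one {lam : ℝ} (hl : 0 ≤ lam) (e : ℕ) {u : ℝ} (hu : 0 ≤ u) : xf lam e u ≤ 1 := by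
  unfold xf; rw [div_le_one (by positivity)]; linarith
lemma xf_le {lam : ℝ} (hl : 0 ≤ lam) (e : ℕ) {u : ℝ} (hu : 0 ≤ u) : xf lam e u ≤ lam * u ^ e := by
  unfold xf; exact div_le_self (by positivity) (by have : 0 ≤ lam * u ^ e := by positivity
                                                   linarith)

lemma pow_mul_le (e : ℕ) {u : ℝ} (h0 : 0 ≤ u) (h1 : u ≤ 1) : u ^ e * (1 - u) ≤ 1 / (e + 1) := by
  have h2 : (∑ i ∈ Finset.range (e+1), u ^ i) * (1 - u) = 1 - u ^ (e+1) := by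
    have := geom_sum_mul u (e+1); linarith
  have h3 : ((e:ℝ) + 1) * u ^ e ≤ ∑ i ∈ Finset.range (e+1), u ^ i := by
    have : ∑ i ∈ Finset.range (e+1), u ^ e ≤ ∑ i ∈ Finset.range (e+1), u ^ i :=
      Finset.sum_le_sum fun i hi => pow_le_pow_of_le_one h0 h1 (by have := Finset.mem_range.1 hi; lia)
    simpa using this
  rw [le_div_iff₀ (by positivity)]
  have h4 := mul_le_mul_of_nonneg_right h3 (sub_nonneg.2 h1)
  have h5 : 0 ≤ u ^ (e+1) := by positivity
  nlinarith

lemma xf_cont {lam : ℝ} (hl : 0 ≤ lam) (e : ℕ) {r : ℝ} (hr : 0 ≤ r) : IntervalIntegrable (xf lam e) volume 0 r := by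
  refine ContinuousOn.intervalIntegrable ?_
  rw [uIcc_of_le hr]
  unfold xf
  refine ContinuousOn.div (by fun_prop) (by fun_prop) fun u hu => ?_
  have := hu.1
  positivity

lemma log_int {lam : ℝ} (hl : 0 ≤ lam) (e : ℕ) {r : ℝ} (hr : 0 ≤ r) :
    IntervalIntegrable (fun u => lam * u ^ e / (1 + lam * u ^ (e+1))) volume 0 r ∧
    ∫ u in (0:ℝ)..r, lam * u ^ e / (1 + lam * u ^ (e+1)) = Real.log (1 + lam * r ^ (e+1)) / (e+1) := by
  have hint : IntervalIntegrable (fun u => lam * u ^ e / (1 + lam * u ^ (e+1))) volume 0 r := by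
    refine ContinuousOn.intervalIntegrable ?_
    rw [uIcc_of_le hr]
    refine ContinuousOn.div (by fun_prop) (by fun_prop) fun u hu => ?_
    have := hu.1
    positivity
  refine ⟨hint, ?_⟩
  rw [intervalIntegral.integral_eq_sub_of_hasDerivAt (f := fun u => Real.log (1 + lam * u ^ (e+1)) / (e+1)) ?_ hint]
  · simp
  · intro u hu
    rw [uIcc_of_le hr] at hu
    have h0 := hu.1
    have hpos : 0 < 1 + lam * u ^ (e+1) := by positivity
    have h1 : HasDerivAt (fun u : ℝ => 1 + lam * u ^ (e+1)) (lam * ((e+1 : ℕ) * u ^ e)) u := by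
      simpa using ((hasDerivAt_pow (e+1) u).const_mul lam).const_add 1
    refine ((h1.log hpos.ne').div_const ((e:ℝ)+1)).congr_deriv ?_
    push_cast
    field_simp

lemma int_pow' (e : ℕ) (r : ℝ) : ∫ u in (0:ℝ)..r, u ^ e = r ^ (e+1) / (e+1) := by
  rw [integral_pow]; simp

lemma y_bounds {lam : ℝ} (hl : 0 ≤ lam) (e : ℕ) {r : ℝ} (hr : 0 ≤ r) (hr1 : r ≤ 1) :
    0 ≤ (∫ u in (0:ℝ)..r, xf lam e u) ∧ (∫ u in (0:ℝ)..r, xf lam e u) ≤ 1 ∧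
    (∫ u in (0:ℝ)..r, xf lam e u) ≤ lam * r ^ (e+1) / (e+1) ∧
    |(∫ u in (0:ℝ)..r, xf lam e u) - Real.log (1 + lam * r ^ (e+1)) / (e+1)| ≤ lam ^ 2 * r ^ (e+1) / (e+1) ^ 2 := by
  have hx := xf_cont hl e hr
  refine ⟨intervalIntegral.integral_nonneg hr fun u hu => xf_nonneg hl e hu.1, ?_, ?_, ?_⟩
  · have := intervalIntegral.integral_mono_on hr hx (intervalIntegrable_const (c := (1:ℝ))) fun u hu => xf_le_one hl e hu.1
    simp at this; linarith
  · have := intervalIntegral.integral_mono_on hr hx (g := fun u => lam * u ^ e) (Continuous.intervalIntegrable (by fun_prop) _ _) fun u hu => xf_le hl e hu.1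
    rw [intervalIntegral.integral_const_mul, int_pow'] at this
    rwa [mul_div_assoc]
  · obtain ⟨h1, h2⟩ := log_int hl e hr
    rw [← h2, ← intervalIntegral.integral_sub hx h1]
    have key : ∀ u ∈ Icc 0 r, |xf lam e u - lam * u ^ e / (1 + lam * u ^ (e+1))| ≤ lam ^ 2 / (e+1) * u ^ e := by
      intro u hu
      have h0 := hu.1
      have hu1 := hu.2.trans hr1
      have hp := pow_mul_le e h0 hu1
      have p1 : 0 ≤ lam * u ^ e := by positivity
      have p2 : 0 ≤ lam * u ^ (e+1) := by positivity
      have hue : 0 ≤ u ^ e := by positivity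
      have e1 : xf lam e u - lam * u ^ e / (1 + lam * u ^ (e+1)) =
          - (lam ^ 2 * u ^ e * (u ^ e * (1 - u)) / ((1 + lam * u ^ e) * (1 + lam * u ^ (e+1)))) := by
        unfold xf
        have := (show 0 < 1 + lam * u ^ e by positivity).ne'
        have := (show 0 < 1 + lam * u ^ (e+1) by positivity).ne'
        field_simp; ring
      have hnn : 0 ≤ lam ^ 2 * u ^ e * (u ^ e * (1 - u)) := mul_nonneg (by positivity) (mul_nonneg hue (by linarith))
      rw [e1, abs_neg, abs_of_nonneg (div_nonneg hnn (by positivity))]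
      refine (div_le_self hnn (by nlinarith [mul_nonneg p1 p2])).trans ?_
      calc _ ≤ lam ^ 2 * u ^ e * (1 / (e+1)) := mul_le_mul_of_nonneg_left hp (by positivity)
        _ = _ := by ring
    have h3 := intervalIntegral.abs_integral_le_integral_abs (f := fun u => xf lam e u - lam * u ^ e / (1 + lam * u ^ (e+1))) (μ := volume) hr
    refine h3.trans ?_
    have h4 := intervalIntegral.integral_mono_on hr (hx.sub h1).abs (g := fun u => lam ^ 2 / (e+1) * u ^ e) (Continuous.intervalIntegrable (by fun_prop) _ _) key
    refine h4.trans (le_of_eq ?_)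
    rw [intervalIntegral.integral_const_mul, int_pow']
    field_simp

lemma exp_sub_le {x : ℝ} (h0 : 0 ≤ x) : |(1 - x) - Real.exp (-x)| ≤ x ^ 2 ∧ |Real.exp (-x) - 1 / (1 + x)| ≤ x ^ 2 := by
  have h1 := Real.add_one_le_exp (-x)
  have h2 : Real.exp (-x) ≤ 1 / (1 + x) := by
    rw [Real.exp_neg, ← one_div]
    exact one_div_le_one_div_of_le (by linarith) (by linarith [Real.add_one_le_exp x])
  have h3 : 1 / (1 + x) ≤ 1 - x + x ^ 2 := by
    rw [div_le_iff₀ (by linarith)]; nlinarith [pow_nonneg h0 3]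
  constructor <;> rw [abs_le] <;> constructor <;> linarith

lemma single_err {lam : ℝ} (hl : 0 ≤ lam) (e N K : ℕ) (hN : N = e + 1 + K) {r : ℝ} (hr : 0 ≤ r) (hr1 : r ≤ 1) :
    |(1 - ∫ u in (0:ℝ)..r, xf lam e u) ^ N - 1 / (1 + lam * r ^ (e+1))| ≤
      (2 * N / (e+1) ^ 2 * lam ^ 2 + K / (e+1) * lam) * r ^ (e+1) := by
  obtain ⟨y0, y1, y2, y3⟩ := y_bounds hl e hr hr1
  set y := ∫ u in (0:ℝ)..r, xf lam e u with hy
  set l := Real.log (1 + lam * r ^ (e+1)) with hl'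
  have hq : 0 ≤ lam * r ^ (e+1) := by positivity
  have hra : 0 ≤ r ^ (e+1) := by positivity
  have hra1 : r ^ (e+1) ≤ 1 := pow_le_one₀ hr hr1
  have l0 : 0 ≤ l := Real.log_nonneg (by linarith)
  have l1 : l ≤ lam * r ^ (e+1) := by have := Real.log_le_sub_one_of_pos (show 0 < 1 + lam * r ^ (e+1) by linarith); linarith
  have e1 : 1 / (1 + lam * r ^ (e+1)) = Real.exp (-l) := by
    rw [Real.exp_neg, Real.exp_log (by linarith), one_div]
  have e2 : Real.exp (-(N * y)) = Real.exp (-y) ^ N := by rw [← Real.exp_nat_mul]; congr 1; ring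
  have a1 : |(1 - y) ^ N - Real.exp (-(N * y))| ≤ N * y ^ 2 := by
    have := prod_sub_le (Finset.range N) (a := fun _ => 1 - y) (b := fun _ => Real.exp (-y))
      (fun _ _ => ⟨by linarith, by linarith⟩) (fun _ _ => ⟨(Real.exp_pos _).le, Real.exp_le_one_iff.2 (by linarith)⟩)
    simp only [Finset.prod_const, Finset.card_range, Finset.sum_const, nsmul_eq_mul] at this
    rw [e2]
    exact this.trans (mul_le_mul_of_nonneg_left (exp_sub_le y0).1 (by positivity))
  have hNy : 0 ≤ N * y := by positivity
  have a2 : |Real.exp (-(N * y)) - Real.exp (-l)| ≤ |N * y - l| := by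
    rcases le_total (N * y) l with h | h
    · rw [abs_sub_comm (N * y) l, abs_of_nonneg (sub_nonneg.2 h)]; exact exp_lip hNy h
    · rw [abs_sub_comm, abs_of_nonneg (sub_nonneg.2 h)]; exact exp_lip l0 h
  have hN' : (N:ℝ) = e + 1 + K := by rw [hN]; push_cast; ring
  have ha : (0:ℝ) < e + 1 := by positivity
  have a3 : |N * y - l| ≤ N * (lam ^ 2 * r ^ (e+1) / (e+1) ^ 2) + K / (e+1) * (lam * r ^ (e+1)) := by
    have : N * y - l = N * (y - l / (e+1)) + K / (e+1) * l := by
      rw [hN']; field_simp; ring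
    rw [this]
    refine (abs_add_le _ _).trans (add_le_add ?_ ?_)
    · rw [abs_mul, abs_of_nonneg (by positivity : (0:ℝ) ≤ N)]
      exact mul_le_mul_of_nonneg_left y3 (by positivity)
    · rw [abs_of_nonneg (by positivity)]
      exact mul_le_mul_of_nonneg_left l1 (by positivity)
  have a4 : N * y ^ 2 ≤ N * (lam ^ 2 * r ^ (e+1) / (e+1) ^ 2) := by
    refine mul_le_mul_of_nonneg_left ?_ (by positivity)
    have : y ^ 2 ≤ (lam * r ^ (e+1) / (e+1)) ^ 2 := pow_le_pow_left₀ y0 y2 2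
    refine this.trans ?_
    rw [div_pow, mul_pow]
    refine div_le_div_of_nonneg_right (mul_le_mul_of_nonneg_left ?_ (by positivity)) (by positivity)
    nlinarith
  rw [e1]
  calc _ ≤ |(1 - y) ^ N - Real.exp (-(N * y))| + |Real.exp (-(N * y)) - Real.exp (-l)| := abs_sub_le _ _ _
    _ ≤ N * (lam ^ 2 * r ^ (e+1) / (e+1) ^ 2) + (N * (lam ^ 2 * r ^ (e+1) / (e+1) ^ 2) + K / (e+1) * (lam * r ^ (e+1))) := by linarith
    _ = _ := by field_simp; ring
end RHP

namespace RHP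
open MeasureTheory Filter Set
open RandomHypercube (EdgeIdx pathEdge initSeg)

section
variable {n : ℕ}

def ed : List (Fin n) → Finset (EdgeIdx n)
  | [] => ∅
  | i :: p => insert (p.toFinset, i) (ed p)

lemma ed_card {k : ℕ} {p : List (Fin n)} (hp : p ∈ L n k) {x : EdgeIdx n} (hx : x ∈ ed p) : x.1.card < k := by
  induction k generalizing p with
  | zero => simp [L] at hp; subst hp; simp [ed] at hx
  | succ k ih =>
    obtain ⟨q, hq, i, hi, rfl⟩ := L_succ_cases hp
    rw [ed, Finset.mem_insert] at hx
    rcases hx with rfl | hx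
    · simp only [L_card hq]; lia
    · have := ih hq hx; lia

lemma ed_new {k : ℕ} {p q : List (Fin n)} (hp : p ∈ L n k) (hq : q ∈ L n k) (h : p ≠ q) : ∃ x ∈ ed q, x ∉ ed p := by
  induction k generalizing p q with
  | zero => simp [L] at hp hq; exact absurd (hp.trans hq.symm) h
  | succ k ih =>
    obtain ⟨p', hp', i, hi, rfl⟩ := L_succ_cases hp
    obtain ⟨q', hq', j, hj, rfl⟩ := L_succ_cases hq
    by_cases hc : (p'.toFinset, i) = (q'.toFinset, j)
    · have hne : p' ≠ q' := by
        rintro rfl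
        simp only [Prod.mk.injEq, true_and] at hc
        exact h (by rw [hc])
      obtain ⟨x, hx, hx'⟩ := ih hp' hq' hne
      refine ⟨x, by rw [ed]; exact Finset.mem_insert_of_mem hx, ?_⟩
      rw [ed, Finset.mem_insert, not_or]
      refine ⟨?_, hx'⟩
      rintro rfl
      have := ed_card hq' hx
      simp only [L_card hp'] at this; lia
    · refine ⟨(q'.toFinset, j), by rw [ed]; exact Finset.mem_insert_self _ _, ?_⟩
      rw [ed, Finset.mem_insert, not_or]
      refine ⟨fun h' => hc h'.symm, fun h' => ?_⟩
      have := ed_card hp' h'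
      simp only [L_card hq'] at this; lia

lemma dep_ed (p : List (Fin n)) {ω ω' : EdgeIdx n → ℝ} (hω : ∀ x ∈ ed p, ω x = ω' x) :
    sl ω p = sl ω' p ∧ (acc ω p ↔ acc ω' p) := by
  induction p with
  | nil => simp [sl, acc]
  | cons i q ih =>
    obtain ⟨h1, h2⟩ := ih fun x hx => hω x (by rw [ed]; exact Finset.mem_insert_of_mem hx)
    have h3 : ω (q.toFinset, i) = ω' (q.toFinset, i) := hω _ (by rw [ed]; exact Finset.mem_insert_self _ _)
    exact ⟨h3, by simp only [acc, h1, h2, h3]⟩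

lemma acc_ed {ω : EdgeIdx n → ℝ} {p : List (Fin n)} (h : acc ω p) {x} (hx : x ∈ ed p) : 0 ≤ ω x ∧ ω x ≤ sl ω p := by
  induction p with
  | nil => simp [ed] at hx
  | cons i q ih =>
    rw [ed, Finset.mem_insert] at hx
    rcases hx with rfl | hx
    · exact ⟨acc_nonneg h, le_rfl⟩
    · obtain ⟨h1, h2⟩ := ih h.1 hx
      exact ⟨h1, h2.trans h.2.le⟩

noncomputable def M (ω : EdgeIdx n → ℝ) (p q : List (Fin n)) (a : ℕ) : ℝ :=
  ind (acc ω p) * ind (acc ω q) * (min (rr ω p) (rr ω q)) ^ a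

lemma M_nonneg (ω : EdgeIdx n → ℝ) (p q a) : 0 ≤ M ω p q a :=
  mul_nonneg (mul_nonneg (ind_nonneg _) (ind_nonneg _)) (pow_nonneg (le_min (rr_nonneg _ _) (rr_nonneg _ _)) _)

lemma M_BM (p q : List (Fin n)) (a : ℕ) : BM fun ω => M ω p q a := by
  refine BM.of01 (((meas_ind (meas_acc p)).mul (meas_ind (meas_acc q))).mul (((meas_rr p).min (meas_rr q)).pow_const a))
    fun ω => ⟨M_nonneg _ _ _ _, ?_⟩
  unfold M
  by_cases hp : acc ω p
  · by_cases hq : acc ω q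
    · rw [ind_true hp, ind_true hq, one_mul, one_mul]
      exact pow_le_one₀ (le_min (rr_nonneg _ _) (rr_nonneg _ _)) ((min_le_left _ _).trans (rr_le_one hp))
    · rw [ind_false hq]; simp
  · rw [ind_false hp]; simp

lemma fact_ratio (d k : ℕ) : (d.factorial : ℝ) / ((d + k).factorial : ℝ) ≤ (1 / ((d:ℝ) + 1)) ^ k := by
  have := Nat.factorial_mul_pow_le_factorial (m := d) (n := k)
  have h : (d.factorial : ℝ) * ((d:ℝ)+1) ^ k ≤ ((d + k).factorial : ℝ) := by exact_mod_cast this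
  rw [div_le_iff₀ (by positivity), one_div, inv_pow, inv_mul_eq_div, le_div_iff₀ (by positivity)]
  exact h

lemma E_M {k : ℕ} {p q : List (Fin n)} (hp : p ∈ L n k) (hq : q ∈ L n k) (h : p ≠ q) {a d : ℕ} (hd : 2 * d ≤ a) :
    ∫ ω, M ω p q a ∂(pm (EdgeIdx n)) ≤ (1 / ((d:ℝ) + 1)) ^ (k+1) := by
  obtain ⟨x, hx, hx'⟩ := ed_new hp hq h
  let g : ℝ → ℝ := fun v => (max 0 (1 - max 0 v)) ^ d
  have hg : Measurable g := by fun_prop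
  have hg01 : ∀ v, 0 ≤ g v ∧ g v ≤ 1 := fun v => ⟨by positivity, pow_le_one₀ (le_max_left _ _)
    (max_le zero_le_one (by have := le_max_left 0 v; linarith))⟩
  have hgB : BM fun ω : EdgeIdx n → ℝ => g (ω x) := BM.of01 (hg.comp (measurable_pi_apply _)) fun ω => hg01 _
  have hpt : ∀ ω : EdgeIdx n → ℝ, M ω p q a ≤ B ω p d * g (ω x) := by
    intro ω
    by_cases h1 : acc ω p
    swap
    · simp [M, B, ind_false h1]
    by_cases h2 : acc ω q
    swap
    · simp only [M, ind_false h2, mul_zero, zero_mul]; exact mul_nonneg (B_nonneg _ _ _) (hg01 _).1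
    obtain ⟨h3, h4⟩ := acc_ed h2 hx
    simp only [M, B, ind_true h1, ind_true h2, one_mul, g]
    set m := min (rr ω p) (rr ω q) with hm
    have m0 : 0 ≤ m := le_min (rr_nonneg _ _) (rr_nonneg _ _)
    have m1 : m ≤ 1 := (min_le_left _ _).trans (rr_le_one h1)
    calc m ^ a ≤ m ^ (2 * d) := pow_le_pow_of_le_one m0 m1 hd
      _ = m ^ d * m ^ d := by rw [two_mul, pow_add]
      _ ≤ _ := by
        refine mul_le_mul (pow_le_pow_left₀ m0 (min_le_left _ _) _) (pow_le_pow_left₀ m0 ((min_le_right _ _).trans ?_) _)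
          (by positivity) (pow_nonneg (rr_nonneg _ _) _)
        rw [max_eq_right h3]
        exact max_le_max le_rfl (by linarith)
  refine (integral_mono (M_BM p q a).int ((B_BM p d).mul hgB).int hpt).trans ?_
  rw [indep_mul (P := (ed p : Set (EdgeIdx n))) (Q := {x}) (B_BM p d) hgB ?_ ?_ ?_, E_B hp]
  · have e1 : ∫ ω : EdgeIdx n → ℝ, g (ω x) ∂(pm (EdgeIdx n)) = 1 / ((d:ℝ) + 1) := by
      have hmp := mp_eval x
      rw [← integral_map (φ := fun ω : EdgeIdx n → ℝ => ω x) hmp.measurable.aemeasurable hg.aestronglyMeasurable, hmp.map_eq]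
      have := win_pow (le_refl (0:ℝ)) d
      simp only [sub_zero, max_eq_right zero_le_one, one_pow] at this
      rw [← this]
      refine integral_congr_ae (ae_unif.mono fun v hv => ?_)
      simp only [g, ind_true hv.1, max_eq_right hv.1.le, one_mul]
    rw [e1, pow_succ]
    exact mul_le_mul_of_nonneg_right (fact_ratio d k) (by positivity)
  · intro a b hab
    obtain ⟨h1, h2⟩ := dep_ed p (ω := a) (ω' := b) fun y hy => hab y hy
    simp only [B, rr, h1, h2]
  · intro a b hab
    simp only [hab x rfl]
  · rw [Set.disjoint_singleton_right]; exact hx'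

/-- conditional one-edge factor -/
noncomputable def Xp (lam : ℝ) (e : ℕ) (ω : EdgeIdx n → ℝ) (p : List (Fin n)) (v : ℝ) : ℝ :=
  ind (acc ω p) * (ind (sl ω p < v) * xf lam e (max 0 (1 - v)))

variable {lam : ℝ}

lemma Xp_01 (hl : 0 ≤ lam) (e : ℕ) (ω : EdgeIdx n → ℝ) (p v) : 0 ≤ Xp lam e ω p v ∧ Xp lam e ω p v ≤ 1 := by
  have h1 := xf_nonneg hl e (le_max_left 0 (1 - v))
  have h2 := xf_le_one hl e (le_max_left 0 (1 - v))
  unfold Xp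
  have a1 := ind_nonneg (acc ω p); have a2 := ind_le_one (acc ω p)
  have b1 := ind_nonneg (sl ω p < v); have b2 := ind_le_one (sl ω p < v)
  exact ⟨mul_nonneg a1 (mul_nonneg b1 h1), mul_le_one₀ a2 (mul_nonneg b1 h1) (mul_le_one₀ b2 h1 h2)⟩

lemma Xp_meas (e : ℕ) (ω : EdgeIdx n → ℝ) (p) : Measurable (Xp lam e ω p) := by
  unfold Xp xf
  refine measurable_const.mul ((meas_ind measurableSet_Ioi).mul (by fun_prop))

lemma Xp_int (hl : 0 ≤ lam) (e : ℕ) (ω : EdgeIdx n → ℝ) (p) :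
    ∫ v, Xp lam e ω p v ∂unif = ind (acc ω p) * ∫ u in (0:ℝ)..rr ω p, xf lam e u := by
  unfold Xp
  rw [integral_const_mul]
  by_cases h : acc ω p
  swap
  · rw [ind_false h, zero_mul, zero_mul]
  congr 1
  have hs := acc_nonneg h
  unfold rr
  set s := sl ω p
  by_cases h1 : s ≤ 1
  · have e1 : ∫ v, ind (s < v) * xf lam e (max 0 (1 - v)) ∂unif = ∫ v, ind (s < v ∧ v < 1) * xf lam e (1 - v) ∂unif := by
      refine integral_congr_ae (ae_unif.mono fun v hv => ?_)
      simp only [hv.2, and_true]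
      rw [max_eq_right (by linarith)]
    rw [e1, unif_window hs h1 le_rfl, max_eq_right (by linarith)]
    rw [intervalIntegral.integral_comp_sub_left (fun x => xf lam e x) 1]
    simp
  · push Not at h1
    rw [max_eq_left (by linarith), intervalIntegral.integral_same]
    refine integral_eq_zero_of_ae ?_
    filter_upwards [ae_unif] with v hv
    rw [ind_false (by linarith [hv.2]), zero_mul]; rfl

lemma Xp_pair (hl : 0 ≤ lam) (e : ℕ) (ω : EdgeIdx n → ℝ) (p q) :
    ∫ v, Xp lam e ω p v * Xp lam e ω q v ∂unif + (∫ v, Xp lam e ω p v ∂unif) * ∫ v, Xp lam e ω q v ∂unif ≤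
      (lam + lam ^ 2) / (e+1) * M ω p q (e+1) := by
  by_cases h1 : acc ω p
  swap
  · simp [Xp, M, ind_false h1]
  by_cases h2 : acc ω q
  swap
  · simp [Xp, M, ind_false h2]
  have p1 := rr_le_one h1
  have q1 := rr_le_one h2
  have p0 := rr_nonneg ω p
  have q0 := rr_nonneg ω q
  have hM : M ω p q (e+1) = (min (rr ω p) (rr ω q)) ^ (e+1) := by simp [M, ind_true h1, ind_true h2]
  rw [hM]
  set m := min (rr ω p) (rr ω q) with hm
  have ha : (0:ℝ) < e + 1 := by positivity
  have m0 : 0 ≤ m := le_min p0 q0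
  have A : ∫ v, Xp lam e ω p v * Xp lam e ω q v ∂unif ≤ lam / (e+1) * m ^ (e+1) := by
    have e1 : m = max 0 (1 - max (sl ω p) (sl ω q)) := by
      rw [hm]; unfold rr
      rw [← max_min_distrib_left]
      congr 1
      exact min_sub_sub_left 1 _ _
    have hw := win_pow ((acc_nonneg h1).trans (le_max_left _ (sl ω q))) e
    rw [e1, div_mul_eq_mul_div, mul_div_assoc, ← hw, ← integral_const_mul]
    have hmx : ∀ p v, |Xp lam e ω p v| ≤ 1 := fun p v => by rw [abs_of_nonneg (Xp_01 hl e ω p v).1]; exact (Xp_01 hl e ω p v).2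
    refine integral_mono_ae ?_ ?_ (ae_unif.mono fun v hv => ?_)
    · refine bint ((Xp_meas e ω p).mul (Xp_meas e ω q)) (C := 1) fun v => ?_
      rw [abs_mul]; exact mul_le_one₀ (hmx p v) (abs_nonneg _) (hmx q v)
    · refine Integrable.of_bound (C := lam) ?_ (ae_unif.mono fun v hv => ?_)
      · exact (measurable_const.mul ((meas_ind measurableSet_Ioi).mul (by fun_prop))).aestronglyMeasurable
      · rw [Real.norm_eq_abs, max_eq_right (show (0:ℝ) ≤ 1 - v by linarith [hv.2])]
        have i1 := ind_nonneg (max (sl ω p) (sl ω q) < v); have i2 := ind_le_one (max (sl ω p) (sl ω q) < v)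
        have i3 : (0:ℝ) ≤ (1 - v) ^ e := pow_nonneg (by linarith [hv.2]) _
        have i4 : (1 - v) ^ e ≤ 1 := pow_le_one₀ (by linarith [hv.2]) (by linarith [hv.1])
        rw [abs_of_nonneg (by positivity)]
        have := mul_le_one₀ i2 i3 i4
        nlinarith
    · simp only [Xp, ind_true h1, ind_true h2, one_mul]
      have x0 := xf_nonneg hl e (le_max_left 0 (1 - v))
      have x1 := xf_le_one hl e (le_max_left 0 (1 - v))
      have x2 := xf_le hl e (le_max_left 0 (1 - v))
      by_cases c1 : sl ω p < v
      · by_cases c2 : sl ω q < v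
        · rw [ind_true c1, ind_true c2, ind_true (max_lt c1 c2), one_mul, one_mul]
          nlinarith
        · rw [ind_false c2]; simp only [zero_mul, mul_zero]
          have := ind_nonneg (max (sl ω p) (sl ω q) < v); positivity
      · rw [ind_false c1]; simp only [zero_mul]
        have := ind_nonneg (max (sl ω p) (sl ω q) < v); positivity
  have Bb : (∫ v, Xp lam e ω p v ∂unif) * ∫ v, Xp lam e ω q v ∂unif ≤ lam ^ 2 / (e+1) * m ^ (e+1) := by
    rw [Xp_int hl, Xp_int hl, ind_true h1, ind_true h2, one_mul, one_mul]
    obtain ⟨a0, _, a2, _⟩ := y_bounds hl e p0 p1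
    obtain ⟨b0, _, b2, _⟩ := y_bounds hl e q0 q1
    refine (mul_le_mul a2 b2 b0 (by positivity)).trans ?_
    have hmm : rr ω p ^ (e+1) * rr ω q ^ (e+1) ≤ m ^ (e+1) := by
      rw [← mul_pow]
      refine pow_le_pow_left₀ (by positivity) (le_min ?_ ?_) _ <;> nlinarith
    have hinv : (1:ℝ) / (e+1) ≤ 1 := by rw [div_le_one ha]; have : (0:ℝ) ≤ e := by positivity
                                        linarith
    calc lam * rr ω p ^ (e + 1) / (e + 1) * (lam * rr ω q ^ (e + 1) / (e + 1))
        = lam ^ 2 / (e+1) * (rr ω p ^ (e+1) * rr ω q ^ (e+1)) * (1 / (e+1)) := by field_simp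
      _ ≤ lam ^ 2 / (e+1) * (m ^ (e+1)) * 1 := by gcongr
      _ = _ := by ring
  calc _ ≤ lam / (e+1) * m ^ (e+1) + lam ^ 2 / (e+1) * m ^ (e+1) := add_le_add A Bb
    _ = _ := by ring

end
end RHP

namespace RHP
open MeasureTheory Filter Set
open RandomHypercube (EdgeIdx pathEdge initSeg)

section
variable {n : ℕ}

def filt (n k : ℕ) (x : EdgeIdx n) : Finset (List (Fin n)) :=
  (L n k).filter fun p => p.toFinset = x.1 ∧ x.2 ∉ x.1

def Gp (n k : ℕ) (p : List (Fin n)) : Finset (List (Fin n)) :=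
  (L n k).filter fun q => q.toFinset = p.toFinset

lemma filt_eq {k : ℕ} {p : List (Fin n)} {i : Fin n} (hi : i ∉ p.toFinset) : filt n k (p.toFinset, i) = Gp n k p := by
  unfold filt Gp
  refine Finset.filter_congr fun q _ => ?_
  simp only [hi, not_false_eq_true, and_true]

lemma regroup {N : Type*} [CommMonoid N] (k : ℕ) (H : List (Fin n) → EdgeIdx n → N) :
    ∏ p ∈ L n k, ∏ i ∈ (p.toFinset)ᶜ, H p (p.toFinset, i) = ∏ x, ∏ p ∈ filt n k x, H p x := by
  unfold filt
  simp only [Finset.prod_filter]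
  rw [Finset.prod_comm]
  refine Finset.prod_congr rfl fun p _ => ?_
  rw [Fintype.prod_prod_type, Finset.prod_eq_single p.toFinset]
  · simp only [true_and]
    rw [← Finset.prod_filter]
    refine Finset.prod_congr ?_ fun _ _ => rfl
    ext i; simp
  · intro A _ hA
    refine Finset.prod_eq_one fun i _ => ?_
    rw [if_neg]
    rintro ⟨h, _⟩; exact hA h.symm
  · simp

lemma regroup_sum (k : ℕ) (H : List (Fin n) → EdgeIdx n → ℝ) :
    ∑ x, ∑ p ∈ filt n k x, H p x = ∑ p ∈ L n k, ∑ i ∈ (p.toFinset)ᶜ, H p (p.toFinset, i) :=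
  (regroup (N := Multiplicative ℝ) k H).symm

lemma factor_eq {lam : ℝ} (hl : 0 ≤ lam) (e : ℕ) (ω : EdgeIdx n → ℝ) (i : Fin n) (p : List (Fin n)) :
    1 / (1 + lam * B ω (i :: p) e) = 1 - Xp lam e ω p (ω (p.toFinset, i)) := by
  have hb : ∀ u : ℝ, 0 ≤ u → 1 / (1 + lam * u ^ e) = 1 - xf lam e u := by
    intro u hu
    have : 0 ≤ lam * u ^ e := by positivity
    unfold xf
    rw [eq_sub_iff_add_eq, ← add_div, div_self (by linarith)]
  unfold B Xp
  by_cases h : acc ω p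
  · by_cases h2 : sl ω p < ω (p.toFinset, i)
    · rw [ind_true (show acc ω (i :: p) from ⟨h, h2⟩), ind_true h, ind_true h2, one_mul, one_mul, one_mul, hb _ (rr_nonneg _ _)]
      rfl
    · rw [ind_false (show ¬ acc ω (i :: p) from fun h' => h2 h'.2), ind_false h2]; simp
  · rw [ind_false (show ¬ acc ω (i :: p) from fun h' => h h'.1), ind_false h]; simp

noncomputable def Pf (lam : ℝ) (n k e : ℕ) (ω : EdgeIdx n → ℝ) : ℝ := ∏ p ∈ L n k, 1 / (1 + lam * B ω p e)

lemma inv01 {x : ℝ} (h : 0 ≤ x) : 0 ≤ 1 / (1 + x) ∧ 1 / (1 + x) ≤ 1 :=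
  ⟨by positivity, by rw [div_le_one (by linarith)]; linarith⟩

lemma Pf_BM {lam : ℝ} (hl : 0 ≤ lam) (k e : ℕ) : BM (Pf lam n k e) := by
  refine BM.prod _ fun p _ => BM.of01 ?_ fun ω => inv01 (mul_nonneg hl (B_nonneg _ _ _))
  exact measurable_const.div (measurable_const.add (measurable_const.mul (B_BM p e).1))

lemma R_Pf {lam : ℝ} (hl : 0 ≤ lam) (k e : ℕ) (ω : EdgeIdx n → ℝ) :
    R (low n k) (Pf lam n (k+1) e) ω = ∏ x, ∫ v, ∏ p ∈ filt n k x, (1 - Xp lam e ω p v) ∂unif := by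
  unfold R
  rw [← int_prod_coord (fun x v => ∏ p ∈ filt n k x, (1 - Xp lam e ω p v))]
  refine integral_congr_ae (ae_of_all _ fun ω' => ?_)
  simp only []
  rw [← regroup k fun p x => 1 - Xp lam e ω p (ω' x), Pf, prod_L_succ]
  refine Finset.prod_congr rfl fun p hp => Finset.prod_congr rfl fun i hi => ?_
  rw [factor_eq hl, glue_not_mem]
  · obtain ⟨h1, h2⟩ := dep_L hp (ω := glue (low n k) ω ω') (ω' := ω) fun x hx => glue_mem hx
    simp only [Xp, h1, h2]
  · intro h
    have := h.1
    simp only [L_card hp] at this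
    lia

lemma Xp_int01 {lam : ℝ} (hl : 0 ≤ lam) (e : ℕ) (ω : EdgeIdx n → ℝ) (p) :
    0 ≤ 1 - (∫ v, Xp lam e ω p v ∂unif) ∧ 1 - (∫ v, Xp lam e ω p v ∂unif) ≤ 1 := by
  rw [Xp_int hl]
  by_cases h : acc ω p
  · obtain ⟨a, b, _⟩ := y_bounds hl e (rr_nonneg ω p) (rr_le_one h)
    rw [ind_true h]; constructor <;> linarith
  · rw [ind_false h]; norm_num

lemma cond_step {lam : ℝ} (hl : 0 ≤ lam) (k e K : ℕ) (hn : n = k + (e + 1 + K)) (ω : EdgeIdx n → ℝ) :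
    |R (low n k) (Pf lam n (k+1) e) ω - Pf lam n k (e+1) ω| ≤
      ((e + 1 + K : ℕ) : ℝ) * ((lam + lam ^ 2) / (e+1)) * (∑ p ∈ L n k, ∑ q ∈ (Gp n k p).erase p, M ω p q (e+1)) +
      (2 * (e + 1 + K : ℕ) / (e+1) ^ 2 * lam ^ 2 + K / (e+1) * lam) * ∑ p ∈ L n k, B ω p (e+1) := by
  set T := ∏ x, ∏ p ∈ filt n k x, (1 - ∫ v, Xp lam e ω p v ∂unif) with hT
  have hnk : n - k = e + 1 + K := by lia
  have hT2 : T = ∏ p ∈ L n k, (1 - ∫ v, Xp lam e ω p v ∂unif) ^ (e + 1 + K) := by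
    rw [hT, ← regroup k fun p x => 1 - ∫ v, Xp lam e ω p v ∂unif]
    refine Finset.prod_congr rfl fun p hp => ?_
    rw [Finset.prod_const, L_compl hp, hnk]
  have A : |R (low n k) (Pf lam n (k+1) e) ω - T| ≤
      ((e + 1 + K : ℕ) : ℝ) * ((lam + lam ^ 2) / (e+1)) * (∑ p ∈ L n k, ∑ q ∈ (Gp n k p).erase p, M ω p q (e+1)) := by
    rw [R_Pf hl, hT]
    refine (prod_sub_le _ (fun x _ => ?_) (fun x _ => ?_)).trans ?_
    · have hp : ∀ v, 0 ≤ ∏ p ∈ filt n k x, (1 - Xp lam e ω p v) ∧ ∏ p ∈ filt n k x, (1 - Xp lam e ω p v) ≤ 1 := fun v =>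
        ⟨Finset.prod_nonneg fun p _ => by linarith [(Xp_01 hl e ω p v).2],
          Finset.prod_le_one (fun p _ => by linarith [(Xp_01 hl e ω p v).2]) (fun p _ => by linarith [(Xp_01 hl e ω p v).1])⟩
      refine ⟨integral_nonneg fun v => (hp v).1, ?_⟩
      have : ∫ v, ∏ p ∈ filt n k x, (1 - Xp lam e ω p v) ∂unif ≤ ∫ v, (1:ℝ) ∂unif := by
        refine integral_mono (bint ?_ (C := 1) fun v => ?_) (integrable_const _) fun v => (hp v).2
        · exact Finset.measurable_prod _ fun p _ => measurable_const.sub (Xp_meas e ω p)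
        · rw [abs_of_nonneg (hp v).1]; exact (hp v).2
      simpa using this
    · exact ⟨Finset.prod_nonneg fun p _ => (Xp_int01 hl e ω p).1, Finset.prod_le_one (fun p _ => (Xp_int01 hl e ω p).1) fun p _ => (Xp_int01 hl e ω p).2⟩
    · calc _ ≤ ∑ x, ∑ p ∈ filt n k x, ∑ q ∈ (filt n k x).erase p, (lam + lam ^ 2) / (e+1) * M ω p q (e+1) := by
            refine Finset.sum_le_sum fun x _ => ?_
            refine (indep_err _ (fun p => Xp_meas e ω p) (fun p v => Xp_01 hl e ω p v)).trans ?_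
            exact Finset.sum_le_sum fun p _ => Finset.sum_le_sum fun q _ => Xp_pair hl e ω p q
        _ = ∑ p ∈ L n k, ∑ i ∈ (p.toFinset)ᶜ, ∑ q ∈ (Gp n k p).erase p, (lam + lam ^ 2) / (e+1) * M ω p q (e+1) := by
            rw [regroup_sum k fun p x => ∑ q ∈ (filt n k x).erase p, (lam + lam ^ 2) / (e+1) * M ω p q (e+1)]
            refine Finset.sum_congr rfl fun p _ => Finset.sum_congr rfl fun i hi => ?_
            rw [filt_eq (by simpa using hi)]
        _ = _ := by
            rw [Finset.mul_sum]
            refine Finset.sum_congr rfl fun p hp => ?_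
            rw [Finset.sum_const, L_compl hp, hnk, nsmul_eq_mul, ← Finset.mul_sum, mul_assoc]
  have C : |T - Pf lam n k (e+1) ω| ≤
      (2 * (e + 1 + K : ℕ) / (e+1) ^ 2 * lam ^ 2 + K / (e+1) * lam) * ∑ p ∈ L n k, B ω p (e+1) := by
    rw [hT2, Pf, Finset.mul_sum]
    refine (prod_sub_le _ (fun p _ => ?_) (fun p _ => inv01 (mul_nonneg hl (B_nonneg _ _ _)))).trans (Finset.sum_le_sum fun p _ => ?_)
    · have h := Xp_int01 hl e ω p
      exact ⟨pow_nonneg h.1 _, pow_le_one₀ h.1 h.2⟩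
    · rw [Xp_int hl]
      by_cases h : acc ω p
      · simp only [B, ind_true h, one_mul]
        exact single_err hl e _ K rfl (rr_nonneg _ _) (rr_le_one h)
      · simp [B, ind_false h]
  calc _ ≤ |R (low n k) (Pf lam n (k+1) e) ω - T| + |T - Pf lam n k (e+1) ω| := abs_sub_le _ _ _
    _ ≤ _ := add_le_add A C

end
end RHP

namespace RHP
open MeasureTheory Filter Set
open RandomHypercube (EdgeIdx pathEdge initSeg)

section
variable {n : ℕ}

lemma card_sub (A : Finset (Fin n)) (k : ℕ) : ((L n k).filter fun q => q.toFinset ⊆ A).card ≤ A.card ^ k := by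
  have key : ∑ q ∈ L n k, (if q.toFinset ⊆ A then (1:ℝ) else 0) ≤ (A.card : ℝ) ^ k := by
    induction k with
    | zero => simp only [L, Finset.sum_singleton, pow_zero]; split_ifs <;> simp
    | succ k ih =>
      rw [sum_L_succ]
      calc _ ≤ ∑ p ∈ L n k, (A.card : ℝ) * (if p.toFinset ⊆ A then (1:ℝ) else 0) := by
            refine Finset.sum_le_sum fun p _ => ?_
            by_cases h : p.toFinset ⊆ A
            · rw [if_pos h, mul_one]
              calc ∑ i ∈ (p.toFinset)ᶜ, (if (i :: p).toFinset ⊆ A then (1:ℝ) else 0) ≤ ∑ i : Fin n, (if i ∈ A then (1:ℝ) else 0) := by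
                    refine (Finset.sum_le_univ_sum_of_nonneg fun i => by split_ifs <;> simp).trans ?_
                    refine Finset.sum_le_sum fun i _ => ?_
                    by_cases hi : i ∈ A
                    · rw [if_pos hi]; split_ifs <;> simp
                    · rw [if_neg hi, if_neg]
                      intro hh; exact hi (hh (by simp))
                _ = _ := by simp
            · rw [if_neg h, mul_zero]
              refine (Finset.sum_eq_zero fun i _ => ?_).le
              rw [if_neg]
              intro hh; exact h (Finset.Subset.trans (by intro x; simp; tauto) hh)
        _ ≤ _ := by
            rw [← Finset.mul_sum, pow_succ, mul_comm]
            exact mul_le_mul_of_nonneg_right ih (by positivity)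
  rw [Finset.sum_boole] at key
  exact_mod_cast key

lemma Gp_card {k : ℕ} {p : List (Fin n)} (hp : p ∈ L n k) : (Gp n k p).card ≤ k ^ k := by
  have h := card_sub p.toFinset k
  rw [L_card hp] at h
  refine (Finset.card_le_card ?_).trans h
  intro q hq
  simp only [Gp, Finset.mem_filter] at hq ⊢
  exact ⟨hq.1, hq.2.subset⟩

lemma card_L_le (k : ℕ) : ((L n k).card : ℝ) ≤ (n:ℝ) ^ k := by
  rw [card_L]; exact_mod_cast Nat.descFactorial_le_pow n k

lemma sum_EB {k a : ℕ} {c : ℝ} (hc : (n:ℝ) ≤ c * (a+1)) : 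
    ∑ p ∈ L n k, ∫ ω, B ω p a ∂(pm (EdgeIdx n)) ≤ c ^ k := by
  rw [Finset.sum_congr rfl fun p hp => E_B hp a, Finset.sum_const, nsmul_eq_mul]
  calc _ ≤ (n:ℝ) ^ k * (1/((a:ℝ)+1)) ^ k := mul_le_mul (card_L_le k) (fact_ratio a k) (by positivity) (by positivity)
    _ = (n / (a+1)) ^ k := by rw [← mul_pow, mul_one_div]
    _ ≤ _ := by
      refine pow_le_pow_left₀ (by positivity) ?_ _
      rw [div_le_iff₀ (by positivity)]; exact hc

lemma sum_EM {k a : ℕ} (hn : 0 < n) (ha : (n:ℝ) ≤ 2 * a) :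
    ∑ p ∈ L n k, ∑ q ∈ (Gp n k p).erase p, ∫ ω, M ω p q a ∂(pm (EdgeIdx n)) ≤ (k:ℝ) ^ k * 4 ^ (k+1) / n := by
  have hn' : (0:ℝ) < n := by exact_mod_cast hn
  have hd : 1 / (((a/2 : ℕ):ℝ) + 1) ≤ 4 / n := by
    rw [div_le_div_iff₀ (by positivity) hn']
    have : a ≤ 2 * (a/2) + 1 := by lia
    have : (a:ℝ) ≤ 2 * ((a/2 : ℕ):ℝ) + 1 := by exact_mod_cast this
    linarith
  calc _ ≤ ∑ p ∈ L n k, ∑ q ∈ (Gp n k p).erase p, (4/(n:ℝ)) ^ (k+1) := by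
        refine Finset.sum_le_sum fun p hp => Finset.sum_le_sum fun q hq => ?_
        rw [Finset.mem_erase, Gp, Finset.mem_filter] at hq
        refine (E_M (d := a/2) hp hq.2.1 (Ne.symm hq.1) (by lia)).trans ?_
        exact pow_le_pow_left₀ (by positivity) hd _
    _ ≤ ∑ p ∈ L n k, (k:ℝ) ^ k * (4/(n:ℝ)) ^ (k+1) := by
        refine Finset.sum_le_sum fun p hp => ?_
        rw [Finset.sum_const, nsmul_eq_mul]
        refine mul_le_mul_of_nonneg_right ?_ (by positivity)
        have := (Finset.card_le_card (Finset.erase_subset p (Gp n k p))).trans (Gp_card hp)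
        exact_mod_cast this
    _ ≤ (n:ℝ) ^ k * ((k:ℝ) ^ k * (4/(n:ℝ)) ^ (k+1)) := by
        rw [Finset.sum_const, nsmul_eq_mul]
        exact mul_le_mul_of_nonneg_right (card_L_le k) (by positivity)
    _ = _ := by
        rw [div_pow, pow_succ (n:ℝ) k]; field_simp

noncomputable def CC (K k : ℕ) : ℝ := 2 * ((k:ℝ) ^ k * 4 ^ (k+1)) + (8 + 2 * K) * 2 ^ k

lemma Phi_step {lam : ℝ} (hl : 0 ≤ lam) (k e K : ℕ) (hk : k < K) (hn : n = k + (e + 1 + K)) (hK : 4 * K ≤ n) :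
    |∫ ω, Pf lam n (k+1) e ω ∂(pm (EdgeIdx n)) - ∫ ω, Pf lam n k (e+1) ω ∂(pm (EdgeIdx n))| ≤ (lam + lam ^ 2) * (CC K k / n) := by
  have hn0 : 0 < n := by lia
  have hn' : (0:ℝ) < n := by exact_mod_cast hn0
  have ha : n ≤ 2 * (e+1) := by lia
  have ha' : (n:ℝ) ≤ 2 * ((e:ℝ)+1) := by exact_mod_cast ha
  have hN' : ((e + 1 + K : ℕ):ℝ) ≤ n := by exact_mod_cast (show e + 1 + K ≤ n by lia)
  have he : (0:ℝ) < (e:ℝ) + 1 := by positivity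
  rw [← int_R (Pf_BM hl (k+1) e) (low n k), ← integral_sub ((Pf_BM hl (k+1) e).R _).int (Pf_BM hl k (e+1)).int]
  refine abs_integral_le_integral_abs.trans ?_
  set c1 : ℝ := ((e + 1 + K : ℕ) : ℝ) * ((lam + lam ^ 2) / (e+1)) with hc1
  set c2 : ℝ := (2 * (e + 1 + K : ℕ) / (e+1) ^ 2 * lam ^ 2 + K / (e+1) * lam) with hc2
  have b1 : BM fun ω : EdgeIdx n → ℝ => ∑ p ∈ L n k, ∑ q ∈ (Gp n k p).erase p, M ω p q (e+1) :=
    BM.sum _ fun p _ => BM.sum _ fun q _ => M_BM p q _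
  have b2 : BM fun ω : EdgeIdx n → ℝ => ∑ p ∈ L n k, B ω p (e+1) := BM.sum _ fun p _ => B_BM p _
  refine (integral_mono (BM.abs (BM.sub ((Pf_BM hl (k+1) e).R (low n k)) (Pf_BM hl k (e+1)))).int
    (((BM.const c1).mul b1).add ((BM.const c2).mul b2)).int fun ω => cond_step hl k e K hn ω).trans ?_
  rw [integral_add ((BM.const c1).mul b1).int ((BM.const c2).mul b2).int, integral_const_mul, integral_const_mul,
    integral_finsetSum _ fun p _ => (BM.sum _ fun q _ => M_BM p q _).int, integral_finsetSum _ fun p _ => (B_BM p _).int,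
    Finset.sum_congr rfl fun p _ => integral_finsetSum _ fun q _ => (M_BM p q _).int]
  have s1 := sum_EM (k := k) (a := e+1) hn0 (by push_cast; exact ha')
  have s2 := sum_EB (n := n) (k := k) (a := e+1) (c := 2) (by push_cast; linarith)
  have d1 : c1 ≤ 2 * (lam + lam ^ 2) := by
    rw [hc1, ← mul_div_assoc, div_le_iff₀ he]
    have : 0 ≤ lam + lam ^ 2 := by positivity
    nlinarith
  have d2 : c2 ≤ (8 + 2 * K) / n * (lam + lam ^ 2) := by
    have f1 : 2 * ((e + 1 + K : ℕ):ℝ) / (e+1) ^ 2 ≤ 8 / n := by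
      rw [div_le_div_iff₀ (by positivity) hn']
      nlinarith
    have f2 : (K:ℝ) / (e+1) ≤ 2 * K / n := by
      rw [div_le_div_iff₀ he hn']
      have : (0:ℝ) ≤ K := by positivity
      nlinarith
    have g1 : (0:ℝ) ≤ 8 / n := by positivity
    have g2 : (0:ℝ) ≤ 2 * K / n := by positivity
    calc c2 ≤ 8 / n * lam ^ 2 + 2 * K / n * lam := by
          rw [hc2]; exact add_le_add (mul_le_mul_of_nonneg_right f1 (by positivity)) (mul_le_mul_of_nonneg_right f2 hl)
      _ ≤ 8 / n * (lam + lam ^ 2) + 2 * K / n * (lam + lam ^ 2) :=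
          add_le_add (mul_le_mul_of_nonneg_left (by linarith) g1) (mul_le_mul_of_nonneg_left (by nlinarith) g2)
      _ = _ := by ring
  have c1n : 0 ≤ c1 := by positivity
  have c2n : 0 ≤ c2 := by positivity
  calc _ ≤ (2 * (lam + lam ^ 2)) * ((k:ℝ) ^ k * 4 ^ (k+1) / n) + ((8 + 2 * K) / n * (lam + lam ^ 2)) * 2 ^ k := by
        refine add_le_add ?_ ?_
        · refine (mul_le_mul_of_nonneg_left s1 c1n).trans (mul_le_mul_of_nonneg_right d1 (by positivity))
        · refine (mul_le_mul_of_nonneg_left s2 c2n).trans (mul_le_mul_of_nonneg_right d2 (by positivity))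
    _ = _ := by unfold CC; ring

lemma Phi_tel {lam : ℝ} (hl : 0 ≤ lam) (K : ℕ) (hn0 : 0 < n) (hK : 4 * K ≤ n) (j : ℕ) (hj : j ≤ K) :
    |∫ ω, Pf lam n j (n - K - j) ω ∂(pm (EdgeIdx n)) - 1 / (1 + lam)| ≤ (lam + lam ^ 2) * ((∑ k ∈ Finset.range j, CC K k) / n) := by
  induction j with
  | zero =>
    have : IsProbabilityMeasure (pm (EdgeIdx n)) := by unfold pm; infer_instance
    have h : ∀ ω : EdgeIdx n → ℝ, Pf lam n 0 (n - K - 0) ω = 1 / (1 + lam) := by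
      intro ω
      simp [Pf, L, B, rr, sl, ind_true (show acc ω [] from trivial)]
    simp only [h, integral_const, probReal_univ, one_smul, sub_self, abs_zero, Finset.range_zero, Finset.sum_empty, zero_div, mul_zero, le_refl]
  | succ j ih =>
    have h1 := ih (by lia)
    have h2 := Phi_step hl j (n - K - (j+1)) K hj (by lia) hK
    rw [show n - K - (j+1) + 1 = n - K - j by lia] at h2
    rw [Finset.sum_range_succ, add_div, mul_add]
    refine (abs_sub_le _ (∫ ω, Pf lam n j (n - K - j) ω ∂(pm (EdgeIdx n))) _).trans ?_
    linarith

noncomputable def DD (K : ℕ) : ℝ := ∑ k ∈ Finset.range K, CC K k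

noncomputable def phi (n K : ℕ) (lam : ℝ) : ℝ := ∫ ω, Real.exp (-lam * Z n K ω) ∂(pm (EdgeIdx n))

lemma phi_bound {lam : ℝ} (hl : 0 ≤ lam) (K : ℕ) (hn0 : 0 < n) (hK : 8 * K ≤ n) :
    |phi n K lam - 1 / (1 + lam)| ≤ (lam + lam ^ 2) * (DD K / n + (2/3) ^ K) := by
  have h1 := Phi_tel hl K hn0 (by lia) K le_rfl
  rw [show n - K - K = n - 2 * K by lia] at h1
  have h2 : |phi n K lam - ∫ ω, Pf lam n K (n - 2 * K) ω ∂(pm (EdgeIdx n))| ≤ lam ^ 2 * (2/3) ^ K := by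
    unfold phi
    have be : BM fun ω => Real.exp (-lam * Z n K ω) := BM_exp (Z_BM K) (Z_nonneg K) hl
    rw [← integral_sub be.int (Pf_BM hl _ _).int]
    refine abs_integral_le_integral_abs.trans ?_
    have bs : BM fun ω : EdgeIdx n → ℝ => ∑ p ∈ L n K, B ω p (2 * (n - 2 * K)) := BM.sum _ fun p _ => B_BM p _
    have hp : ∀ ω : EdgeIdx n → ℝ, |Real.exp (-lam * Z n K ω) - Pf lam n K (n - 2 * K) ω| ≤ lam ^ 2 * ∑ p ∈ L n K, B ω p (2 * (n - 2 * K)) := by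
      intro ω
      rw [Z, Finset.mul_sum, Real.exp_sum, Pf, Finset.mul_sum]
      refine (prod_sub_le _ (fun p _ => ⟨(Real.exp_pos _).le, Real.exp_le_one_iff.2 ?_⟩) fun p _ => inv01 (mul_nonneg hl (B_nonneg _ _ _))).trans ?_
      · have := mul_nonneg hl (B_nonneg ω p (n - 2 * K)); linarith
      · refine Finset.sum_le_sum fun p _ => ?_
        have := (exp_sub_le (mul_nonneg hl (B_nonneg ω p (n - 2 * K)))).2
        rw [neg_mul]
        refine this.trans (le_of_eq ?_)
        rw [mul_pow]
        congr 1
        unfold B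
        by_cases h : acc ω p
        · rw [ind_true h, one_mul, one_mul, ← pow_mul, mul_comm]
        · rw [ind_false h]; simp
    refine (integral_mono (be.sub (Pf_BM hl _ _)).abs.int ((BM.const (lam ^ 2)).mul bs).int hp).trans ?_
    rw [integral_const_mul, integral_finsetSum _ fun p _ => (B_BM p _).int]
    refine mul_le_mul_of_nonneg_left (sum_EB ?_) (by positivity)
    have : 3 * n ≤ 2 * (2 * (n - 2 * K) + 1) := by lia
    have : (3:ℝ) * n ≤ 2 * ((2 * (n - 2 * K) : ℕ) + 1) := by exact_mod_cast this
    linarith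
  have h3 : (0:ℝ) ≤ lam * (2/3) ^ K := by positivity
  refine (abs_sub_le _ _ _).trans ((add_le_add h2 h1).trans ?_)
  unfold DD
  linarith

lemma phi_lim {ε : ℝ} (hε : 0 < ε) : ∃ K0 : ℕ, ∀ K ≥ K0, ∀ᶠ n : ℕ in atTop, ∀ lam : ℝ, 0 ≤ lam →
    |phi n K lam - 1 / (1 + lam)| ≤ (lam + lam ^ 2) * ε := by
  have ht : Tendsto (fun K : ℕ => ((2:ℝ)/3) ^ K) atTop (nhds 0) := tendsto_pow_atTop_nhds_zero_of_lt_one (by norm_num) (by norm_num)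
  obtain ⟨K0, hK0⟩ := eventually_atTop.1 (ht.eventually (gt_mem_nhds (half_pos hε)))
  refine ⟨K0, fun K hK => ?_⟩
  have h2 : Tendsto (fun n : ℕ => DD K / (n:ℝ)) atTop (nhds 0) := tendsto_const_div_atTop_nhds_zero_nat _
  filter_upwards [h2.eventually (gt_mem_nhds (half_pos hε)), eventually_ge_atTop (8 * K), eventually_gt_atTop 0] with n h1 h3 h4
  intro lam hl
  refine (phi_bound hl K h4 h3).trans (mul_le_mul_of_nonneg_left ?_ (by positivity))
  linarith [hK0 K hK]

end
end RHP

namespace RHP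
open MeasureTheory Filter Set
open RandomHypercube (EdgeIdx pathEdge initSeg)

section
variable {n : ℕ}

lemma R_ZZ {K : ℕ} (hK : 2 * K ≤ n) {s : ℝ} (hs : 0 ≤ s) (ω : EdgeIdx n → ℝ) :
    R (low n K) (fun ω => Real.exp (-s * (Z n K ω * Z n K (rev ω)))) ω = phi n K (s * Z n K ω) := by
  unfold R phi
  rw [← int_mp mp_rev (BM_exp (Z_BM K) (Z_nonneg K) (mul_nonneg hs (Z_nonneg K ω)))]
  refine integral_congr_ae (ae_of_all _ fun ω' => ?_)
  simp only []
  have h1 : Z n K (glue (low n K) ω ω') = Z n K ω := Z_dep K fun x hx => glue_mem hx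
  have h2 : Z n K (rev (glue (low n K) ω ω')) = Z n K (rev ω') := Zrev_dep fun x hx =>
    glue_not_mem fun h => Set.disjoint_left.1 (low_high hK) h hx
  rw [h1, h2]
  congr 1; ring

lemma phi_lin {K : ℕ} {δ : ℝ} (hδ : 0 < δ) (hδ1 : δ ≤ 1)
    (h : ∀ lam : ℝ, 0 ≤ lam → |phi n K lam - 1 / (1 + lam)| ≤ (lam + lam ^ 2) * δ ^ 2) {lam : ℝ} (hl : 0 ≤ lam) :
    |phi n K lam - 1 / (1 + lam)| ≤ 2 * δ * lam := by
  have : IsProbabilityMeasure (pm (EdgeIdx n)) := by unfold pm; infer_instance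
  have h0 : 0 ≤ phi n K lam := integral_nonneg fun ω => (Real.exp_pos _).le
  have h1 : phi n K lam ≤ 1 := by
    have : phi n K lam ≤ ∫ ω, (1:ℝ) ∂(pm (EdgeIdx n)) := by
      refine integral_mono (BM_exp (Z_BM K) (Z_nonneg K) hl).int (integrable_const _) fun ω => Real.exp_le_one_iff.2 ?_
      have := mul_nonneg hl (Z_nonneg K ω); linarith
    simpa using this
  obtain ⟨i0, i1⟩ := inv01 hl
  by_cases hc : δ * lam ≤ 1
  · refine (h lam hl).trans ?_
    have a : 0 ≤ δ * lam := by positivity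
    nlinarith
  · push Not at hc
    rw [abs_le]; constructor <;> linarith

lemma exp_int_eq {y : ℝ} (hy : 0 ≤ y) : ∫ x in Set.Ioi (0:ℝ), Real.exp (-x) * Real.exp (-(x * y)) = 1 / (1 + y) := by
  have h := integral_exp_mul_Ioi (a := -(1+y)) (by linarith) 0
  rw [← integral_congr_ae (ae_of_all _ fun x => show Real.exp (-(1+y) * x) = _ from ?_), h]
  · rw [mul_zero, Real.exp_zero, neg_div_neg_eq]
  · rw [← Real.exp_add]; congr 1; ring

lemma exp_integrable : Integrable (fun x : ℝ => Real.exp (-x)) (volume.restrict (Set.Ioi 0)) := by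
  have := exp_neg_integrableOn_Ioi 0 one_pos
  simpa [IntegrableOn] using this

lemma xexp_integrable : Integrable (fun x : ℝ => x * Real.exp (-x)) (volume.restrict (Set.Ioi 0)) := by
  have := Real.GammaIntegral_convergent (s := 2) (by norm_num)
  refine Integrable.congr this (ae_restrict_of_forall_mem measurableSet_Ioi fun x hx => ?_)
  norm_num [mul_comm]

lemma xexp_int : ∫ x in Set.Ioi (0:ℝ), x * Real.exp (-x) = 1 := by
  have h := Real.Gamma_eq_integral (s := 2) (by norm_num)
  rw [Real.Gamma_two] at h
  rw [h]
  refine setIntegral_congr_fun measurableSet_Ioi fun x hx => ?_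
  norm_num [mul_comm]

lemma fub {K : ℕ} {s : ℝ} (hs : 0 ≤ s) :
    Integrable (fun x => Real.exp (-x) * phi n K (s * x)) (volume.restrict (Set.Ioi 0)) ∧
    ∫ ω, 1 / (1 + s * Z n K ω) ∂(pm (EdgeIdx n)) = ∫ x in Set.Ioi (0:ℝ), Real.exp (-x) * phi n K (s * x) := by
  have : IsProbabilityMeasure (pm (EdgeIdx n)) := by unfold pm; infer_instance
  let F : (EdgeIdx n → ℝ) → ℝ → ℝ := fun ω x => Real.exp (-x) * Real.exp (-(x * (s * Z n K ω)))
  have hF : Integrable (Function.uncurry F) ((pm (EdgeIdx n)).prod (volume.restrict (Set.Ioi (0:ℝ)))) := by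
    have hb : Integrable (fun z : (EdgeIdx n → ℝ) × ℝ => Real.exp (-z.2)) ((pm (EdgeIdx n)).prod (volume.restrict (Set.Ioi (0:ℝ)))) :=
      exp_integrable.comp_snd _
    refine hb.mono' ?_ ?_
    · have hZ := (Z_BM (n := n) K).1
      refine Measurable.aestronglyMeasurable ?_
      simp only [Function.uncurry_def, F]
      have : Measurable fun z : (EdgeIdx n → ℝ) × ℝ => Z n K z.1 := hZ.comp measurable_fst
      fun_prop
    · have : ∀ᵐ z : (EdgeIdx n → ℝ) × ℝ ∂((pm (EdgeIdx n)).prod (volume.restrict (Set.Ioi (0:ℝ)))), 0 < z.2 :=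
        Measure.quasiMeasurePreserving_snd.ae (ae_restrict_mem measurableSet_Ioi)
      filter_upwards [this] with z hz
      simp only [Function.uncurry_def, F]
      rw [Real.norm_eq_abs, abs_of_pos (by positivity)]
      have h1 : 0 ≤ z.2 * (s * Z n K z.1) := mul_nonneg hz.le (mul_nonneg hs (Z_nonneg K _))
      have h2 : Real.exp (-(z.2 * (s * Z n K z.1))) ≤ 1 := Real.exp_le_one_iff.2 (by linarith)
      exact mul_le_of_le_one_right (Real.exp_pos _).le h2
  have e : ∀ x, ∫ ω, F ω x ∂(pm (EdgeIdx n)) = Real.exp (-x) * phi n K (s * x) := by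
    intro x
    simp only [F, phi]
    rw [integral_const_mul]
    congr 1
    refine integral_congr_ae (ae_of_all _ fun ω => ?_)
    simp only []; congr 1; ring
  constructor
  · have := hF.integral_prod_right
    refine this.congr (ae_of_all _ fun x => ?_)
    exact e x
  · rw [← integral_congr_ae (ae_of_all _ e), ← integral_integral_swap hF]
    refine integral_congr_ae (ae_of_all _ fun ω => ?_)
    exact (exp_int_eq (mul_nonneg hs (Z_nonneg K ω))).symm

noncomputable def GG (s : ℝ) : ℝ := ∫ x in Set.Ioi (0:ℝ), Real.exp (-x) * (1 / (1 + s * x))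

lemma GG_int {s : ℝ} (hs : 0 ≤ s) : Integrable (fun x => Real.exp (-x) * (1 / (1 + s * x))) (volume.restrict (Set.Ioi 0)) := by
  refine exp_integrable.mono' (by fun_prop) (ae_restrict_of_forall_mem measurableSet_Ioi fun x hx => ?_)
  obtain ⟨h1, h2⟩ := inv01 (mul_nonneg hs (le_of_lt hx))
  rw [Real.norm_eq_abs, abs_of_nonneg (mul_nonneg (Real.exp_pos _).le h1)]
  exact mul_le_of_le_one_right (Real.exp_pos _).le h2

lemma step3 {K : ℕ} (hK : 2 * K ≤ n) {s : ℝ} (hs0 : 0 ≤ s) (hs1 : s ≤ 1) {δ : ℝ} (hδ : 0 < δ) (hδ1 : δ ≤ 1)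
    (h : ∀ lam : ℝ, 0 ≤ lam → |phi n K lam - 1 / (1 + lam)| ≤ (lam + lam ^ 2) * δ ^ 2) :
    |∫ ω, Real.exp (- s * (Z n K ω * Z n K (rev ω))) ∂(pm (EdgeIdx n)) - GG s| ≤ 2 * δ * EZ n K + 2 * δ := by
  have hb : BM fun ω => Real.exp (- s * (Z n K ω * Z n K (rev ω))) :=
    BM_exp ((Z_BM K).mul ((Z_BM K).comp rev_meas)) (fun ω => mul_nonneg (Z_nonneg K _) (Z_nonneg K _)) hs0
  have hφ : BM fun ω => phi n K (s * Z n K ω) := by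
    have := hb.R (low n K)
    rwa [funext (R_ZZ hK hs0)] at this
  have hi : BM fun ω => 1 / (1 + s * Z n K ω) := by
    refine BM.of01 (measurable_const.div (measurable_const.add (measurable_const.mul (Z_BM K).1))) fun ω => inv01 (mul_nonneg hs0 (Z_nonneg K _))
  have A : |∫ ω, Real.exp (- s * (Z n K ω * Z n K (rev ω))) ∂(pm (EdgeIdx n)) - ∫ ω, 1 / (1 + s * Z n K ω) ∂(pm (EdgeIdx n))| ≤ 2 * δ * EZ n K := by
    rw [← int_R hb (low n K), funext (R_ZZ hK hs0), ← integral_sub hφ.int hi.int]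
    refine abs_integral_le_integral_abs.trans ?_
    rw [← E_Z, ← integral_const_mul]
    refine integral_mono (hφ.sub hi).abs.int ((BM.const _).mul (Z_BM K)).int fun ω => ?_
    have hz := Z_nonneg K ω
    refine (phi_lin hδ hδ1 h (mul_nonneg hs0 hz)).trans ?_
    have : s * Z n K ω ≤ Z n K ω := mul_le_of_le_one_left hz hs1
    exact mul_le_mul_of_nonneg_left this (by positivity)
  have C : |∫ ω, 1 / (1 + s * Z n K ω) ∂(pm (EdgeIdx n)) - GG s| ≤ 2 * δ := by
    obtain ⟨f1, f2⟩ := fub (n := n) (K := K) hs0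
    rw [f2, GG, ← integral_sub f1 (GG_int hs0)]
    refine abs_integral_le_integral_abs.trans ?_
    have e2 : 2 * δ = ∫ x in Set.Ioi (0:ℝ), 2 * δ * (x * Real.exp (-x)) := by rw [integral_const_mul, xexp_int, mul_one]
    rw [e2]
    refine integral_mono_ae (f1.sub (GG_int hs0)).abs (xexp_integrable.const_mul _) (ae_restrict_of_forall_mem measurableSet_Ioi fun x hx => ?_)
    have hx0 : (0:ℝ) ≤ x := le_of_lt hx
    simp only []
    rw [← mul_sub, abs_mul, abs_of_pos (Real.exp_pos _)]
    have := (phi_lin hδ hδ1 h (mul_nonneg hs0 hx0)).trans (mul_le_mul_of_nonneg_left (mul_le_of_le_one_left hx0 hs1) (by positivity))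
    calc _ ≤ Real.exp (-x) * (2 * δ * x) := mul_le_mul_of_nonneg_left this (Real.exp_pos _).le
      _ = _ := by ring
  exact (abs_sub_le _ _ _).trans (add_le_add A C)

end

lemma pgf_lim {s : ℝ} (hs0 : 0 ≤ s) (hs1 : s ≤ 1) {ε : ℝ} (hε : 0 < ε) :
    ∀ᶠ n : ℕ in atTop, ∀ [NeZero n], |∫ ω, ∏ σ : Equiv.Perm (Fin n), (1 - s * Ip σ ω) ∂(pm (EdgeIdx n)) - GG s| ≤ ε := by
  set δ := min 1 (ε / 32) with hδd
  have hδ : 0 < δ := lt_min one_pos (by positivity)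
  have hδ1 : δ ≤ 1 := min_le_left _ _
  have hδ2 : δ ≤ ε / 32 := min_le_right _ _
  obtain ⟨K1, h1⟩ := phi_lim (pow_pos hδ 2)
  obtain ⟨K2, h2⟩ := BB_small (show 0 < ε / 8 by positivity)
  set K := max K1 K2
  have hf : Tendsto (fun n : ℕ => 1 / ((n - 2 * K : ℕ) : ℝ)) atTop (nhds 0) :=
    tendsto_one_div_atTop_nhds_zero_nat.comp (tendsto_sub_atTop_nat (2 * K))
  have hE := EZ_tendsto K
  have hE2 : Tendsto (fun n => EZ n K ^ 2 - 1) atTop (nhds 0) := by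
    have := (hE.pow 2).sub_const 1
    simpa using this
  filter_upwards [h1 K (le_max_left _ _), h2 K (le_max_right _ _), eventually_gt_atTop (2 * K),
    hf.eventually (gt_mem_nhds (show 0 < ε / 8 by positivity)), hE.eventually (gt_mem_nhds (show (1:ℝ) < 2 by norm_num)),
    hE2.eventually (gt_mem_nhds (show 0 < ε / 8 by positivity))] with n a1 a2 a3 a4 a5 a6
  intro _
  have s1 := step1 (n := n) (K := K) a3.le hs0 hs1
  have s2 := step2 (n := n) (K := K) a3 hs0 hs1
  have s3 := step3 (n := n) (K := K) a3.le hs0 hs1 hδ hδ1 a1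
  have hfac : 1 / ((n - 2 * K).factorial : ℝ) ≤ 1 / ((n - 2 * K : ℕ) : ℝ) := by
    refine one_div_le_one_div_of_le ?_ ?_
    · exact_mod_cast (show 0 < n - 2 * K by lia)
    · exact_mod_cast Nat.self_le_factorial _
  have e3 : 2 * δ * EZ n K + 2 * δ ≤ 6 * δ := by nlinarith
  rw [abs_le] at *
  constructor <;> linarith [s1.1, s1.2, s2.1, s2.2, s3.1, s3.2]

end RHP

namespace RHP
open MeasureTheory Filter Set
open RandomHypercube (EdgeIdx pathEdge initSeg Accessible X cubeMeasure)

lemma coef_lim {p : ℕ → ℕ → ℝ} {q : ℕ → ℝ} {g : ℕ → ℝ → ℝ} {G : ℝ → ℝ}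
    (hp : ∀ᶠ n in atTop, ∀ k t, 0 < t → t < 1 → 0 ≤ g n t - ∑ j ∈ Finset.range (k+1), p n j * t ^ j ∧
      g n t - ∑ j ∈ Finset.range (k+1), p n j * t ^ j ≤ t ^ (k+1))
    (hq : ∀ k t, 0 < t → t < 1 → 0 ≤ G t - ∑ j ∈ Finset.range (k+1), q j * t ^ j ∧
      G t - ∑ j ∈ Finset.range (k+1), q j * t ^ j ≤ t ^ (k+1))
    (hg : ∀ t, 0 < t → t < 1 → Tendsto (fun n => g n t) atTop (nhds (G t))) (k : ℕ) :
    Tendsto (fun n => p n k) atTop (nhds (q k)) := by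
  induction k using Nat.strong_induction_on with
  | _ k ih =>
    rw [Metric.tendsto_nhds]
    intro ε hε
    set t := min (1/2) (ε/2) with ht
    have t0 : 0 < t := lt_min (by norm_num) (by positivity)
    have t1 : t < 1 := (min_le_left _ _).trans_lt (by norm_num)
    have t2 : t ≤ ε / 2 := min_le_right _ _
    have tk : 0 < t ^ k := by positivity
    have hl : Tendsto (fun n => |(g n t - ∑ j ∈ Finset.range k, p n j * t ^ j) - (G t - ∑ j ∈ Finset.range k, q j * t ^ j)|) atTop (nhds 0) := by
      have h1 : Tendsto (fun n => ∑ j ∈ Finset.range k, p n j * t ^ j) atTop (nhds (∑ j ∈ Finset.range k, q j * t ^ j)) :=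
        tendsto_finsetSum _ fun j hj => (ih j (Finset.mem_range.1 hj)).mul_const _
      have h2 := (((hg t t0 t1).sub h1).sub_const (G t - ∑ j ∈ Finset.range k, q j * t ^ j)).abs
      simpa using h2
    filter_upwards [hp, hl.eventually (gt_mem_nhds (show 0 < ε / 2 * t ^ k by positivity))] with n h1 h2
    obtain ⟨a1, a2⟩ := h1 k t t0 t1
    obtain ⟨b1, b2⟩ := hq k t t0 t1
    rw [Finset.sum_range_succ] at a1 a2 b1 b2
    have hb : t ^ (k+1) ≤ ε / 2 * t ^ k := by rw [pow_succ, mul_comm]; exact mul_le_mul_of_nonneg_right t2 tk.le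
    rw [abs_lt] at h2
    rw [Real.dist_eq, ← mul_lt_mul_iff_left₀ tk, ← abs_of_pos tk, ← abs_mul, abs_of_pos tk, abs_lt, sub_mul]
    constructor <;> linarith [h2.1, h2.2]

section limit

noncomputable def qq (x : ℕ) : ℝ := ∫ z in Set.Ioi (0:ℝ), Real.exp (-z) * (z ^ x / (1 + z) ^ (x+1))

lemma inner_int (x : ℕ) {z : ℝ} (hz : 0 < z) :
    ∫ z' in Set.Ioi (0:ℝ), ((z * z') ^ x / (x.factorial : ℝ)) * Real.exp (-(z * z')) * Real.exp (-z) * Real.exp (-z') =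
      Real.exp (-z) * (z ^ x / (1 + z) ^ (x+1)) := by
  have h := Real.integral_rpow_mul_exp_neg_mul_Ioi (a := x + 1) (r := 1 + z) (by positivity) (by positivity)
  have e : ∫ z' in Set.Ioi (0:ℝ), ((z * z') ^ x / (x.factorial : ℝ)) * Real.exp (-(z * z')) * Real.exp (-z) * Real.exp (-z') =
      ∫ z' in Set.Ioi (0:ℝ), (Real.exp (-z) * (z ^ x / (x.factorial : ℝ))) * (z' ^ ((x:ℝ) + 1 - 1) * Real.exp (-((1 + z) * z'))) := by
    refine setIntegral_congr_fun measurableSet_Ioi fun z' hz' => ?_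
    simp only [add_sub_cancel_right, Real.rpow_natCast]
    rw [show -((1 + z) * z') = -(z * z') + -z' by ring, Real.exp_add]
    ring
  rw [e, integral_const_mul, h, Real.Gamma_nat_eq_factorial]
  rw [show (x:ℝ) + 1 = ((x + 1 : ℕ):ℝ) by push_cast; rfl, Real.rpow_natCast, one_div_pow]
  have : (x.factorial : ℝ) ≠ 0 := by positivity
  field_simp

lemma qq_eq (x : ℕ) : ∫ z in Set.Ioi (0:ℝ), ∫ z' in Set.Ioi (0:ℝ),
        ((z * z') ^ x / (x.factorial : ℝ)) * Real.exp (-(z * z')) * Real.exp (-z) * Real.exp (-z') = qq x :=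
  setIntegral_congr_fun measurableSet_Ioi fun z hz => inner_int x hz

lemma qq_int (x : ℕ) : Integrable (fun z : ℝ => Real.exp (-z) * (z ^ x / (1 + z) ^ (x+1))) (volume.restrict (Set.Ioi 0)) := by
  refine exp_integrable.mono' (Measurable.aestronglyMeasurable (by fun_prop)) (ae_restrict_of_forall_mem measurableSet_Ioi fun z hz => ?_)
  have hz0 : (0:ℝ) < z := hz
  rw [Real.norm_eq_abs, abs_of_nonneg (by positivity)]
  refine mul_le_of_le_one_right (Real.exp_pos _).le ?_
  rw [div_le_one (by positivity), pow_succ]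
  have h1 : z ^ x ≤ (1 + z) ^ x := pow_le_pow_left₀ hz0.le (by linarith) _
  have h2 : (0:ℝ) ≤ (1 + z) ^ x := by positivity
  nlinarith

lemma geo {t z : ℝ} (ht0 : 0 < t) (ht1 : t < 1) (hz : 0 < z) (k : ℕ) :
    1 / (1 + (1 - t) * z) - ∑ j ∈ Finset.range (k+1), z ^ j / (1 + z) ^ (j+1) * t ^ j = (t * z / (1 + z)) ^ (k+1) / (1 + (1 - t) * z) := by
  have hd : 0 < 1 + (1 - t) * z := by nlinarith
  have hz1 : (0:ℝ) < 1 + z := by linarith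
  have hr : 1 - t * z / (1 + z) = (1 + (1 - t) * z) / (1 + z) := by field_simp; ring
  have e : ∑ j ∈ Finset.range (k+1), z ^ j / (1 + z) ^ (j+1) * t ^ j = (∑ j ∈ Finset.range (k+1), (t * z / (1 + z)) ^ j) / (1 + z) := by
    rw [Finset.sum_div]
    refine Finset.sum_congr rfl fun j _ => ?_
    rw [div_pow, mul_pow, pow_succ]; field_simp
  have g := geom_sum_mul (t * z / (1 + z)) (k+1)
  rw [e]
  set r := t * z / (1 + z)
  set S := ∑ j ∈ Finset.range (k+1), r ^ j
  have g2 : S * ((1 + (1 - t) * z) / (1 + z)) = 1 - r ^ (k+1) := by rw [← hr]; linarith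
  have g3 : S / (1 + z) = (1 - r ^ (k+1)) / (1 + (1 - t) * z) := by
    rw [← g2, eq_div_iff hd.ne']; ring
  rw [g3]; ring

lemma q_tail (k : ℕ) (t : ℝ) (ht0 : 0 < t) (ht1 : t < 1) :
    0 ≤ GG (1 - t) - ∑ j ∈ Finset.range (k+1), qq j * t ^ j ∧ GG (1 - t) - ∑ j ∈ Finset.range (k+1), qq j * t ^ j ≤ t ^ (k+1) := by
  have e : GG (1 - t) - ∑ j ∈ Finset.range (k+1), qq j * t ^ j =
      ∫ z in Set.Ioi (0:ℝ), Real.exp (-z) * ((t * z / (1 + z)) ^ (k+1) / (1 + (1 - t) * z)) := by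
    have h1 : ∑ j ∈ Finset.range (k+1), qq j * t ^ j =
        ∫ z in Set.Ioi (0:ℝ), ∑ j ∈ Finset.range (k+1), Real.exp (-z) * (z ^ j / (1 + z) ^ (j+1)) * t ^ j := by
      rw [integral_finsetSum _ fun j _ => (qq_int j).mul_const _]
      refine Finset.sum_congr rfl fun j _ => ?_
      rw [integral_mul_const, qq]
    rw [h1, GG, ← integral_sub (GG_int (by linarith)) (integrable_finsetSum _ fun j _ => (qq_int j).mul_const _)]
    refine setIntegral_congr_fun measurableSet_Ioi fun z hz => ?_
    rw [← geo ht0 ht1 hz k, mul_sub, Finset.mul_sum]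
    congr 1
    exact Finset.sum_congr rfl fun j _ => by ring
  rw [e]
  have hb : ∀ z : ℝ, 0 < z → 0 ≤ Real.exp (-z) * ((t * z / (1 + z)) ^ (k+1) / (1 + (1 - t) * z)) ∧
      Real.exp (-z) * ((t * z / (1 + z)) ^ (k+1) / (1 + (1 - t) * z)) ≤ t ^ (k+1) * Real.exp (-z) := by
    intro z hz
    have hd : 1 ≤ 1 + (1 - t) * z := by nlinarith
    have r0 : 0 ≤ t * z / (1 + z) := by positivity
    have r1 : t * z / (1 + z) ≤ t := by
      rw [div_le_iff₀ (by linarith)]; nlinarith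
    have p1 := pow_le_pow_left₀ r0 r1 (k+1)
    have p0 : 0 ≤ (t * z / (1 + z)) ^ (k+1) := by positivity
    have d0 : 0 ≤ (t * z / (1 + z)) ^ (k+1) / (1 + (1 - t) * z) := div_nonneg p0 (by linarith)
    refine ⟨mul_nonneg (Real.exp_pos _).le d0, ?_⟩
    rw [mul_comm (t ^ (k+1))]
    exact mul_le_mul_of_nonneg_left ((div_le_self p0 hd).trans p1) (Real.exp_pos _).le
  constructor
  · exact setIntegral_nonneg measurableSet_Ioi fun z hz => (hb z hz).1
  · have e1 : t ^ (k+1) = ∫ z in Set.Ioi (0:ℝ), t ^ (k+1) * Real.exp (-z) := by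
      rw [integral_const_mul, integral_exp_neg_Ioi_zero, mul_one]
    conv_rhs => rw [e1]
    refine integral_mono_of_nonneg (ae_restrict_of_forall_mem measurableSet_Ioi fun z hz => (hb z hz).1) (exp_integrable.const_mul _)
      (ae_restrict_of_forall_mem measurableSet_Ioi fun z hz => (hb z hz).2)

end limit

section
variable {n : ℕ} [NeZero n]

lemma Ip_eq {ω : EdgeIdx n → ℝ} (h : ∀ x, 0 < ω x ∧ ω x < 1) (σ : Equiv.Perm (Fin n)) : Ip σ ω = ind (Accessible n σ ω) := by
  unfold Ip wI
  congr 1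
  refine propext ⟨fun hw i j hij => ?_, fun ha => ⟨fun i _ _ => h _, fun i j _ hij hj => ?_⟩⟩
  · have := hw.2 i j (by lia) hij j.2
    rwa [pe_fin, pe_fin] at this
  · have := ha (a := ⟨i, hij.trans hj⟩) (b := ⟨j, hj⟩) hij
    simp only [← pe_fin] at this
    exact this

lemma pow_X (ω : EdgeIdx n → ℝ) (t : ℝ) : ∏ σ : Equiv.Perm (Fin n), (1 - (1 - t) * ind (Accessible n σ ω)) = t ^ X n ω := by
  classical
  have : ∀ σ : Equiv.Perm (Fin n), 1 - (1 - t) * ind (Accessible n σ ω) = if Accessible n σ ω then t else 1 := by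
    intro σ
    by_cases h : Accessible n σ ω
    · rw [ind_true h, if_pos h]; ring
    · rw [ind_false h, if_neg h]; ring
  rw [Finset.prod_congr rfl fun σ _ => this σ, ← Finset.prod_filter, Finset.prod_const, X, Nat.card_eq_fintype_card, Fintype.card_subtype]

lemma X_meas : Measurable (X n) := by
  classical
  have e : X n = fun ω => ∑ σ : Equiv.Perm (Fin n), if Accessible n σ ω then 1 else 0 := by
    funext ω
    rw [X, Nat.card_eq_fintype_card, Fintype.card_subtype, Finset.card_filter]
  rw [e]
  refine Finset.measurable_sum _ fun σ _ => Measurable.ite ?_ measurable_const measurable_const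
  simp only [Accessible, StrictMono, Set.ofPred_forall]
  refine MeasurableSet.iInter fun i => MeasurableSet.iInter fun j => MeasurableSet.iInter fun _ => ?_
  exact measurableSet_lt (measurable_pi_apply _) (measurable_pi_apply _)

lemma p_tail (k : ℕ) (t : ℝ) (ht0 : 0 < t) (ht1 : t < 1) :
    0 ≤ ∫ ω, t ^ X n ω ∂(pm (EdgeIdx n)) - ∑ j ∈ Finset.range (k+1), (cubeMeasure n {ω | X n ω = j}).toReal * t ^ j ∧
      ∫ ω, t ^ X n ω ∂(pm (EdgeIdx n)) - ∑ j ∈ Finset.range (k+1), (cubeMeasure n {ω | X n ω = j}).toReal * t ^ j ≤ t ^ (k+1) := by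
  have : IsProbabilityMeasure (pm (EdgeIdx n)) := by unfold pm; infer_instance
  have hm : ∀ j, MeasurableSet {ω | X n ω = j} := fun j => X_meas (measurableSet_singleton j)
  have hi : ∀ j, (cubeMeasure n {ω | X n ω = j}).toReal = ∫ ω, ind (X n ω = j) ∂(pm (EdgeIdx n)) := by
    intro j
    have : (fun ω => ind (X n ω = j)) = Set.indicator {ω | X n ω = j} 1 := by
      classical
      funext ω
      simp [ind, Set.indicator]
    rw [this, integral_indicator_one (hm j)]
    rfl
  have bi : ∀ j, BM fun ω => ind (X n ω = j) * t ^ j := fun j =>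
    (BM.of01 (meas_ind (hm j)) fun ω => ⟨ind_nonneg _, ind_le_one _⟩).mul (BM.const _)
  have bX : BM fun ω => t ^ X n ω := by
    refine BM.of01 ?_ fun ω => ⟨by positivity, pow_le_one₀ ht0.le ht1.le⟩
    exact (measurable_of_countable fun m : ℕ => t ^ m).comp X_meas
  have e : ∫ ω, t ^ X n ω ∂(pm (EdgeIdx n)) - ∑ j ∈ Finset.range (k+1), (cubeMeasure n {ω | X n ω = j}).toReal * t ^ j =
      ∫ ω, (t ^ X n ω - ∑ j ∈ Finset.range (k+1), ind (X n ω = j) * t ^ j) ∂(pm (EdgeIdx n)) := by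
    rw [integral_sub bX.int (BM.sum _ fun j _ => bi j).int, integral_finsetSum _ fun j _ => (bi j).int]
    congr 1
    refine Finset.sum_congr rfl fun j _ => ?_
    rw [hi, integral_mul_const]
  have hb : ∀ ω, 0 ≤ (t ^ X n ω - ∑ j ∈ Finset.range (k+1), ind (X n ω = j) * t ^ j) ∧
      (t ^ X n ω - ∑ j ∈ Finset.range (k+1), ind (X n ω = j) * t ^ j) ≤ t ^ (k+1) := by
    intro ω
    generalize X n ω = m
    by_cases h : m < k + 1
    · rw [Finset.sum_eq_single m]
      · rw [ind_true rfl, one_mul, sub_self]; exact ⟨le_rfl, by positivity⟩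
      · intro j _ hj
        rw [ind_false (Ne.symm hj), zero_mul]
      · intro hh; exact absurd (Finset.mem_range.2 h) hh
    · rw [Finset.sum_eq_zero fun j hj => by
        have := Finset.mem_range.1 hj
        rw [ind_false (by lia), zero_mul], sub_zero]
      exact ⟨by positivity, pow_le_pow_of_le_one ht0.le ht1.le (by lia)⟩
  rw [e]
  refine ⟨integral_nonneg fun ω => (hb ω).1, ?_⟩
  have : ∫ ω, (t ^ X n ω - ∑ j ∈ Finset.range (k+1), ind (X n ω = j) * t ^ j) ∂(pm (EdgeIdx n)) ≤ ∫ ω, t ^ (k+1) ∂(pm (EdgeIdx n)) :=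
    integral_mono (bX.sub (BM.sum _ fun j _ => bi j)).int (integrable_const _) fun ω => (hb ω).2
  simpa using this

lemma pgf_eq (t : ℝ) : ∫ ω, t ^ X n ω ∂(pm (EdgeIdx n)) = ∫ ω, ∏ σ : Equiv.Perm (Fin n), (1 - (1 - t) * Ip σ ω) ∂(pm (EdgeIdx n)) := by
  refine integral_congr_ae (ae_coord.mono fun ω hω => ?_)
  simp only []
  rw [← pow_X]
  exact Finset.prod_congr rfl fun σ _ => by rw [Ip_eq hω]

end

theorem main_lim (x : ℕ) :
    Tendsto (fun n : ℕ => (cubeMeasure n {ω | X n ω = x}).toReal) atTop (nhds (qq x)) := by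
  refine coef_lim (p := fun n j => (cubeMeasure n {ω | X n ω = j}).toReal) (q := qq)
    (g := fun n t => ∫ ω, t ^ X n ω ∂(pm (EdgeIdx n))) (G := fun t => GG (1 - t)) ?_ q_tail ?_ x
  · filter_upwards [eventually_gt_atTop 0] with n hn k t h0 h1
    have : NeZero n := ⟨hn.ne'⟩
    exact p_tail k t h0 h1
  · intro t h0 h1
    rw [Metric.tendsto_nhds]
    intro ε hε
    filter_upwards [pgf_lim (s := 1 - t) (by linarith) (by linarith) (half_pos hε), eventually_gt_atTop 0] with n h hn
    have : NeZero n := ⟨hn.ne'⟩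
    have h' := h
    rw [Real.dist_eq, pgf_eq]
    linarith

end RHP

open RandomHypercube in
/-- As `n → ∞`, the number of accessible direct paths converges in distribution to a
mixed Poisson law with mixture `Z·Z'` for `Z, Z'` independent rate-1 exponentials. -/
theorem accessible_paths_tendsto_mixedPoisson (x : ℕ) :
    Tendsto (fun n : ℕ => (cubeMeasure n {ω | X n ω = x}).toReal) atTop
      (nhds (∫ z in Set.Ioi (0:ℝ), ∫ z' in Set.Ioi (0:ℝ),
        ((z * z') ^ x / (x.factorial : ℝ)) * Real.exp (-(z * z'))
          * Real.exp (-z) * Real.exp (-z'))) := by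
  rw [RHP.qq_eq]
  exact RHP.main_lim x
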